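/- arXiv:q-alg/9711020 — 2 statements merged into one kernel-verified Lean document; each statement's English description precedes it below -/
import Mathlib

section
/- Let a : ℕ → ℝ with a_0 = 1. The sequence a is totally positive if and only if there exist a real γ ≥ 0, sequences t, u : ℕ → ℝ with t_i ≥ 0 and u_i ≥ 0 for all i and Σ_i (t_i + u_i) < ∞, and a real ε > 0 such that for every complex number z with |z| < ε: the infinite products ∏_{i}(1 + t_i z) and ∏_{i}(1 − u_i z) converge, ∏_{i}(1 − u_i z) ≠ 0, and the series Σ_{k≥0} a_k z^k converges with sum e^{γz} · ∏_{i}(1 + t_i z) / ∏_{i}(1 − u_i z). (Theorem 2.2, Edrei's theorem on Pólya frequency sequences) -/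
/-- Extension of a sequence by `0` on negative indices. -/
noncomputable def seqExt (a : ℕ → ℝ) (k : ℤ) : ℝ := if 0 ≤ k then a k.toNat else 0

/-- A sequence is totally positive (a Pólya frequency sequence) if every minor of the
associated infinite Toeplitz matrix `‖a_{i−j}‖` is nonnegative. -/
def IsTotallyPositive (a : ℕ → ℝ) : Prop :=
  ∀ r : ℕ, 0 < r → ∀ i j : Fin r → ℕ, StrictMono i → StrictMono j →
    0 ≤ (Matrix.of fun s t => seqExt a ((i s : ℤ) - (j t : ℤ))).det

/-- A PP-sequence: a totally positive sequence all of whose minors with `j_s ≤ i_s`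
for all `s` are strictly positive. -/
def IsPP (a : ℕ → ℝ) : Prop :=
  IsTotallyPositive a ∧
    ∀ r : ℕ, 0 < r → ∀ i j : Fin r → ℕ, StrictMono i → StrictMono j →
      (∀ s, j s ≤ i s) →
      0 < (Matrix.of fun s t => seqExt a ((i s : ℤ) - (j t : ℤ))).det

section EdreiHelpers

open MeasureTheory Filter Topology

namespace Edrei

/-- Product of counting measures on `Fin r → ℕ`. -/
noncomputable def cnt (r : ℕ) : Measure (Fin r → ℕ) := Measure.pi (fun _ => Measure.count)

lemma int_count_iff {f : ℕ → ℝ} : Integrable f (Measure.count) ↔ Summable f := by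
  rw [MeasureTheory.integrable_count_iff]
  exact summable_norm_iff

/-- `dd f l = det (f_t (l_s))`. -/
noncomputable def dd {r : ℕ} (f : Fin r → ℕ → ℝ) (l : Fin r → ℕ) : ℝ :=
  (Matrix.of fun s t => f t (l s)).det

lemma dd_eq {r : ℕ} (f : Fin r → ℕ → ℝ) (l : Fin r → ℕ) :
    dd f l = ∑ σ : Equiv.Perm (Fin r), ((Equiv.Perm.sign σ : ℤ) : ℝ) * ∏ s, f (σ s) (l s) := by
  rw [dd, ← Matrix.det_transpose, Matrix.det_apply']
  rfl

lemma dd_mul_eq {r : ℕ} (f g : Fin r → ℕ → ℝ) (l : Fin r → ℕ) :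
    dd f l * dd g l = ∑ σ : Equiv.Perm (Fin r), ∑ τ : Equiv.Perm (Fin r),
      (((Equiv.Perm.sign σ : ℤ) : ℝ) * ((Equiv.Perm.sign τ : ℤ) : ℝ)) *
        ∏ s, (f (σ s) (l s) * g (τ s) (l s)) := by
  rw [dd_eq, dd_eq, Finset.sum_mul_sum]
  refine Finset.sum_congr rfl fun σ _ => Finset.sum_congr rfl fun τ _ => ?_
  rw [Finset.prod_mul_distrib]; ring

lemma integrable_term {r : ℕ} (f g : Fin r → ℕ → ℝ)
    (h : ∀ i k, Summable (fun m => f i m * g k m)) (σ τ : Equiv.Perm (Fin r)) :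
    Integrable (fun l : Fin r → ℕ => ∏ s, (f (σ s) (l s) * g (τ s) (l s))) (cnt r) := by
  unfold cnt
  exact Integrable.fintype_prod (f := fun s m => f (σ s) m * g (τ s) m)
    (fun s => int_count_iff.2 (h _ _))

lemma integrable_dd_mul {r : ℕ} (f g : Fin r → ℕ → ℝ)
    (h : ∀ i k, Summable (fun m => f i m * g k m)) :
    Integrable (fun l : Fin r → ℕ => dd f l * dd g l) (cnt r) := by
  simp_rw [dd_mul_eq]
  refine integrable_finsetSum _ fun σ _ => integrable_finsetSum _ fun τ _ => ?_
  exact (integrable_term f g h σ τ).const_mul _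

lemma andreief {r : ℕ} (f g : Fin r → ℕ → ℝ)
    (h : ∀ i k, Summable (fun m => f i m * g k m)) :
    ∫ l : Fin r → ℕ, dd f l * dd g l ∂(cnt r) =
      (r.factorial : ℝ) * (Matrix.of fun i k => ∑' m, f i m * g k m).det := by
  simp_rw [dd_mul_eq]
  rw [integral_finsetSum _ (fun σ _ => integrable_finsetSum _ fun τ _ =>
    (integrable_term f g h σ τ).const_mul _)]
  have key : ∀ σ : Equiv.Perm (Fin r),
      ∫ l : Fin r → ℕ, ∑ τ : Equiv.Perm (Fin r),
        (((Equiv.Perm.sign σ : ℤ) : ℝ) * ((Equiv.Perm.sign τ : ℤ) : ℝ)) *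
        ∏ s, (f (σ s) (l s) * g (τ s) (l s)) ∂(cnt r) =
      (Matrix.of fun i k => ∑' m, f i m * g k m).det := by
    intro σ
    rw [integral_finsetSum _ (fun τ _ => (integrable_term f g h σ τ).const_mul _)]
    have h1 : ∀ τ : Equiv.Perm (Fin r), ∫ l : Fin r → ℕ,
        (((Equiv.Perm.sign σ : ℤ) : ℝ) * ((Equiv.Perm.sign τ : ℤ) : ℝ)) *
        ∏ s, (f (σ s) (l s) * g (τ s) (l s)) ∂(cnt r) =
        ((Equiv.Perm.sign σ : ℤ) : ℝ) * (((Equiv.Perm.sign τ : ℤ) : ℝ) *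
          ∏ s, (Matrix.of fun i k => ∑' m, f i m * g k m) (σ s) (τ s)) := by
      intro τ
      rw [integral_const_mul, mul_assoc]
      congr 2
      unfold cnt
      rw [integral_fintype_prod_eq_prod (f := fun s m => f (σ s) m * g (τ s) m)]
      refine Finset.prod_congr rfl fun s _ => ?_
      rw [integral_countable (int_count_iff.2 (h _ _))]
      simp
    simp_rw [h1]
    rw [← Finset.mul_sum]
    have h2 := Matrix.det_permute σ (Matrix.of fun i k => ∑' m, f i m * g k m)
    rw [← Matrix.det_transpose, Matrix.det_apply'] at h2
    simp only [Matrix.transpose_apply, Matrix.submatrix_apply, id] at h2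
    rw [h2, ← mul_assoc]
    have : ((Equiv.Perm.sign σ : ℤ) : ℝ) * ((Equiv.Perm.sign σ : ℤ) : ℝ) = 1 := by
      rw [← Int.cast_mul, ← Units.val_mul, Int.units_mul_self]; simp
    rw [this, one_mul]
  simp_rw [key]
  simp [Finset.card_univ, Fintype.card_perm]

lemma dd_perm {r : ℕ} (f : Fin r → ℕ → ℝ) (l : Fin r → ℕ) (σ : Equiv.Perm (Fin r)) :
    dd f (l ∘ σ) = ((Equiv.Perm.sign σ : ℤ) : ℝ) * dd f l := by
  have h2 := Matrix.det_permute σ (Matrix.of fun s t => f t (l s))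
  exact h2

lemma dd_perm_mul {r : ℕ} (f g : Fin r → ℕ → ℝ) (l : Fin r → ℕ) (σ : Equiv.Perm (Fin r)) :
    dd f (l ∘ σ) * dd g (l ∘ σ) = dd f l * dd g l := by
  rw [dd_perm, dd_perm]
  have : ((Equiv.Perm.sign σ : ℤ) : ℝ) * ((Equiv.Perm.sign σ : ℤ) : ℝ) = 1 := by
    rw [← Int.cast_mul, ← Units.val_mul, Int.units_mul_self]; simp
  calc _ = (((Equiv.Perm.sign σ : ℤ) : ℝ) * ((Equiv.Perm.sign σ : ℤ) : ℝ)) * (dd f l * dd g l) := by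
        ring
    _ = _ := by rw [this, one_mul]

lemma dd_not_inj {r : ℕ} (f : Fin r → ℕ → ℝ) (l : Fin r → ℕ) (hl : ¬ Function.Injective l) :
    dd f l = 0 := by
  rw [Function.Injective] at hl
  push Not at hl
  obtain ⟨i, j, hij, hne⟩ := hl
  exact Matrix.det_zero_of_row_eq hne (by ext t; simp [hij])

lemma exists_sort {r : ℕ} (l : Fin r → ℕ) (hl : Function.Injective l) :
    ∃ σ : Equiv.Perm (Fin r), StrictMono (l ∘ σ) :=
  ⟨Tuple.sort l, (Tuple.monotone_sort l).strictMono_of_injective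
    (hl.comp (Tuple.sort l).injective)⟩

lemma dd_mul_nonneg {r : ℕ} (f g : Fin r → ℕ → ℝ)
    (h : ∀ l : Fin r → ℕ, StrictMono l → 0 ≤ dd f l * dd g l) (l : Fin r → ℕ) :
    0 ≤ dd f l * dd g l := by
  by_cases hl : Function.Injective l
  · obtain ⟨σ, hσ⟩ := exists_sort l hl
    rw [← dd_perm_mul f g l σ]
    exact h _ hσ
  · rw [dd_not_inj f l hl]; simp

end Edrei

namespace Edrei

lemma seqExt_ofNat (a : ℕ → ℝ) (k : ℕ) : seqExt a (k : ℤ) = a k := by simp [seqExt]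

lemma seqExt_neg (a : ℕ → ℝ) {k : ℤ} (hk : k < 0) : seqExt a k = 0 := by
  simp [seqExt, not_le.2 hk]

lemma seqExt_sub_le (a : ℕ → ℝ) {i j : ℕ} (h : j ≤ i) :
    seqExt a ((i : ℤ) - (j : ℤ)) = a (i - j) := by
  rw [← Int.natCast_sub h, seqExt_ofNat]

lemma seqExt_sub_lt (a : ℕ → ℝ) {i j : ℕ} (h : i < j) :
    seqExt a ((i : ℤ) - (j : ℤ)) = 0 := seqExt_neg a (by omega)

/-- Cauchy product of sequences. -/
noncomputable def cprod (a b : ℕ → ℝ) (k : ℕ) : ℝ :=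
  ∑ p ∈ Finset.HasAntidiagonal.antidiagonal k, a p.1 * b p.2

lemma hasSum_cprod (a b : ℕ → ℝ) (i j : ℕ) :
    HasSum (fun m : ℕ => seqExt a ((i : ℤ) - m) * seqExt b ((m : ℤ) - j))
      (seqExt (cprod a b) ((i : ℤ) - j)) := by
  rcases lt_or_ge i j with h | h
  · rw [seqExt_sub_lt _ h]
    convert hasSum_zero with m
    rcases lt_or_ge i m with h1 | h1
    · rw [seqExt_sub_lt _ h1, zero_mul]
    · rw [seqExt_sub_lt b (show m < j by omega), mul_zero]
  · obtain ⟨n, rfl⟩ := Nat.exists_eq_add_of_le' h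
    have h0 : seqExt (cprod a b) (((n + j : ℕ) : ℤ) - j) =
        ∑ m ∈ (Finset.range (n + 1)).map (addRightEmbedding j),
          seqExt a (((n + j : ℕ) : ℤ) - m) * seqExt b ((m : ℤ) - j) := by
      rw [seqExt_sub_le _ h, Finset.sum_map, Nat.add_sub_cancel, cprod,
        ← Finset.Nat.sum_antidiagonal_swap]
      simp only [Prod.fst_swap, Prod.snd_swap]
      rw [Finset.Nat.sum_antidiagonal_eq_sum_range_succ (fun p q => a q * b p)]
      refine Finset.sum_congr rfl fun k hk => ?_
      have hk' : k ≤ n := by simpa [Nat.lt_succ_iff] using hk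
      simp only [addRightEmbedding_apply]
      rw [seqExt_sub_le _ (by omega), seqExt_sub_le _ (by omega)]
      congr 2 <;> omega
    rw [h0]
    apply hasSum_sum_of_ne_finset_zero
    intro m hm
    simp only [Finset.mem_map, Finset.mem_range, addRightEmbedding_apply, not_exists, not_and] at hm
    rcases lt_or_ge m j with h1 | h1
    · rw [seqExt_sub_lt b h1, mul_zero]
    · have : n + j < m := by
        by_contra hc
        exact hm (m - j) (by omega) (by omega)
      rw [seqExt_sub_lt a this, zero_mul]

lemma tp_cprod {a b : ℕ → ℝ} (ha : IsTotallyPositive a) (hb : IsTotallyPositive b) :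
    IsTotallyPositive (cprod a b) := by
  intro r hr i j hi hj
  have h1 := andreief (fun t m => seqExt a ((i t : ℤ) - (m : ℤ)))
    (fun t m => seqExt b ((m : ℤ) - (j t : ℤ))) (fun s t => (hasSum_cprod a b (i s) (j t)).summable)
  have h2 : (Matrix.of fun s t => seqExt (cprod a b) ((i s : ℤ) - (j t : ℤ))) =
      (Matrix.of fun s t => ∑' m : ℕ, seqExt a ((i s : ℤ) - (m : ℤ)) *
        seqExt b ((m : ℤ) - (j t : ℤ))) := by
    ext s t
    exact (hasSum_cprod a b (i s) (j t)).tsum_eq.symm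
  rw [h2]
  have h3 : 0 ≤ ∫ l : Fin r → ℕ, dd (fun t m => seqExt a ((i t : ℤ) - (m : ℤ))) l *
      dd (fun t m => seqExt b ((m : ℤ) - (j t : ℤ))) l ∂(cnt r) := by
    apply integral_nonneg
    apply dd_mul_nonneg
    intro l hl
    apply mul_nonneg
    · rw [dd, ← Matrix.det_transpose]
      exact ha r hr i l hi hl
    · exact hb r hr l j hl hj
  rw [h1] at h3
  exact nonneg_of_mul_nonneg_right h3 (by positivity)

/-- auxiliary: TP including empty minors -/
lemma tp_geom {u : ℝ} (hu : 0 ≤ u) : IsTotallyPositive (fun k => u ^ k) := by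
  have : ∀ r : ℕ, ∀ i j : Fin r → ℕ, StrictMono i → StrictMono j →
    0 ≤ (Matrix.of fun s t => seqExt (fun k => u ^ k) ((i s : ℤ) - (j t : ℤ))).det := by
    intro r
    induction r with
    | zero => intro i j _ _; simp
    | succ r ih =>
      intro i j hi hj
      rcases lt_or_ge (i 0) (j 0) with h0 | h0
      · rw [Matrix.det_eq_zero_of_row_eq_zero 0]
        intro t
        have := hj.monotone (Fin.zero_le t)
        simp only [Matrix.of_apply]
        exact seqExt_sub_lt _ (by omega)
      · by_cases hc : ∃ t : Fin (r + 1), t ≠ 0 ∧ j t ≤ i 0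
        · obtain ⟨t, ht, hjt⟩ := hc
          have hz : (Matrix.of fun s t => seqExt (fun k => u ^ k)
              ((i s : ℤ) - (j t : ℤ))).det = 0 := by
            have h00 : j 0 ≤ j t := hj.monotone (Fin.zero_le t)
            have := Matrix.det_updateCol_add_smul_self (Matrix.of fun s t =>
              seqExt (fun k => u ^ k) ((i s : ℤ) - (j t : ℤ))) (Ne.symm ht) (-(u ^ (j t - j 0)))
            rw [← this]
            apply Matrix.det_eq_zero_of_column_eq_zero 0
            intro s
            have h2 : i 0 ≤ i s := hi.monotone (Fin.zero_le s)
            simp only [Matrix.updateCol_self, Matrix.of_apply, smul_eq_mul]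
            rw [seqExt_sub_le _ (by omega), seqExt_sub_le _ (by omega)]
            rw [show i s - j 0 = (j t - j 0) + (i s - j t) by omega, pow_add]
            ring
          rw [hz]
        · push Not at hc
          rw [Matrix.det_succ_row_zero, Finset.sum_eq_single 0]
          · apply mul_nonneg
            · simp only [Matrix.of_apply]
              rw [seqExt_sub_le _ h0]
              simp; positivity
            · exact ih _ _
                (hi.comp Fin.strictMono_succ) (hj.comp (Fin.strictMono_succAbove 0))
          · intro t _ ht
            simp only [Matrix.of_apply]
            rw [seqExt_sub_lt _ (hc t ht)]; simp
          · simp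
  intro r _ i j hi hj
  exact this r i j hi hj

/-- coefficients of `1 + t z` -/
noncomputable def lin (t : ℝ) (k : ℕ) : ℝ := if k = 0 then 1 else if k = 1 then t else 0

lemma tp_lin {t : ℝ} (ht : 0 ≤ t) : IsTotallyPositive (lin t) := by
  have : ∀ r : ℕ, ∀ i j : Fin r → ℕ, StrictMono i → StrictMono j →
    0 ≤ (Matrix.of fun s q => seqExt (lin t) ((i s : ℤ) - (j q : ℤ))).det := by
    intro r
    induction r with
    | zero => intro i j _ _; simp
    | succ r ih =>
      intro i j hi hj
      rcases lt_or_ge (i 0) (j 0) with h0 | h0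
      · rw [Matrix.det_eq_zero_of_row_eq_zero 0]
        intro q
        have := hj.monotone (Fin.zero_le q)
        simp only [Matrix.of_apply]
        exact seqExt_sub_lt _ (by omega)
      · rcases eq_or_lt_of_le h0 with h1 | h1
        · rw [Matrix.det_succ_row_zero, Finset.sum_eq_single 0]
          · apply mul_nonneg
            · simp only [Matrix.of_apply]
              rw [seqExt_sub_le _ h0]
              simp [lin, h1]
            · exact ih _ _ (hi.comp Fin.strictMono_succ) (hj.comp (Fin.strictMono_succAbove 0))
          · intro q _ hq
            simp only [Matrix.of_apply]
            have : j 0 < j q := hj (Fin.pos_of_ne_zero hq)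
            rw [seqExt_sub_lt _ (by omega)]; simp
          · simp
        · rw [Matrix.det_succ_column_zero, Finset.sum_eq_single 0]
          · apply mul_nonneg
            · simp only [Matrix.of_apply]
              rw [seqExt_sub_le _ h0]
              simp only [lin]
              split_ifs <;> simp [ht]
            · exact ih _ _ (hi.comp (Fin.strictMono_succAbove 0)) (hj.comp Fin.strictMono_succ)
          · intro q _ hq
            simp only [Matrix.of_apply]
            have : i 0 < i q := hi (Fin.pos_of_ne_zero hq)
            rw [seqExt_sub_le _ (by omega)]
            have h2 : i q - j 0 ≠ 0 := by omega
            have h3 : i q - j 0 ≠ 1 := by omega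
            simp [lin, h2, h3]
          · simp
  intro r _ i j hi hj
  exact this r i j hi hj

lemma tp_nonneg {a : ℕ → ℝ} (ha : IsTotallyPositive a) (k : ℕ) : 0 ≤ a k := by
  have := ha 1 one_pos (fun _ => k) (fun _ => 0) (Subsingleton.strictMono _)
    (Subsingleton.strictMono _)
  simpa [seqExt] using this

lemma tp_succ_le {a : ℕ → ℝ} (ha : IsTotallyPositive a) (h0 : a 0 = 1) (k : ℕ) :
    a (k + 1) ≤ a 1 * a k := by
  rcases Nat.eq_zero_or_pos k with rfl | hk
  · simp [h0]
  have := ha 2 two_pos ![1, k + 1] ![0, 1]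
    (by rw [Fin.strictMono_iff_lt_succ]; intro i; fin_cases i; simp [hk])
    (by rw [Fin.strictMono_iff_lt_succ]; intro i; fin_cases i; simp)
  rw [Matrix.det_fin_two] at this
  simp only [Matrix.of_apply, Matrix.cons_val_zero, Matrix.cons_val_one] at this
  rw [seqExt_sub_le _ (by omega), seqExt_sub_le _ (by omega), seqExt_sub_le _ (by omega),
    seqExt_sub_le _ (by omega)] at this
  simp [h0] at this
  linarith

lemma tp_le_pow {a : ℕ → ℝ} (ha : IsTotallyPositive a) (h0 : a 0 = 1) (k : ℕ) :
    a k ≤ a 1 ^ k := by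
  induction k with
  | zero => simp [h0]
  | succ k ih =>
    calc a (k + 1) ≤ a 1 * a k := tp_succ_le ha h0 k
      _ ≤ a 1 * a 1 ^ k := by gcongr; exact tp_nonneg ha 1
      _ = a 1 ^ (k + 1) := by ring

end Edrei

namespace Edrei

lemma coeff_unique {a b : ℕ → ℝ} {F : ℂ → ℂ} {ρ : ℝ} (hρ : 0 < ρ)
    (ha : ∀ z : ℂ, ‖z‖ < ρ → HasSum (fun k => (a k : ℂ) * z ^ k) (F z))
    (hb : ∀ z : ℂ, ‖z‖ < ρ → HasSum (fun k => (b k : ℂ) * z ^ k) (F z)) : a = b := by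
  have key : ∀ c : ℕ → ℝ, (∀ z : ℂ, ‖z‖ < ρ → HasSum (fun k => (c k : ℂ) * z ^ k) (F z)) →
      HasFPowerSeriesAt F (FormalMultilinearSeries.ofScalars ℂ (fun k => (c k : ℂ))) 0 := by
    intro c hc
    rw [hasFPowerSeriesAt_iff]
    filter_upwards [Metric.ball_mem_nhds (0 : ℂ) hρ] with z hz
    have := hc z (by simpa using hz)
    simpa [FormalMultilinearSeries.coeff_ofScalars, mul_comm] using this
  have h := (key a ha).eq_formalMultilinearSeries (key b hb)
  funext k
  have h2 := congrArg (fun p => FormalMultilinearSeries.coeff p k) h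
  simpa [FormalMultilinearSeries.coeff_ofScalars] using h2

lemma tp_closed {b : ℕ → ℕ → ℝ} {c : ℕ → ℝ} (hb : ∀ n, IsTotallyPositive (b n))
    (h : ∀ k, Tendsto (fun n => b n k) atTop (𝓝 (c k))) : IsTotallyPositive c := by
  intro r hr i j hi hj
  have h1 : ∀ k : ℤ, Tendsto (fun n => seqExt (b n) k) atTop (𝓝 (seqExt c k)) := by
    intro k
    unfold seqExt
    split_ifs
    · exact h _
    · exact tendsto_const_nhds
  have h2 : Tendsto (fun n => (Matrix.of fun s t => seqExt (b n) ((i s : ℤ) - (j t : ℤ))).det)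
      atTop (𝓝 ((Matrix.of fun s t => seqExt c ((i s : ℤ) - (j t : ℤ))).det)) := by
    simp_rw [Matrix.det_apply]
    refine tendsto_finsetSum _ fun σ _ => ?_
    exact (tendsto_finsetProd _ fun s _ => h1 _).const_smul _
  exact ge_of_tendsto' h2 (fun n => hb n r hr i j hi hj)

lemma tp_limit {b : ℕ → ℕ → ℝ} {a : ℕ → ℝ} {C ρ : ℝ} (hρ : 0 < ρ) {G : ℕ → ℂ → ℂ} {F : ℂ → ℂ}
    (hb : ∀ n, IsTotallyPositive (b n)) (hb0 : ∀ n, b n 0 = 1) (hb1 : ∀ n, b n 1 ≤ C)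
    (hs : ∀ n z, ‖z‖ < ρ → HasSum (fun k => (b n k : ℂ) * z ^ k) (G n z))
    (hG : ∀ z, ‖z‖ < ρ → Tendsto (fun n => G n z) atTop (𝓝 (F z)))
    (ha : ∀ z : ℂ, ‖z‖ < ρ → HasSum (fun k => (a k : ℂ) * z ^ k) (F z)) :
    IsTotallyPositive a := by
  have hC : 0 ≤ C := (tp_nonneg (hb 0) 1).trans (hb1 0)
  have hle : ∀ n k, b n k ≤ C ^ k := fun n k => (tp_le_pow (hb n) (hb0 n) k).trans
    (pow_le_pow_left₀ (tp_nonneg (hb n) 1) (hb1 n) k)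
  have hK : IsCompact (Set.univ.pi (fun k : ℕ => Set.Icc (0 : ℝ) (C ^ k))) :=
    isCompact_univ_pi fun k => isCompact_Icc
  obtain ⟨c, hc, φ, hφ, hlim⟩ := hK.tendsto_subseq (x := b)
    (fun n k _ => ⟨tp_nonneg (hb n) k, hle n k⟩)
  have hlim' : ∀ k, Tendsto (fun n => b (φ n) k) atTop (𝓝 (c k)) := by
    intro k
    exact (tendsto_pi_nhds.1 hlim) k
  have htp : IsTotallyPositive c := tp_closed (fun n => hb (φ n)) hlim'
  have hcb : ∀ k, |c k| ≤ C ^ k := fun k => by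
    have := hc k (Set.mem_univ _)
    rw [abs_of_nonneg this.1]; exact this.2
  set ρ' := min ρ (1 / (2 * (C + 1))) with hρ'
  have hρ'0 : 0 < ρ' := lt_min hρ (by positivity)
  have hsum : ∀ z : ℂ, ‖z‖ < ρ' → ∀ k, C ^ k * ‖z‖ ^ k ≤ (1 / 2) ^ k := by
    intro z hz k
    rw [← mul_pow]
    apply pow_le_pow_left₀ (by positivity)
    have h1 : ‖z‖ ≤ 1 / (2 * (C + 1)) := (hz.le.trans (min_le_right _ _))
    calc C * ‖z‖ ≤ (C + 1) * (1 / (2 * (C + 1))) := by gcongr; linarith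
      _ = 1 / 2 := by field_simp
  have hgeo : Summable (fun k : ℕ => (1 / 2 : ℝ) ^ k) := summable_geometric_two
  have hcs : ∀ z : ℂ, ‖z‖ < ρ' → HasSum (fun k => (c k : ℂ) * z ^ k) (F z) := by
    intro z hz
    have hz1 : ‖z‖ < ρ := hz.trans_le (min_le_left _ _)
    have hcsum : Summable (fun k => (c k : ℂ) * z ^ k) := by
      refine Summable.of_norm_bounded hgeo fun k => ?_
      rw [norm_mul, norm_pow, Complex.norm_real, Real.norm_eq_abs]
      exact (mul_le_mul_of_nonneg_right (hcb k) (by positivity)).trans (hsum z hz k)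
    have ht : Tendsto (fun n => ∑' k, (b (φ n) k : ℂ) * z ^ k) atTop
        (𝓝 (∑' k, (c k : ℂ) * z ^ k)) := by
      refine tendsto_tsum_of_dominated_convergence hgeo (fun k => ?_) (Eventually.of_forall ?_)
      · exact ((Complex.continuous_ofReal.tendsto _).comp (hlim' k)).mul_const _
      · intro n k
        rw [norm_mul, norm_pow, Complex.norm_real, Real.norm_eq_abs,
          abs_of_nonneg (tp_nonneg (hb _) k)]
        exact (mul_le_mul_of_nonneg_right (hle _ k) (by positivity)).trans (hsum z hz k)
    have ht2 : Tendsto (fun n => ∑' k, (b (φ n) k : ℂ) * z ^ k) atTop (𝓝 (F z)) := by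
      have : (fun n => ∑' k, (b (φ n) k : ℂ) * z ^ k) = fun n => G (φ n) z := by
        funext n; exact (hs _ z hz1).tsum_eq
      rw [this]
      exact (hG z hz1).comp hφ.tendsto_atTop
    have := tendsto_nhds_unique ht ht2
    rw [← this]
    exact hcsum.hasSum
  have : a = c := coeff_unique hρ'0 (fun z hz => ha z (hz.trans_le (min_le_left _ _))) hcs
  rw [this]; exact htp

/-- A totally positive sequence with generating function `F` on the disc of radius `ρ`. -/
def Good (ρ s : ℝ) (b : ℕ → ℝ) (F : ℂ → ℂ) : Prop :=
  IsTotallyPositive b ∧ b 0 = 1 ∧ b 1 = s ∧ ∀ z : ℂ, ‖z‖ < ρ →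
    HasSum (fun k => (b k : ℂ) * z ^ k) (F z) ∧ Summable (fun k => ‖(b k : ℂ) * z ^ k‖)

lemma Good.mul {ρ s s' : ℝ} {b b' : ℕ → ℝ} {F F' : ℂ → ℂ} (h : Good ρ s b F)
    (h' : Good ρ s' b' F') : Good ρ (s + s') (cprod b b') (fun z => F z * F' z) := by
  obtain ⟨h1, h2, h3, h4⟩ := h
  obtain ⟨h1', h2', h3', h4'⟩ := h'
  refine ⟨tp_cprod h1 h1', by simp [cprod, h2, h2'], ?_, ?_⟩
  · simp [cprod, Finset.Nat.antidiagonal_succ, h2, h2', h3, h3']; ring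
  · intro z hz
    obtain ⟨a1, a2⟩ := h4 z hz
    obtain ⟨a1', a2'⟩ := h4' z hz
    have e : ∀ k, ((cprod b b' k : ℝ) : ℂ) * z ^ k = ∑ p ∈ Finset.HasAntidiagonal.antidiagonal k,
        ((b p.1 : ℂ) * z ^ p.1) * ((b' p.2 : ℂ) * z ^ p.2) := by
      intro k
      rw [cprod]; push_cast
      rw [Finset.sum_mul]
      refine Finset.sum_congr rfl fun p hp => ?_
      rw [← Finset.HasAntidiagonal.mem_antidiagonal.1 hp, pow_add]; ring
    have hsn := summable_norm_sum_mul_antidiagonal_of_summable_norm a2 a2'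
    simp_rw [e]
    refine ⟨?_, hsn⟩
    rw [← a1.tsum_eq, ← a1'.tsum_eq,
      tsum_mul_tsum_eq_tsum_sum_antidiagonal_of_summable_norm a2 a2']
    exact hsn.of_norm.hasSum

lemma good_lin {ρ t : ℝ} (ht : 0 ≤ t) : Good ρ t (lin t) (fun z => 1 + (t : ℂ) * z) := by
  refine ⟨tp_lin ht, by simp [lin], by simp [lin], fun z _ => ?_⟩
  have h0 : ∀ k, k ∉ Finset.range 2 → (lin t k : ℂ) * z ^ k = 0 := by
    intro k hk
    have h1 : k ≠ 0 := by rintro rfl; simp at hk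
    have h2 : k ≠ 1 := by rintro rfl; simp at hk
    simp [lin, h1, h2]
  constructor
  · have h5 : HasSum (fun k => (lin t k : ℂ) * z ^ k)
        (∑ k ∈ Finset.range 2, (lin t k : ℂ) * z ^ k) := hasSum_sum_of_ne_finset_zero h0
    convert h5 using 1
    simp [Finset.sum_range_succ, lin]
  · exact summable_of_ne_finset_zero (s := Finset.range 2) (fun k hk => by rw [h0 k hk, norm_zero])

lemma good_geom {ρ u : ℝ} (hu : 0 ≤ u) (hρ : u * ρ < 1) :
    Good ρ u (fun k => u ^ k) (fun z => (1 - (u : ℂ) * z)⁻¹) := by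
  refine ⟨tp_geom hu, by simp, by simp, fun z hz => ?_⟩
  have hn : ‖(u : ℂ) * z‖ < 1 := by
    rw [norm_mul, Complex.norm_real, Real.norm_eq_abs, abs_of_nonneg hu]
    exact (mul_le_mul_of_nonneg_left hz.le hu).trans_lt hρ
  have e : ∀ k, ((u ^ k : ℝ) : ℂ) * z ^ k = ((u : ℂ) * z) ^ k := by
    intro k; push_cast; rw [mul_pow]
  simp_rw [e]
  exact ⟨hasSum_geometric_of_norm_lt_one hn, summable_norm_geometric_of_norm_lt_one hn⟩

lemma good_one {ρ : ℝ} : ∃ b, Good ρ 0 b (fun _ => 1) := ⟨_, by simpa using good_lin (ρ := ρ) le_rfl⟩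

lemma good_prod {ρ : ℝ} (s : ℕ → ℝ) (F : ℕ → ℂ → ℂ) (h : ∀ i, ∃ b, Good ρ (s i) b (F i)) (n : ℕ) :
    ∃ b, Good ρ (∑ i ∈ Finset.range n, s i) b (fun z => ∏ i ∈ Finset.range n, F i z) := by
  induction n with
  | zero => simpa using good_one
  | succ n ih =>
    obtain ⟨b, hb⟩ := ih
    obtain ⟨b', hb'⟩ := h n
    refine ⟨cprod b b', ?_⟩
    simp_rw [Finset.prod_range_succ, Finset.sum_range_succ]
    exact hb.mul hb'

theorem easy (a : ℕ → ℝ) (γ : ℝ) (hγ : 0 ≤ γ) (t u : ℕ → ℝ) (ht : ∀ i, 0 ≤ t i)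
    (hu : ∀ i, 0 ≤ u i) (hs : Summable (fun i => t i + u i)) (ε : ℝ) (hε : 0 < ε)
    (h : ∀ z : ℂ, ‖z‖ < ε →
          Multipliable (fun i => (1 + (t i : ℂ) * z)) ∧
          Multipliable (fun i => (1 - (u i : ℂ) * z)) ∧
          (∏' i, (1 - (u i : ℂ) * z)) ≠ 0 ∧
          HasSum (fun k => (a k : ℂ) * z ^ k)
            (Complex.exp ((γ : ℂ) * z) * (∏' i, (1 + (t i : ℂ) * z)) /
              (∏' i, (1 - (u i : ℂ) * z)))) : IsTotallyPositive a := by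
  set S := ∑' i, (t i + u i) with hS
  have hS0 : 0 ≤ S := tsum_nonneg fun i => add_nonneg (ht i) (hu i)
  have huS : ∀ i, u i ≤ S := fun i =>
    (le_add_of_nonneg_left (ht i)).trans (hs.le_tsum i fun j _ => add_nonneg (ht j) (hu j))
  set ρ := min ε (1 / (S + 1)) with hρ
  have hρ0 : 0 < ρ := lt_min hε (by positivity)
  have huρ : ∀ i, u i * ρ < 1 := by
    intro i
    calc u i * ρ ≤ S * (1 / (S + 1)) := by
          apply mul_le_mul (huS i) (min_le_right _ _) hρ0.le hS0
      _ < 1 := by rw [mul_one_div, div_lt_one (by positivity)]; linarith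
  have hex : ∀ n : ℕ, ∃ b, Good ρ ((∑ i ∈ Finset.range n, γ / n) +
      (∑ i ∈ Finset.range n, t i + ∑ i ∈ Finset.range n, u i)) b
      (fun z => (∏ i ∈ Finset.range n, (1 + ((γ / n : ℝ) : ℂ) * z)) *
        ((∏ i ∈ Finset.range n, (1 + (t i : ℂ) * z)) *
          ∏ i ∈ Finset.range n, (1 - (u i : ℂ) * z)⁻¹)) := by
    intro n
    obtain ⟨b1, h1⟩ := good_prod (ρ := ρ) (fun _ => γ / n)
      (fun _ z => 1 + ((γ / n : ℝ) : ℂ) * z) (fun i => ⟨_, good_lin (by positivity)⟩) n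
    obtain ⟨b2, h2⟩ := good_prod (ρ := ρ) t
      (fun i z => 1 + (t i : ℂ) * z) (fun i => ⟨_, good_lin (ht i)⟩) n
    obtain ⟨b3, h3⟩ := good_prod (ρ := ρ) u
      (fun i z => (1 - (u i : ℂ) * z)⁻¹) (fun i => ⟨_, good_geom (hu i) (huρ i)⟩) n
    exact ⟨_, h1.mul (h2.mul h3)⟩
  choose b hb using hex
  refine tp_limit (C := γ + S) hρ0 (fun n => (hb n).1) (fun n => (hb n).2.1) ?_
    (fun n z hz => ((hb n).2.2.2 z hz).1) ?_
    (fun z hz => (h z (hz.trans_le (min_le_left _ _))).2.2.2)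
  · intro n
    rw [(hb n).2.2.1, ← Finset.sum_add_distrib]
    apply add_le_add
    · rw [Finset.sum_const, Finset.card_range, nsmul_eq_mul]
      rcases Nat.eq_zero_or_pos n with rfl | hn
      · simpa using hγ
      · field_simp; exact le_rfl
    · exact hs.sum_le_tsum _ (fun j _ => add_nonneg (ht j) (hu j))
  · intro z hz
    obtain ⟨m1, m2, m3, -⟩ := h z (hz.trans_le (min_le_left _ _))
    rw [mul_div_assoc, div_eq_mul_inv]
    refine Tendsto.mul ?_ (m1.hasProd.tendsto_prod_nat.mul ?_)
    · have := Complex.tendsto_one_add_div_pow_exp ((γ : ℂ) * z)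
      refine this.congr fun n => ?_
      rw [Finset.prod_const, Finset.card_range]
      push_cast
      ring
    · have := (m2.hasProd.tendsto_prod_nat.inv₀ m3)
      refine this.congr fun n => ?_
      rw [Finset.prod_inv_distrib]

end Edrei

namespace Edrei

lemma det_block {n : ℕ} (M : Matrix (Fin (n + 2)) (Fin (n + 2)) ℝ)
    (h0 : ∀ k : Fin n, M 0 k.succ.succ = 0) (h1 : ∀ k : Fin n, M 1 k.succ.succ = 0) :
    M.det = (M 0 0 * M 1 1 - M 0 1 * M 1 0) *
      (M.submatrix (fun i : Fin n => i.succ.succ) (fun i : Fin n => i.succ.succ)).det := by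
  rw [Matrix.det_succ_row_zero, Fin.sum_univ_succ, Fin.sum_univ_succ]
  have hz : ∀ k : Fin n, (-1 : ℝ) ^ ((k.succ.succ : Fin (n + 2)) : ℕ) * M 0 k.succ.succ *
      (M.submatrix Fin.succ (Fin.succAbove k.succ.succ)).det = 0 := by
    intro k; rw [h0]; simp
  rw [Finset.sum_eq_zero (fun k _ => hz k)]
  have hA : (M.submatrix Fin.succ (Fin.succAbove (0 : Fin (n + 2)))).det = M 1 1 *
      (M.submatrix (fun i : Fin n => i.succ.succ) (fun i : Fin n => i.succ.succ)).det := by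
    rw [Matrix.det_succ_row_zero, Fin.sum_univ_succ, Finset.sum_eq_zero]
    · simp [Matrix.submatrix_submatrix, Function.comp_def]
    · intro k _
      have : (M.submatrix Fin.succ (Fin.succAbove (0 : Fin (n + 2)))) 0 k.succ = 0 := by
        simpa using h1 k
      rw [this]; simp
  have hB : (M.submatrix Fin.succ (Fin.succAbove (Fin.succ 0 : Fin (n + 2)))).det = M 1 0 *
      (M.submatrix (fun i : Fin n => i.succ.succ) (fun i : Fin n => i.succ.succ)).det := by
    rw [Matrix.det_succ_row_zero, Fin.sum_univ_succ, Finset.sum_eq_zero]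
    · simp [Matrix.submatrix_submatrix, Function.comp_def]
    · intro k _
      have : (M.submatrix Fin.succ (Fin.succAbove (Fin.succ 0 : Fin (n + 2)))) 0 k.succ = 0 := by
        simpa using h1 k
      rw [this]; simp
  rw [hA, hB]
  simp
  ring

/-- `(-Δ)^p` -/
noncomputable def dop (p : ℕ) (g : ℕ → ℝ) (m : ℕ) : ℝ := (-1) ^ p * ((fwdDiff (1 : ℕ))^[p] g m)

lemma dop_eq (p : ℕ) (g : ℕ → ℝ) (m : ℕ) :
    dop p g m = ∑ j ∈ Finset.range (p + 1), (-1) ^ j * (p.choose j : ℝ) * g (m + j) := by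
  rw [dop, fwdDiff_iter_eq_sum_shift, Finset.mul_sum]
  refine Finset.sum_congr rfl fun j hj => ?_
  have hj' : j ≤ p := by simpa [Nat.lt_succ_iff] using hj
  obtain ⟨q, rfl⟩ := Nat.exists_eq_add_of_le hj'
  simp only [zsmul_eq_mul, smul_eq_mul, mul_one, Nat.add_sub_cancel_left]
  push_cast
  have : ((-1 : ℝ) ^ q) * (-1) ^ q = 1 := by rw [← mul_pow]; simp
  rw [pow_add]
  linear_combination ((-1 : ℝ) ^ j * ((j + q).choose j : ℝ) * g (m + j)) * this

lemma dop_pow {p k : ℕ} (h : k < p) (m : ℕ) : dop p (fun m => (m : ℝ) ^ k) m = 0 := by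
  have h1 := fwdDiff_iter_pow_eq_zero_of_lt (R := ℝ) h
  have h2 := congrFun h1 (m : ℝ)
  rw [fwdDiff_iter_eq_sum_shift] at h2
  rw [dop, fwdDiff_iter_eq_sum_shift]
  simp only [smul_eq_mul, mul_one, nsmul_eq_mul, Pi.zero_apply, Nat.cast_add] at h2 ⊢
  rw [h2, mul_zero]

lemma dop_succ (p : ℕ) (g : ℕ → ℝ) (m : ℕ) : dop (p + 1) g m = dop p g m - dop p g (m + 1) := by
  simp only [dop, Function.iterate_succ_apply', fwdDiff]
  ring

/-- rising product `v (v+1) ⋯ (v+N-1)` -/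
noncomputable def rp (N : ℕ) (v : ℝ) : ℝ := ∏ r ∈ Finset.range N, (v + r)

lemma rp_pos (N : ℕ) {v : ℝ} (hv : 0 < v) : 0 < rp N v :=
  Finset.prod_pos fun r _ => by positivity

lemma rp_succ (N : ℕ) (v : ℝ) : rp (N + 1) v = rp N v * (v + N) := Finset.prod_range_succ _ _

lemma rp_succ' (N : ℕ) (v : ℝ) : rp (N + 1) v = v * rp N (v + 1) := by
  rw [rp, Finset.prod_range_succ', mul_comm, rp]
  congr 1
  · simp
  · refine Finset.prod_congr rfl fun r _ => ?_
    push_cast; ring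

lemma dop_inv {v : ℝ} (hv : 0 < v) (p m : ℕ) :
    dop p (fun m => 1 / (v + m)) m = (p.factorial : ℝ) / rp (p + 1) (v + m) := by
  induction p generalizing m with
  | zero => simp [dop, rp]
  | succ p ih =>
    rw [dop_succ, ih, ih, rp_succ' (p + 1), rp_succ (p) (v + ((m + 1 : ℕ) : ℝ)), rp_succ' p (v + m)]
    rw [rp_succ p]
    have e : v + ((m + 1 : ℕ) : ℝ) = v + m + 1 := by push_cast; ring
    rw [e, Nat.factorial_succ]
    have h1 : 0 < rp p (v + m + 1) := rp_pos _ (by positivity)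
    have h2 : 0 < v + m := by positivity
    have h3 : 0 < v + m + 1 + p := by positivity
    push_cast
    field_simp
    ring

lemma dop_sub (p : ℕ) (f g : ℕ → ℝ) (c : ℝ) (m : ℕ) :
    dop p (fun m => c * (f m - g m)) m = c * (dop p f m - dop p g m) := by
  simp only [dop_eq, mul_sub, Finset.mul_sum, ← Finset.sum_sub_distrib]
  refine Finset.sum_congr rfl fun j _ => by ring

/-- `Λ` functional -/
noncomputable def lam (a : ℕ → ℝ) (p : ℕ) (g : ℕ → ℝ) : ℝ := ∑' m, a m * dop p g m

/-- A function is tame for `a` if all its shifts are summable against `a`. -/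
def Tame (a g : ℕ → ℝ) : Prop := ∀ j : ℕ, Summable (fun m => a m * g (m + j))

lemma tame_dop {a g : ℕ → ℝ} (h : Tame a g) (p : ℕ) : Summable (fun m => a m * dop p g m) := by
  simp_rw [dop_eq, Finset.mul_sum]
  refine summable_sum fun j _ => ?_
  refine ((h j).mul_left ((-1) ^ j * (p.choose j : ℝ))).congr fun m => by ring

lemma hasSum_shift {a g : ℕ → ℝ} (h : Tame a g) (j : ℕ) :
    HasSum (fun m : ℕ => seqExt a ((m : ℤ) - (j : ℤ)) * g m) (∑' m, a m * g (m + j)) := by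
  have hinj : Function.Injective (fun m : ℕ => m + j) := add_left_injective j
  rw [← hinj.hasSum_iff]
  · convert (h j).hasSum using 2 with m
    simp only [Function.comp]
    rw [seqExt_sub_le _ (by omega)]; simp
  · intro m hm
    have : m < j := by
      by_contra hc
      exact hm ⟨m - j, by simp; omega⟩
    rw [seqExt_sub_lt _ this, zero_mul]

/-- functions `f_i(m) = a_{m-i}` -/
noncomputable def fA (a : ℕ → ℝ) {N : ℕ} (i : Fin N) (m : ℕ) : ℝ := seqExt a ((m : ℤ) - ((i : ℕ) : ℤ))

/-- Change of basis matrix. -/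
noncomputable def Rm (n : ℕ) : Matrix (Fin (n + 2)) (Fin (n + 2)) ℝ :=
  Matrix.of fun i j => (-1) ^ (j : ℕ) * ((n + 1 - (i : ℕ)).choose (j : ℕ) : ℝ)

lemma Rm_det (n : ℕ) : (Rm n).det ≠ 0 := by
  set T : Matrix (Fin (n + 2)) (Fin (n + 2)) ℝ :=
    Matrix.of fun i j => (-1) ^ (j : ℕ) * (((i : ℕ)).choose (j : ℕ) : ℝ) with hT
  have hTdet : T.det ≠ 0 := by
    rw [Matrix.det_of_isLowerTriangular T]
    · rw [Finset.prod_ne_zero_iff]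
      intro i _
      simp [hT]
    · intro i j hij
      have : (i : ℕ) < (j : ℕ) := by simpa using hij
      simp [hT, Nat.choose_eq_zero_of_lt this]
  have : Rm n = T.submatrix Fin.revPerm id := by
    ext i j
    simp [Rm, hT, Fin.val_rev]
  rw [this, Matrix.det_permute]
  refine mul_ne_zero ?_ hTdet
  exact_mod_cast (Equiv.Perm.sign (Fin.revPerm (n := n + 2))).ne_zero

lemma Rm_mul {a : ℕ → ℝ} {n : ℕ} (g : Fin (n + 2) → ℕ → ℝ) (hg : ∀ k, Tame a (g k))
    (i k : Fin (n + 2)) :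
    (Rm n * (Matrix.of fun i k => ∑' m, fA a i m * g k m :
      Matrix (Fin (n + 2)) (Fin (n + 2)) ℝ)) i k = lam a (n + 1 - (i : ℕ)) (g k) := by
  rw [Matrix.mul_apply]
  simp only [Rm, Matrix.of_apply, fA]
  simp_rw [fun j : Fin (n + 2) => (hasSum_shift (hg k) (j : ℕ)).tsum_eq]
  rw [Fin.sum_univ_eq_sum_range (fun j => (-1 : ℝ) ^ j * ((n + 1 - (i : ℕ)).choose j : ℝ) *
    ∑' m, a m * g k (m + j)) (n + 2), lam]
  simp_rw [dop_eq, Finset.mul_sum]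
  rw [Summable.tsum_finsetSum]
  · rw [← Finset.sum_subset (s₁ := Finset.range (n + 1 - (i : ℕ) + 1)) (s₂ := Finset.range (n + 2))]
    · refine Finset.sum_congr rfl fun j _ => ?_
      rw [← tsum_mul_left]
      refine tsum_congr fun m => by ring
    · intro j hj; simp at hj ⊢; omega
    · intro j _ hj
      have : n + 1 - (i : ℕ) < j := by simp at hj; omega
      simp [Nat.choose_eq_zero_of_lt this]
  · intro j _
    refine ((hg k j).mul_left ((-1) ^ j * ((n + 1 - (i : ℕ)).choose j : ℝ))).congr fun m => by ring

/-- The columns: two special functions, then monomials. -/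
noncomputable def sp (v w : ℝ) {n : ℕ} (k : Fin (n + 2)) : ℕ → ℝ :=
  Fin.cases (fun m => 1 / ((v + m) * (w + m)))
    (fun k' => Fin.cases (fun m => 1 / (w + m)) (fun k'' m => (m : ℝ) ^ (k'' : ℕ)) k') k

/-- Vandermonde functions -/
noncomputable def pw {N : ℕ} (k : Fin N) (m : ℕ) : ℝ := (m : ℝ) ^ (k : ℕ)

open Polynomial in
lemma dd_sp {v w : ℝ} (hv : 0 < v) (hw : 0 < w) {n : ℕ} (l : Fin (n + 2) → ℕ) :
    dd (sp v w) l = dd pw l * ((∏ s, (1 / (v + l s))) * ∏ s, (1 / (w + l s))) := by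
  set p : Fin (n + 2) → ℝ[X] := fun k => Fin.cases 1
    (fun k' => Fin.cases (X + C v) (fun k'' => (X + C v) * (X + C w) * X ^ (k'' : ℕ)) k') k with hp
  have p0 : p 0 = 1 := rfl
  have p1 : p (Fin.succ 0) = X + C v := rfl
  have p2 : ∀ k : Fin n, p k.succ.succ = (X + C v) * (X + C w) * X ^ (k : ℕ) := fun k => rfl
  have s0 : sp v w (0 : Fin (n + 2)) = fun m : ℕ => 1 / ((v + m) * (w + m)) := rfl
  have s1 : sp v w (Fin.succ 0 : Fin (n + 2)) = fun m : ℕ => 1 / (w + m) := rfl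
  have s2 : ∀ k : Fin n, sp v w (k.succ.succ : Fin (n + 2)) = fun m : ℕ => (m : ℝ) ^ (k : ℕ) :=
    fun k => rfl
  have hmon : ∀ k, (p k).Monic := by
    intro k
    refine Fin.cases ?_ (fun k' => ?_) k
    · rw [p0]; exact monic_one
    · refine Fin.cases ?_ (fun k'' => ?_) k'
      · rw [p1]; exact monic_X_add_C v
      · rw [p2]; exact ((monic_X_add_C v).mul (monic_X_add_C w)).mul (monic_X_pow _)
  have hdeg : ∀ k, (p k).natDegree = k := by
    intro k
    refine Fin.cases ?_ (fun k' => ?_) k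
    · rw [p0]; simp
    · refine Fin.cases ?_ (fun k'' => ?_) k'
      · rw [p1]; simp
      · rw [p2]
        rw [((monic_X_add_C v).mul (monic_X_add_C w)).natDegree_mul (monic_X_pow _),
          (monic_X_add_C v).natDegree_mul (monic_X_add_C w)]
        simp; ring
  have h1 := Matrix.det_eval_matrixOfPolynomials_eq_det_vandermonde
    (fun s => (l s : ℝ)) p hdeg hmon
  have h2 : dd pw l = (Matrix.vandermonde (fun s => (l s : ℝ))).det := by
    rw [dd]; rfl
  rw [h2, h1, ← Finset.prod_mul_distrib, mul_comm, ← Matrix.det_mul_column, dd]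
  congr 1
  ext s k
  have e1 : v + (l s : ℝ) ≠ 0 := by positivity
  have e2 : w + (l s : ℝ) ≠ 0 := by positivity
  simp only [Matrix.of_apply]
  clear_value p
  refine Fin.cases ?_ (fun k' => ?_) k
  · rw [p0, s0]; simp only [Polynomial.eval_one]; field_simp
  · refine Fin.cases ?_ (fun k'' => ?_) k'
    · rw [p1, s1]; simp only [eval_add, eval_X, eval_C]; field_simp; ring
    · rw [p2, s2]; simp only [eval_add, eval_X, eval_C, eval_mul, eval_pow]; field_simp; ring

end Edrei

namespace Edrei

lemma summable_succ_pow (k : ℕ) : Summable (fun m : ℕ => ((m : ℝ) + 1) ^ k * (1 / 2 : ℝ) ^ m) := by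
  have h := summable_pow_mul_geometric_of_norm_lt_one k (r := (1 / 2 : ℝ)) (by norm_num)
  have h2 := ((summable_nat_add_iff 1).2 h).mul_left 2
  refine h2.congr fun m => ?_
  push_cast
  rw [pow_succ]; ring

/-- standing assumptions on `a` -/
structure Std (a : ℕ → ℝ) : Prop where
  tp : IsTotallyPositive a
  zero : a 0 = 1
  bd : ∀ k, a k ≤ (1 / 2) ^ k

lemma Std.nonneg {a : ℕ → ℝ} (h : Std a) (k : ℕ) : 0 ≤ a k := tp_nonneg h.tp k

lemma Std.tame {a : ℕ → ℝ} (h : Std a) {g : ℕ → ℝ} (C : ℝ) (k : ℕ)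
    (hg : ∀ m : ℕ, |g m| ≤ C * ((m : ℝ) + 1) ^ k) : Tame a g := by
  intro j
  have hC : 0 ≤ C := by
    have := (abs_nonneg _).trans (hg 0)
    simpa using this
  refine Summable.of_norm_bounded (((summable_succ_pow k).mul_left (C * ((j : ℝ) + 1) ^ k))) ?_
  intro m
  rw [norm_mul, Real.norm_eq_abs, Real.norm_eq_abs, abs_of_nonneg (h.nonneg m)]
  have h1 : |g (m + j)| ≤ C * (((j : ℝ) + 1) ^ k * ((m : ℝ) + 1) ^ k) := by
    refine (hg _).trans ?_
    rw [← mul_pow]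
    gcongr
    push_cast
    have : 0 ≤ (j : ℝ) * m := by positivity
    linarith
  calc a m * |g (m + j)| ≤ (1 / 2) ^ m * (C * (((j : ℝ) + 1) ^ k * ((m : ℝ) + 1) ^ k)) :=
        mul_le_mul (h.bd m) h1 (abs_nonneg _) (by positivity)
    _ = _ := by ring

lemma Std.tame_inv {a : ℕ → ℝ} (h : Std a) {v : ℝ} (hv : 0 < v) :
    Tame a (fun m => 1 / (v + m)) := by
  refine h.tame (1 / v) 0 fun m => ?_
  rw [abs_of_pos (by positivity)]
  simp only [pow_zero, mul_one]
  gcongr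
  simp

lemma Std.tame_inv2 {a : ℕ → ℝ} (h : Std a) {v w : ℝ} (hv : 0 < v) (hw : 0 < w) :
    Tame a (fun m => 1 / ((v + m) * (w + m))) := by
  refine h.tame (1 / (v * w)) 0 fun m => ?_
  rw [abs_of_pos (by positivity)]
  simp only [pow_zero, mul_one]
  gcongr <;> simp

lemma Std.tame_pow {a : ℕ → ℝ} (h : Std a) (k : ℕ) : Tame a (fun m => (m : ℝ) ^ k) := by
  refine h.tame 1 k fun m => ?_
  rw [abs_of_nonneg (by positivity), one_mul]
  gcongr
  simp

lemma Std.tame_sp {a : ℕ → ℝ} (h : Std a) {v w : ℝ} (hv : 0 < v) (hw : 0 < w) {n : ℕ}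
    (k : Fin (n + 2)) : Tame a (sp v w k) := by
  refine Fin.cases ?_ (fun k' => ?_) k
  · exact h.tame_inv2 hv hw
  · refine Fin.cases ?_ (fun k'' => ?_) k'
    · exact h.tame_inv hw
    · exact h.tame_pow _

/-- weight -/
noncomputable def Wt (a : ℕ → ℝ) (n : ℕ) (l : Fin (n + 2) → ℕ) : ℝ :=
  dd (fA a : Fin (n + 2) → ℕ → ℝ) l * dd pw l

lemma summable_fA {a g : ℕ → ℝ} (h : Tame a g) {N : ℕ} (i : Fin N) :
    Summable (fun m => fA a i m * g m) := (hasSum_shift h (i : ℕ)).summable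

lemma lam_inv2 {a : ℕ → ℝ} (h : Std a) {v w : ℝ} (hv : 0 < v) (hw : 0 < w) (hvw : v ≠ w) (p : ℕ) :
    lam a p (fun m => 1 / ((v + m) * (w + m))) =
      1 / (w - v) * (lam a p (fun m => 1 / (v + m)) - lam a p (fun m => 1 / (w + m))) := by
  have e : (fun m : ℕ => 1 / ((v + m) * (w + m))) =
      fun m : ℕ => 1 / (w - v) * (1 / (v + m) - 1 / (w + m)) := by
    ext m
    have h1 : v + (m : ℝ) ≠ 0 := by positivity
    have h2 : w + (m : ℝ) ≠ 0 := by positivity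
    have h3 : w - v ≠ 0 := sub_ne_zero.2 hvw.symm
    field_simp
    ring
  rw [e]
  simp only [lam]
  simp_rw [dop_sub p (fun m : ℕ => 1 / (v + m)) (fun m : ℕ => 1 / (w + m))]
  rw [← (tame_dop (h.tame_inv hv) p).tsum_sub (tame_dop (h.tame_inv hw) p), ← tsum_mul_left]
  refine tsum_congr fun m => by ring

lemma lam_pow {a : ℕ → ℝ} {p k : ℕ} (hk : k < p) : lam a p (fun m => (m : ℝ) ^ k) = 0 := by
  simp [lam, dop_pow hk]

lemma key_id {a : ℕ → ℝ} (h : Std a) (n : ℕ) : ∃ K : ℝ, ∀ v w : ℝ, 0 < v → 0 < w → v ≠ w →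
    ∫ l, Wt a n l * ((∏ s, (1 / (v + l s))) * ∏ s, (1 / (w + l s))) ∂(cnt (n + 2)) =
      K / (w - v) * (lam a (n + 1) (fun m => 1 / (v + m)) * lam a n (fun m => 1 / (w + m)) -
        lam a (n + 1) (fun m => 1 / (w + m)) * lam a n (fun m => 1 / (v + m))) := by
  set B : ℝ := (Matrix.of fun i k : Fin n =>
    lam a (n + 1 - ((i.succ.succ : Fin (n + 2)) : ℕ)) (fun m => (m : ℝ) ^ (k : ℕ))).det with hB
  refine ⟨((n + 2).factorial : ℝ) * B / (Rm n).det, fun v w hv hw hvw => ?_⟩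
  have h1 : ∀ l : Fin (n + 2) → ℕ, Wt a n l * ((∏ s, (1 / (v + l s))) * ∏ s, (1 / (w + l s))) =
      dd (fA a : Fin (n + 2) → ℕ → ℝ) l * dd (sp v w) l := by
    intro l
    rw [dd_sp hv hw, Wt]; ring
  simp_rw [h1]
  rw [andreief _ _ (fun i k => summable_fA (h.tame_sp hv hw k) i)]
  set M : Matrix (Fin (n + 2)) (Fin (n + 2)) ℝ :=
    Matrix.of fun i k => ∑' m, fA a i m * sp v w k m with hM
  have hRM : ∀ i k, (Rm n * M) i k = lam a (n + 1 - (i : ℕ)) (sp v w k) := fun i k =>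
    Rm_mul (sp v w) (fun k => h.tame_sp hv hw k) i k
  have hdet := det_block (Rm n * M) (fun k => by
      rw [hRM]
      exact lam_pow (show (k : ℕ) < n + 1 - 0 by omega)) (fun k => by
      rw [hRM]
      refine lam_pow (show (k : ℕ) < n + 1 - ((1 : Fin (n + 2)) : ℕ) from ?_)
      simp)
  rw [Matrix.det_mul] at hdet
  have hsub : ((Rm n * M).submatrix (fun i : Fin n => i.succ.succ) (fun i : Fin n => i.succ.succ)).det
      = B := by
    rw [hB]
    congr 1
    ext i k
    rw [Matrix.submatrix_apply, hRM]
    rfl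
  rw [hsub, hRM, hRM, hRM, hRM] at hdet
  have s0 : sp v w (0 : Fin (n + 2)) = fun m : ℕ => 1 / ((v + m) * (w + m)) := rfl
  have s1 : sp v w (1 : Fin (n + 2)) = fun m : ℕ => 1 / (w + m) := rfl
  rw [s0, s1, lam_inv2 h hv hw hvw, lam_inv2 h hv hw hvw] at hdet
  have e0 : n + 1 - ((0 : Fin (n + 2)) : ℕ) = n + 1 := by simp
  have e1 : n + 1 - ((1 : Fin (n + 2)) : ℕ) = n := by simp
  rw [e0, e1] at hdet
  have hR := Rm_det n
  have h3 : w - v ≠ 0 := sub_ne_zero.2 hvw.symm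
  have : M.det = (Rm n).det * M.det / (Rm n).det := by field_simp
  rw [this, hdet]
  field_simp
  ring

/-- normalized sums -/
noncomputable def SS (a : ℕ → ℝ) (N : ℕ) (v : ℝ) : ℝ := ∑' m : ℕ, a m * (rp N v / rp N (v + m))

lemma lam_inv {a : ℕ → ℝ} {v : ℝ} (hv : 0 < v) (p : ℕ) :
    lam a p (fun m => 1 / (v + m)) = (p.factorial : ℝ) / rp (p + 1) v * SS a (p + 1) v := by
  rw [lam, SS, ← tsum_mul_left]
  refine tsum_congr fun m => ?_
  rw [dop_inv hv]
  have h1 := rp_pos (p + 1) hv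
  have h2 : 0 < rp (p + 1) (v + m) := rp_pos (p + 1) (by positivity)
  field_simp

/-- observable -/
noncomputable def FF {N : ℕ} (l : Fin N → ℕ) (v : ℝ) : ℝ := rp N v * ∏ s, (1 / (v + l s))

lemma key_id2 {a : ℕ → ℝ} (h : Std a) (n : ℕ) : ∃ K : ℝ, ∀ v w : ℝ, 0 < v → 0 < w → v ≠ w →
    ∫ l, Wt a n l * (FF l v * FF l w) ∂(cnt (n + 2)) =
      K / (w - v) * ((w + (n + 1)) * (SS a (n + 1) w * SS a (n + 2) v) -
        (v + (n + 1)) * (SS a (n + 1) v * SS a (n + 2) w)) := by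
  obtain ⟨K, hK⟩ := key_id h n
  refine ⟨K * ((n + 1).factorial : ℝ) * (n.factorial : ℝ), fun v w hv hw hvw => ?_⟩
  have e : ∀ l : Fin (n + 2) → ℕ, Wt a n l * (FF l v * FF l w) = (rp (n + 2) v * rp (n + 2) w) *
      (Wt a n l * ((∏ s, (1 / (v + l s))) * ∏ s, (1 / (w + l s)))) := by
    intro l; simp only [FF]; ring
  simp_rw [e]
  rw [integral_const_mul, hK v w hv hw hvw, lam_inv hv, lam_inv hv, lam_inv hw, lam_inv hw,
    rp_succ (n + 1) v, rp_succ (n + 1) w]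
  have h1 := rp_pos (n + 1) hv
  have h2 := rp_pos (n + 1) hw
  have h3 : w - v ≠ 0 := sub_ne_zero.2 hvw.symm
  push_cast
  have h4 : 0 < v + (n + 1) := by positivity
  have h5 : 0 < w + (n + 1) := by positivity
  field_simp

lemma Wt_integrable {a : ℕ → ℝ} (h : Std a) (n : ℕ) : Integrable (Wt a n) (cnt (n + 2)) :=
  integrable_dd_mul _ _ (fun i k => summable_fA (h.tame_pow (k : ℕ)) i)

lemma vander_pos {N : ℕ} (l : Fin N → ℕ) (hl : StrictMono l) : 0 < dd pw l := by
  have h2 : dd pw l = (Matrix.vandermonde (fun s => (l s : ℝ))).det := rfl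
  rw [h2, Matrix.det_vandermonde]
  refine Finset.prod_pos fun i _ => Finset.prod_pos fun j hj => ?_
  have : l i < l j := hl (by simpa using hj)
  have : (l i : ℝ) < l j := by exact_mod_cast this
  linarith

lemma fA_nonneg {a : ℕ → ℝ} (h : Std a) (n : ℕ) (l : Fin (n + 2) → ℕ) (hl : StrictMono l) :
    0 ≤ dd (fA a : Fin (n + 2) → ℕ → ℝ) l :=
  h.tp (n + 2) (by omega) l (fun i => (i : ℕ)) hl (fun i j hij => hij)

lemma Wt_nonneg {a : ℕ → ℝ} (h : Std a) (n : ℕ) (l : Fin (n + 2) → ℕ) : 0 ≤ Wt a n l :=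
  dd_mul_nonneg _ _ (fun l hl => mul_nonneg (fA_nonneg h n l hl) (vander_pos l hl).le) l

lemma Wt_id_pos {a : ℕ → ℝ} (h : Std a) (n : ℕ) :
    0 < Wt a n (fun i : Fin (n + 2) => (i : ℕ)) := by
  refine mul_pos ?_ (vander_pos _ (fun i j hij => hij))
  have : dd (fA a : Fin (n + 2) → ℕ → ℝ) (fun i : Fin (n + 2) => (i : ℕ)) = 1 := by
    rw [dd, Matrix.det_of_isLowerTriangular]
    · refine Finset.prod_eq_one fun i _ => ?_
      simp [fA, seqExt, h.zero]
    · intro i j hij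
      have : (i : ℕ) < (j : ℕ) := by simpa using hij
      simp only [Matrix.of_apply, fA]
      exact seqExt_sub_lt _ this
  rw [this]; exact one_pos

lemma Wt_inj {a : ℕ → ℝ} {n : ℕ} {l : Fin (n + 2) → ℕ} (hl : Wt a n l ≠ 0) :
    Function.Injective l := by
  by_contra hc
  exact hl (by rw [Wt, dd_not_inj _ _ hc, zero_mul])

lemma Wt_int_pos {a : ℕ → ℝ} (h : Std a) (n : ℕ) : 0 < ∫ l, Wt a n l ∂(cnt (n + 2)) := by
  rw [integral_pos_iff_support_of_nonneg (Wt_nonneg h n) (Wt_integrable h n)]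
  refine lt_of_lt_of_le ?_ (measure_mono (s := {(fun i : Fin (n + 2) => (i : ℕ))}) ?_)
  · rw [cnt, Measure.pi_singleton]
    simp
  · intro l hl
    rw [Set.mem_singleton_iff.1 hl]
    exact (Wt_id_pos h n).ne'

end Edrei

namespace Edrei

lemma FF_eq {N : ℕ} (l : Fin N → ℕ) (v : ℝ) :
    FF l v = ∏ s : Fin N, ((v + (s : ℕ)) / (v + l s)) := by
  rw [FF, rp, Finset.prod_range, ← Finset.prod_mul_distrib]
  refine Finset.prod_congr rfl fun s _ => by ring

lemma FF_perm {N : ℕ} (l : Fin N → ℕ) (σ : Equiv.Perm (Fin N)) (v : ℝ) :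
    FF (l ∘ σ) v = FF l v := by
  rw [FF, FF]
  congr 1
  exact Equiv.prod_comp σ (fun s => 1 / (v + (l s : ℝ)))

lemma FF_pos {N : ℕ} (l : Fin N → ℕ) {v : ℝ} (hv : 0 < v) : 0 < FF l v := by
  rw [FF_eq]
  exact Finset.prod_pos fun s _ => by positivity

lemma le_of_strictMono {N : ℕ} {l : Fin N → ℕ} (hl : StrictMono l) (s : Fin N) : (s : ℕ) ≤ l s := by
  obtain ⟨s, hs⟩ := s
  induction s with
  | zero => simp
  | succ s ih =>
    have h1 := ih (by omega)
    have h2 : l ⟨s, by omega⟩ < l ⟨s + 1, hs⟩ := hl (by simp)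
    simp only at h1 ⊢
    omega

lemma FF_mono {N : ℕ} {l : Fin N → ℕ} (hl : Function.Injective l) {v w : ℝ} (hv : 0 < v)
    (hvw : v ≤ w) : FF l v ≤ FF l w := by
  obtain ⟨σ, hσ⟩ := exists_sort l hl
  rw [← FF_perm l σ, ← FF_perm l σ, FF_eq, FF_eq]
  refine Finset.prod_le_prod (fun s _ => by positivity) fun s _ => ?_
  have h1 : (((s : ℕ)) : ℝ) ≤ ((l ∘ σ) s : ℝ) := by exact_mod_cast le_of_strictMono hσ s
  have hw : 0 < w := hv.trans_le hvw
  rw [div_le_div_iff₀ (by positivity) (by positivity)]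
  nlinarith

lemma FF_le_one {N : ℕ} {l : Fin N → ℕ} (hl : Function.Injective l) {v : ℝ} (hv : 0 < v) :
    FF l v ≤ 1 := by
  obtain ⟨σ, hσ⟩ := exists_sort l hl
  rw [← FF_perm l σ, FF_eq]
  refine Finset.prod_le_one (fun s _ => by positivity) fun s _ => ?_
  have h1 : (((s : ℕ)) : ℝ) ≤ ((l ∘ σ) s : ℝ) := by exact_mod_cast le_of_strictMono hσ s
  rw [div_le_one (by positivity)]
  linarith

lemma ratio_tendsto (p q : ℝ) : Tendsto (fun v : ℝ => (v + p) / (v + q)) atTop (𝓝 1) := by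
  have h1 : Tendsto (fun v : ℝ => 1 + (p - q) / (v + q)) atTop (𝓝 (1 + 0)) :=
    tendsto_const_nhds.add (tendsto_const_nhds.div_atTop (tendsto_atTop_add_const_right _ _ tendsto_id))
  rw [add_zero] at h1
  refine h1.congr' ?_
  filter_upwards [eventually_gt_atTop (-q)] with v hv
  have : v + q ≠ 0 := by linarith
  field_simp
  ring

lemma FF_tendsto {N : ℕ} (l : Fin N → ℕ) : Tendsto (FF l) atTop (𝓝 1) := by
  have : FF l = fun v : ℝ => ∏ s : Fin N, ((v + ((s : ℕ) : ℝ)) / (v + l s)) := funext (FF_eq l)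
  rw [this]
  have := tendsto_finsetProd (Finset.univ : Finset (Fin N))
    (fun s _ => ratio_tendsto ((s : ℕ) : ℝ) (l s : ℝ))
  simpa using this

lemma rp_ratio (N m : ℕ) (v : ℝ) :
    rp N v / rp N (v + m) = ∏ r ∈ Finset.range N, ((v + r) / (v + (m + r))) := by
  rw [rp, rp, ← Finset.prod_div_distrib]
  refine Finset.prod_congr rfl fun r _ => by ring

lemma rp_ratio_le (N m : ℕ) {v : ℝ} (hv : 0 < v) : rp N v / rp N (v + m) ≤ 1 := by
  rw [rp_ratio]
  refine Finset.prod_le_one (fun s _ => by positivity) fun s _ => ?_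
  rw [div_le_one (by positivity)]
  have : (0 : ℝ) ≤ m := by positivity
  linarith

lemma rp_ratio_nonneg (N m : ℕ) {v : ℝ} (hv : 0 < v) : 0 ≤ rp N v / rp N (v + m) :=
  (div_pos (rp_pos _ hv) (rp_pos _ (by positivity))).le

lemma Std.summable {a : ℕ → ℝ} (h : Std a) : Summable a :=
  Summable.of_nonneg_of_le h.nonneg h.bd (summable_geometric_of_lt_one (by norm_num) (by norm_num))

/-- generating function -/
noncomputable def Ag (a : ℕ → ℝ) (x : ℝ) : ℝ := ∑' m, a m * x ^ m

lemma Ag_pos {a : ℕ → ℝ} (h : Std a) {x : ℝ} (hx : 0 ≤ x) (hx1 : x ≤ 1) : 0 < Ag a x := by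
  have hs : Summable (fun m => a m * x ^ m) :=
    Summable.of_nonneg_of_le (fun m => mul_nonneg (h.nonneg m) (by positivity))
      (fun m => mul_le_of_le_one_right (h.nonneg m) (pow_le_one₀ hx hx1)) h.summable
  exact hs.tsum_pos (fun m => mul_nonneg (h.nonneg m) (by positivity)) 0 (by simp [h.zero])

lemma SS_tendsto_of {a : ℕ → ℝ} (h : Std a) {ι : Type*} (F : Filter ι) (M : ι → ℕ) (v : ι → ℝ)
    (hv : ∀ᶠ i in F, 0 < v i) (y : ℝ)
    (hlim : ∀ m : ℕ, Tendsto (fun i => rp (M i) (v i) / rp (M i) (v i + m)) F (𝓝 (y ^ m))) :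
    Tendsto (fun i => SS a (M i) (v i)) F (𝓝 (Ag a y)) := by
  refine tendsto_tsum_of_dominated_convergence h.summable (fun m => (hlim m).const_mul _) ?_
  filter_upwards [hv] with i hi m
  rw [norm_mul, Real.norm_eq_abs, Real.norm_eq_abs, abs_of_nonneg (h.nonneg m),
    abs_of_nonneg (rp_ratio_nonneg _ _ hi)]
  exact mul_le_of_le_one_right (h.nonneg m) (rp_ratio_le _ _ hi)

lemma SS_tendsto {a : ℕ → ℝ} (h : Std a) (N : ℕ) :
    Tendsto (SS a N) atTop (𝓝 (Ag a 1)) := by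
  refine SS_tendsto_of h atTop (fun _ => N) (fun v => v) (eventually_gt_atTop 0) 1 fun m => ?_
  simp_rw [rp_ratio]
  have := tendsto_finsetProd (Finset.range N)
    (fun r _ => ratio_tendsto (r : ℝ) ((m : ℝ) + r))
  simpa using this

lemma Wt_mul_integrable {a : ℕ → ℝ} (h : Std a) (n : ℕ) (g : (Fin (n + 2) → ℕ) → ℝ) (C : ℝ)
    (hg : ∀ l, Function.Injective l → |g l| ≤ C) :
    Integrable (fun l => Wt a n l * g l) (cnt (n + 2)) := by
  refine ((Wt_integrable h n).mul_const C).mono' (Measurable.of_discrete).aestronglyMeasurable ?_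
  refine Eventually.of_forall fun l => ?_
  rw [norm_mul, Real.norm_eq_abs, Real.norm_eq_abs, abs_of_nonneg (Wt_nonneg h n l)]
  by_cases hl : Wt a n l = 0
  · rw [hl]; simp
  · exact mul_le_mul_of_nonneg_left (hg l (Wt_inj hl)) (Wt_nonneg h n l)

lemma Wt_tendsto {a : ℕ → ℝ} (h : Std a) (n : ℕ) (g : ℝ → (Fin (n + 2) → ℕ) → ℝ)
    (g' : (Fin (n + 2) → ℕ) → ℝ)
    (hg : ∀ v, 0 < v → ∀ l, Function.Injective l → |g v l| ≤ 1)
    (hlim : ∀ l, Tendsto (fun v => g v l) atTop (𝓝 (g' l))) :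
    Tendsto (fun v => ∫ l, Wt a n l * g v l ∂(cnt (n + 2))) atTop
      (𝓝 (∫ l, Wt a n l * g' l ∂(cnt (n + 2)))) := by
  refine tendsto_integral_filter_of_dominated_convergence (Wt a n) ?_ ?_ (Wt_integrable h n) ?_
  · exact Eventually.of_forall fun v => (Measurable.of_discrete).aestronglyMeasurable
  · filter_upwards [eventually_gt_atTop 0] with v hv
    refine Eventually.of_forall fun l => ?_
    rw [norm_mul, Real.norm_eq_abs, Real.norm_eq_abs, abs_of_nonneg (Wt_nonneg h n l)]
    by_cases hl : Wt a n l = 0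
    · rw [hl]; simp
    · exact mul_le_of_le_one_right (Wt_nonneg h n l) (hg v hv l (Wt_inj hl))
  · exact Eventually.of_forall fun l => (hlim l).const_mul _

lemma abs_FF_le {N : ℕ} {l : Fin N → ℕ} (hl : Function.Injective l) {v : ℝ} (hv : 0 < v) :
    |FF l v| ≤ 1 := by
  rw [abs_of_pos (FF_pos l hv)]; exact FF_le_one hl hv

lemma moments {a : ℕ → ℝ} (h : Std a) (n : ℕ) :
    (∀ v, 0 < v → ∫ l, Wt a n l * FF l v ∂(cnt (n + 2)) =
      (∫ l, Wt a n l ∂(cnt (n + 2))) * (SS a (n + 2) v / Ag a 1)) ∧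
    (∀ v w, 0 < v → 0 < w → v ≠ w → ∫ l, Wt a n l * (FF l v * FF l w) ∂(cnt (n + 2)) =
      (∫ l, Wt a n l ∂(cnt (n + 2))) * (((w + (n + 1)) / (w - v) * (SS a (n + 1) w * SS a (n + 2) v) -
        (v + (n + 1)) / (w - v) * (SS a (n + 1) v * SS a (n + 2) w)) / Ag a 1 ^ 2)) := by
  obtain ⟨K, hK⟩ := key_id2 h n
  have hA := Ag_pos h zero_le_one le_rfl
  have h1 : ∀ v, 0 < v → ∫ l, Wt a n l * FF l v ∂(cnt (n + 2)) =
      K * (Ag a 1 * SS a (n + 2) v) := by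
    intro v hv
    have t1 : Tendsto (fun w => ∫ l, Wt a n l * (FF l v * FF l w) ∂(cnt (n + 2))) atTop
        (𝓝 (∫ l, Wt a n l * (FF l v * 1) ∂(cnt (n + 2)))) := by
      refine Wt_tendsto h n (fun w l => FF l v * FF l w) _ ?_ ?_
      · intro w hw l hl
        rw [abs_mul]
        exact mul_le_one₀ (abs_FF_le hl hv) (abs_nonneg _) (abs_FF_le hl hw)
      · intro l
        exact (FF_tendsto l).const_mul _
    simp only [mul_one] at t1
    have t2 : Tendsto (fun w => K * ((w + (n + 1)) / (w + (-v)) * (SS a (n + 1) w * SS a (n + 2) v) -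
        (v + (n + 1)) / (w + (-v)) * (SS a (n + 1) v * SS a (n + 2) w))) atTop
        (𝓝 (K * (1 * (Ag a 1 * SS a (n + 2) v) - 0 * (SS a (n + 1) v * Ag a 1)))) := by
      refine Tendsto.const_mul _ (Tendsto.sub ?_ ?_)
      · exact (ratio_tendsto _ _).mul ((SS_tendsto h _).mul_const _)
      · refine Tendsto.mul ?_ ((SS_tendsto h _).const_mul _)
        exact tendsto_const_nhds.div_atTop (tendsto_atTop_add_const_right _ _ tendsto_id)
    have t3 := tendsto_nhds_unique_of_eventuallyEq t1 t2 (by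
      filter_upwards [eventually_gt_atTop v] with w hw
      rw [hK v w hv (hv.trans hw) hw.ne]
      ring)
    rw [t3]; ring
  have h2 : ∫ l, Wt a n l ∂(cnt (n + 2)) = K * (Ag a 1 * Ag a 1) := by
    have t1 := Wt_tendsto h n (fun v l => FF l v) (fun _ => 1) (fun v hv l hl => abs_FF_le hl hv)
      FF_tendsto
    simp only [mul_one] at t1
    have t2 : Tendsto (fun v => K * (Ag a 1 * SS a (n + 2) v)) atTop (𝓝 (K * (Ag a 1 * Ag a 1))) :=
      ((SS_tendsto h _).const_mul _).const_mul _
    exact tendsto_nhds_unique_of_eventuallyEq t1 t2 (by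
      filter_upwards [eventually_gt_atTop 0] with v hv
      exact h1 v hv)
  constructor
  · intro v hv
    rw [h1 v hv, h2]
    field_simp
  · intro v w hv hw hvw
    rw [hK v w hv hw hvw, h2]
    have h3 : w - v ≠ 0 := sub_ne_zero.2 hvw.symm
    field_simp

end Edrei

namespace Edrei

lemma rp_swap (N m : ℕ) {v : ℝ} (hv : 0 < v) :
    rp N v / rp N (v + m) = ∏ r ∈ Finset.range m, ((v + r) / (v + N + r)) := by
  have key : ∀ N m : ℕ, rp (N + m) v = rp N v * rp m (v + N) := by
    intro N m
    rw [rp, rp, rp, Finset.prod_range_add]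
    congr 1
    refine Finset.prod_congr rfl fun r _ => by push_cast; ring
  have e1 := key N m
  have e2 := key m N
  rw [add_comm m N, e1] at e2
  have p1 : 0 < rp N (v + m) := rp_pos _ (by positivity)
  have p2 : 0 < rp m (v + N) := rp_pos _ (by positivity)
  have : rp N v / rp N (v + m) = rp m v / rp m (v + N) := by
    rw [div_eq_div_iff p1.ne' p2.ne', e2]
  rw [this, rp, rp, ← Finset.prod_div_distrib]

lemma nat2_tendsto : Tendsto (fun n : ℕ => (n : ℝ) + 2) atTop atTop :=
  tendsto_atTop_add_const_right _ _ tendsto_natCast_atTop_atTop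

lemma lin_ratio (c d r q : ℝ) (hd : d ≠ 0) :
    Tendsto (fun n : ℕ => (c * ((n : ℝ) + 2) + r) / (d * ((n : ℝ) + 2) + q)) atTop (𝓝 (c / d)) := by
  have h1 : Tendsto (fun n : ℕ => (c + r / ((n : ℝ) + 2)) / (d + q / ((n : ℝ) + 2))) atTop
      (𝓝 ((c + 0) / (d + 0))) :=
    (tendsto_const_nhds.add (tendsto_const_nhds.div_atTop nat2_tendsto)).div
      (tendsto_const_nhds.add (tendsto_const_nhds.div_atTop nat2_tendsto)) (by simpa using hd)
  simp only [add_zero] at h1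
  refine h1.congr fun n => ?_
  have : (n : ℝ) + 2 ≠ 0 := by positivity
  rw [← mul_div_mul_right _ _ this]
  congr 1 <;> field_simp

lemma SS_lim2 {a : ℕ → ℝ} (h : Std a) {c : ℝ} (hc : 0 < c) :
    Tendsto (fun n : ℕ => SS a (n + 2) (c * ((n : ℝ) + 2))) atTop (𝓝 (Ag a (c / (c + 1)))) := by
  refine SS_tendsto_of h atTop (fun n => n + 2) _ (Eventually.of_forall fun n => by positivity) _
    fun m => ?_
  have := tendsto_finsetProd (Finset.range m)
    (fun r _ => lin_ratio c (c + 1) r r (by positivity))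
  simp only [Finset.prod_const, Finset.card_range] at this
  refine this.congr fun n => ?_
  rw [rp_swap _ _ (by positivity)]
  refine Finset.prod_congr rfl fun r _ => ?_
  push_cast
  congr 1
  ring

lemma SS_lim1 {a : ℕ → ℝ} (h : Std a) {c : ℝ} (hc : 0 < c) :
    Tendsto (fun n : ℕ => SS a (n + 1) (c * ((n : ℝ) + 2))) atTop (𝓝 (Ag a (c / (c + 1)))) := by
  refine SS_tendsto_of h atTop (fun n => n + 1) _ (Eventually.of_forall fun n => by positivity) _
    fun m => ?_
  have := tendsto_finsetProd (Finset.range m)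
    (fun r _ => lin_ratio c (c + 1) r (r - 1) (by positivity))
  simp only [Finset.prod_const, Finset.card_range] at this
  refine this.congr fun n => ?_
  rw [rp_swap _ _ (by positivity)]
  refine Finset.prod_congr rfl fun r _ => ?_
  push_cast
  congr 1
  ring

/-- limit of observables -/
noncomputable def al (a : ℕ → ℝ) (c : ℝ) : ℝ := Ag a (c / (c + 1)) / Ag a 1

lemma Ag_cont {a : ℕ → ℝ} (h : Std a) : ContinuousOn (Ag a) (Set.Icc 0 1) := by
  refine continuousOn_tsum (fun m => by fun_prop) h.summable fun m x hx => ?_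
  rw [norm_mul, Real.norm_eq_abs, Real.norm_eq_abs, abs_of_nonneg (h.nonneg m),
    abs_of_nonneg (pow_nonneg hx.1 _)]
  exact mul_le_of_le_one_right (h.nonneg m) (pow_le_one₀ hx.1 hx.2)

lemma al_cont {a : ℕ → ℝ} (h : Std a) {c : ℝ} (hc : 0 < c) : ContinuousAt (al a) c := by
  have h1 : ContinuousAt (Ag a) (c / (c + 1)) := by
    refine (Ag_cont h).continuousAt (Icc_mem_nhds (by positivity) ?_)
    rw [div_lt_one (by positivity)]; linarith
  have h2 : ContinuousAt (fun c : ℝ => c / (c + 1)) c :=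
    continuousAt_id.div (by fun_prop) (by positivity)
  exact (ContinuousAt.comp (f := fun c : ℝ => c / (c + 1)) h1 h2).div_const _

lemma var_bound {a : ℕ → ℝ} (h : Std a) (n : ℕ) {v w : ℝ} (hv : 0 < v) (hvw : v < w) (α : ℝ) :
    ∫ l, Wt a n l * (FF l v - α) ^ 2 ∂(cnt (n + 2)) ≤ (∫ l, Wt a n l ∂(cnt (n + 2))) *
      ((((w + (n + 1)) / (w - v) * (SS a (n + 1) w * SS a (n + 2) v) -
        (v + (n + 1)) / (w - v) * (SS a (n + 1) v * SS a (n + 2) w)) / Ag a 1 ^ 2) -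
        2 * α * (SS a (n + 2) v / Ag a 1) + α ^ 2) := by
  obtain ⟨m1, m2⟩ := moments h n
  have hw := hv.trans hvw
  have i1 : Integrable (fun l => Wt a n l * FF l v) (cnt (n + 2)) :=
    Wt_mul_integrable h n _ 1 (fun l hl => abs_FF_le hl hv)
  have i2 : Integrable (fun l => Wt a n l * (FF l v * FF l w)) (cnt (n + 2)) :=
    Wt_mul_integrable h n _ 1 (fun l hl => by
      rw [abs_mul]
      exact mul_le_one₀ (abs_FF_le hl hv) (abs_nonneg _) (abs_FF_le hl hw))
  have e : ∫ l, (Wt a n l * (FF l v * FF l w) - 2 * α * (Wt a n l * FF l v) + α ^ 2 * Wt a n l)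
      ∂(cnt (n + 2)) = (∫ l, Wt a n l ∂(cnt (n + 2))) *
      ((((w + (n + 1)) / (w - v) * (SS a (n + 1) w * SS a (n + 2) v) -
        (v + (n + 1)) / (w - v) * (SS a (n + 1) v * SS a (n + 2) w)) / Ag a 1 ^ 2) -
        2 * α * (SS a (n + 2) v / Ag a 1) + α ^ 2) := by
    have i3 : Integrable (fun l => Wt a n l * (FF l v * FF l w) - 2 * α * (Wt a n l * FF l v))
      (cnt (n + 2)) := i2.sub (i1.const_mul _)
    rw [integral_add i3 ((Wt_integrable h n).const_mul _),
      integral_sub i2 (i1.const_mul _), integral_const_mul, integral_const_mul, m1 v hv,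
      m2 v w hv hw hvw.ne]
    ring
  rw [← e]
  refine integral_mono ?_ ((i2.sub (i1.const_mul _)).add ((Wt_integrable h n).const_mul _)) ?_
  · refine Wt_mul_integrable h n _ ((1 + |α|) ^ 2) (fun l hl => ?_)
    rw [abs_pow]
    gcongr
    exact (abs_sub _ _).trans (by gcongr; exact abs_FF_le hl hv)
  · intro l
    simp only
    by_cases hl : Wt a n l = 0
    · rw [hl]; simp
    have h1 := FF_mono (Wt_inj hl) hv hvw.le
    have h2 := FF_pos l hv
    have h3 := Wt_nonneg h n l
    have : FF l v * FF l v ≤ FF l v * FF l w := by gcongr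
    nlinarith [mul_le_mul_of_nonneg_left this h3]

lemma concentration {a : ℕ → ℝ} (h : Std a) {c : ℝ} (hc : 0 < c) {η : ℝ} (hη : 0 < η) :
    ∀ᶠ n : ℕ in atTop, ∫ l, Wt a n l * (FF l (c * ((n : ℝ) + 2)) - al a c) ^ 2 ∂(cnt (n + 2)) <
      η * (∫ l, Wt a n l ∂(cnt (n + 2))) := by
  have hA := Ag_pos h zero_le_one le_rfl
  -- choose d > c with al d close to al c
  have hcont : ContinuousAt (fun d => al a c * al a d - 2 * al a c * al a c + al a c ^ 2) c :=
    ((al_cont h hc).const_mul _ |>.sub continuousAt_const).add continuousAt_const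
  have hz : al a c * al a c - 2 * al a c * al a c + al a c ^ 2 < η := by
    have : al a c * al a c - 2 * al a c * al a c + al a c ^ 2 = 0 := by ring
    rwa [this]
  have hev := (hcont.eventually (gt_mem_nhds hz)).filter_mono (nhdsWithin_le_nhds (s := Set.Ioi c))
  obtain ⟨d, hd, hcd⟩ := (hev.and self_mem_nhdsWithin).exists
  have hcd : c < d := hcd
  have hd0 := hc.trans hcd
  have t := ((((lin_ratio (d + 1) (d - c) (-1) 0 (by linarith)).mul
    ((SS_lim1 h hd0).mul (SS_lim2 h hc))).sub ((lin_ratio (c + 1) (d - c) (-1) 0 (by linarith)).mul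
    ((SS_lim1 h hc).mul (SS_lim2 h hd0)))).div_const (Ag a 1 ^ 2)).sub
    (((SS_lim2 h hc).div_const (Ag a 1)).const_mul (2 * al a c)) |>.add_const (al a c ^ 2)
  have hlim : ((d + 1) / (d - c) * (Ag a (d / (d + 1)) * Ag a (c / (c + 1))) -
      (c + 1) / (d - c) * (Ag a (c / (c + 1)) * Ag a (d / (d + 1)))) / Ag a 1 ^ 2 -
      2 * al a c * (Ag a (c / (c + 1)) / Ag a 1) + al a c ^ 2 < η := by
    refine lt_of_eq_of_lt ?_ hd
    have : d - c ≠ 0 := by linarith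
    simp only [al]
    field_simp
    ring
  filter_upwards [t.eventually (gt_mem_nhds hlim)] with n hn
  have hZ := Wt_int_pos h n
  have hb := var_bound h n (v := c * ((n : ℝ) + 2)) (w := d * ((n : ℝ) + 2)) (by positivity)
    (by gcongr) (al a c)
  refine hb.trans_lt ?_
  rw [mul_comm η]
  refine mul_lt_mul_of_pos_left (lt_of_eq_of_lt ?_ hn) hZ
  have e1 : d * ((n : ℝ) + 2) + (n + 1) = (d + 1) * ((n : ℝ) + 2) + -1 := by ring
  have e2 : c * ((n : ℝ) + 2) + (n + 1) = (c + 1) * ((n : ℝ) + 2) + -1 := by ring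
  have e3 : d * ((n : ℝ) + 2) - c * ((n : ℝ) + 2) = (d - c) * ((n : ℝ) + 2) + 0 := by ring
  rw [e1, e2, e3]

lemma exists_l {a : ℕ → ℝ} (h : Std a) (S : Finset ℝ) (hS : ∀ c ∈ S, 0 < c) {η : ℝ} (hη : 0 < η) :
    ∃ n : ℕ, ∃ l : Fin (n + 2) → ℕ, StrictMono l ∧
      ∀ c ∈ S, |FF l (c * ((n : ℝ) + 2)) - al a c| < η := by
  have hη2 : 0 < η ^ 2 / (S.card + 1) := by positivity
  have hev : ∀ᶠ n : ℕ in atTop, ∀ c ∈ S,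
      ∫ l, Wt a n l * (FF l (c * ((n : ℝ) + 2)) - al a c) ^ 2 ∂(cnt (n + 2)) <
      η ^ 2 / (S.card + 1) * (∫ l, Wt a n l ∂(cnt (n + 2))) := by
    rw [eventually_all_finset]
    intro c hc
    exact concentration h (hS c hc) hη2
  obtain ⟨n, hn⟩ := hev.exists
  have hZ := Wt_int_pos h n
  have hInteg : ∀ c ∈ S, Integrable (fun l => Wt a n l * (FF l (c * ((n : ℝ) + 2)) - al a c) ^ 2)
      (cnt (n + 2)) := by
    intro c hc
    have := hS c hc
    refine Wt_mul_integrable h n _ ((1 + |al a c|) ^ 2) (fun l hl => ?_)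
    rw [abs_pow]
    gcongr
    exact (abs_sub _ _).trans (by gcongr; exact abs_FF_le hl (by positivity))
  have hsum : ∑ c ∈ S, ∫ l, Wt a n l * (FF l (c * ((n : ℝ) + 2)) - al a c) ^ 2 ∂(cnt (n + 2)) <
      η ^ 2 * (∫ l, Wt a n l ∂(cnt (n + 2))) := by
    calc _ ≤ ∑ c ∈ S, η ^ 2 / (S.card + 1) * (∫ l, Wt a n l ∂(cnt (n + 2))) :=
          Finset.sum_le_sum fun c hc => (hn c hc).le
      _ = (S.card / (S.card + 1)) * (η ^ 2 * (∫ l, Wt a n l ∂(cnt (n + 2)))) := by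
          rw [Finset.sum_const, nsmul_eq_mul]; ring
      _ < 1 * (η ^ 2 * (∫ l, Wt a n l ∂(cnt (n + 2)))) := by
          refine mul_lt_mul_of_pos_right ?_ (by positivity)
          rw [div_lt_one (by positivity)]; linarith
      _ = _ := one_mul _
  have : ∃ l, Wt a n l ≠ 0 ∧ ∑ c ∈ S, (FF l (c * ((n : ℝ) + 2)) - al a c) ^ 2 < η ^ 2 := by
    by_contra hcon
    push Not at hcon
    refine absurd hsum (not_lt.2 ?_)
    rw [← integral_finsetSum _ hInteg, ← integral_const_mul]
    refine integral_mono ((Wt_integrable h n).const_mul _) (integrable_finsetSum _ hInteg) ?_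
    intro l
    simp only
    rw [← Finset.mul_sum]
    by_cases hl : Wt a n l = 0
    · rw [hl]; simp
    · rw [mul_comm]
      exact mul_le_mul_of_nonneg_left (hcon l hl) (Wt_nonneg h n l)
  obtain ⟨l, hl, hlS⟩ := this
  obtain ⟨σ, hσ⟩ := exists_sort l (Wt_inj hl)
  refine ⟨n, l ∘ σ, hσ, fun c hc => ?_⟩
  rw [FF_perm]
  refine abs_lt_of_sq_lt_sq ?_ hη.le
  exact (Finset.single_le_sum (f := fun c => (FF l (c * ((n : ℝ) + 2)) - al a c) ^ 2)
    (fun c _ => sq_nonneg _) hc).trans_lt hlS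

end Edrei

namespace Edrei

/-- Decreasing rearrangement of a finite family, padded with zeros. -/
lemma rearr (S : Finset ℕ) (f : ℕ → ℝ) (hf : ∀ m ∈ S, 0 ≤ f m) : ∃ T : ℕ → ℝ, Antitone T ∧
    (∀ k, 0 ≤ T k) ∧ (∀ k, S.card ≤ k → T k = 0) ∧ (∀ C, 0 ≤ C → (∀ m ∈ S, f m ≤ C) → ∀ k, T k ≤ C) ∧
    ∀ g : ℝ → ℝ, ∏ m ∈ S, g (f m) = ∏ k ∈ Finset.range S.card, g (T k) := by
  set e := S.equivFin.symm with he
  set hh : Fin S.card → ℝ := fun i => f (e i) with hhh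
  set σ := Tuple.sort (fun i => - hh i) with hσ
  have hmono : Monotone ((fun i => - hh i) ∘ σ) := Tuple.monotone_sort _
  refine ⟨fun k => if hk : k < S.card then hh (σ ⟨k, hk⟩) else 0, ?_, ?_, ?_, ?_, ?_⟩
  · intro k k' hkk
    by_cases h1 : k' < S.card
    · have h2 : k < S.card := lt_of_le_of_lt hkk h1
      simp only [h1, h2, dif_pos]
      have := hmono (show (⟨k, h2⟩ : Fin S.card) ≤ ⟨k', h1⟩ from hkk)
      simpa using this
    · simp only [h1, dif_neg, not_false_iff]
      split_ifs
      · exact hf _ (e _).2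
      · exact le_rfl
  · intro k
    simp only
    split_ifs
    · exact hf _ (e _).2
    · exact le_rfl
  · intro k hk
    simp [not_lt.2 hk]
  · intro C hC h k
    simp only
    split_ifs
    · exact h _ (e _).2
    · exact hC
  · intro g
    rw [Finset.prod_range]
    simp only [Fin.is_lt, dif_pos]
    rw [← Finset.prod_coe_sort, ← e.prod_comp, ← Equiv.prod_comp σ]

lemma one_add_sum_le_prod (s : Finset ℕ) (f : ℕ → ℝ) (h : ∀ i, 0 ≤ f i) :
    1 + ∑ i ∈ s, f i ≤ ∏ i ∈ s, (1 + f i) := by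
  induction s using Finset.induction_on with
  | empty => simp
  | insert a s ha ih =>
    rw [Finset.sum_insert ha, Finset.prod_insert ha]
    have h1 : 0 ≤ ∑ i ∈ s, f i := Finset.sum_nonneg fun i _ => h i
    nlinarith [h a]

lemma prod_one_sub_le (s : Finset ℕ) (f : ℕ → ℝ) (h : ∀ i, 0 ≤ f i) (h1 : ∀ i, f i ≤ 1) :
    (∏ i ∈ s, (1 - f i)) * (1 + ∑ i ∈ s, f i) ≤ 1 := by
  have h2 := one_add_sum_le_prod s f h
  have h3 : 0 ≤ ∏ i ∈ s, (1 - f i) := Finset.prod_nonneg fun i _ => sub_nonneg.2 (h1 i)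
  refine (mul_le_mul_of_nonneg_left h2 h3).trans ?_
  rw [← Finset.prod_mul_distrib]
  refine Finset.prod_le_one (fun i _ => mul_nonneg (sub_nonneg.2 (h1 i)) (by linarith [h i])) fun i _ => ?_
  nlinarith [h i, sq_nonneg (f i)]

/-- compensated log-sum for zeros -/
noncomputable def PP (s : ℝ) (T : ℕ → ℝ) : ℝ := ∑' k, (Real.log (1 - s * T k) + s * T k)

/-- compensated log-sum for poles -/
noncomputable def QQ (s : ℝ) (U : ℕ → ℝ) : ℝ := ∑' k, (Real.log (1 + s * U k) - s * U k)

lemma profile {N : ℕ} (hN : 0 < N) (l : Fin N → ℕ) (hl : Function.Injective l) :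
    ∃ T U : ℕ → ℝ, Antitone T ∧ Antitone U ∧ (∀ k, 0 ≤ T k) ∧ (∀ k, T k ≤ 1) ∧ (∀ k, 0 ≤ U k) ∧
      Summable T ∧ Summable U ∧ ∀ c, 0 < c →
      (FF l (c * N) * (1 + 1 / (1 + c) * ∑' k, T k) ≤ 1) ∧
      (FF l (c * N) * (1 + 1 / (1 + c) * ∑' k, U k) ≤ 1) ∧
      FF l (c * N) = Real.exp (PP (1 / (1 + c)) T - QQ (1 / (1 + c)) U -
        1 / (1 + c) * (∑' k, T k + ∑' k, U k)) := by
  classical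
  have hN' : (0 : ℝ) < N := by exact_mod_cast hN
  set L : Finset ℕ := Finset.univ.image l with hL
  set R : Finset ℕ := Finset.range N with hR
  have hcard : (R \ L).card = (L \ R).card := Finset.card_sdiff_comm (by
    rw [hL, Finset.card_image_of_injective _ hl]; simp [hR])
  obtain ⟨T, T1, T2, T3, T4, T5⟩ := rearr (R \ L) (fun m => ((N : ℝ) - m) / N) (fun m hm => by
    have : m < N := by simp [hR] at hm; exact hm.1
    have : (m : ℝ) < N := by exact_mod_cast this
    exact div_nonneg (by linarith) hN'.le)
  obtain ⟨U, U1, U2, U3, U4, U5⟩ := rearr (L \ R) (fun m => ((m : ℝ) - N) / N) (fun m hm => by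
    have : N ≤ m := by simp [hR] at hm; exact hm.2
    have : (N : ℝ) ≤ m := by exact_mod_cast this
    exact div_nonneg (by linarith) hN'.le)
  have Tle : ∀ k, T k ≤ 1 := T4 1 zero_le_one (fun m _ => by
    rw [div_le_one hN']; have : (0 : ℝ) ≤ m := by positivity
    linarith)
  set p := (R \ L).card with hp
  rw [← hcard] at U3 U5
  have sT : ∑' k, T k = ∑ k ∈ Finset.range p, T k := tsum_eq_sum fun k hk => T3 k (by simpa using hk)
  have sU : ∑' k, U k = ∑ k ∈ Finset.range p, U k := tsum_eq_sum fun k hk => U3 k (by simpa using hk)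
  refine ⟨T, U, T1, U1, T2, Tle, U2,
    summable_of_ne_finset_zero (s := Finset.range p) fun k hk => T3 k (by simpa using hk),
    summable_of_ne_finset_zero (s := Finset.range p) fun k hk => U3 k (by simpa using hk),
    fun c hc => ?_⟩
  set s : ℝ := 1 / (1 + c) with hs
  have hs0 : 0 < s := by positivity
  have hs1 : s < 1 := by rw [hs, div_lt_one (by positivity)]; linarith
  have hsT : ∀ k, s * T k < 1 := fun k => by nlinarith [T2 k, Tle k]
  have hsT0 : ∀ k, 0 ≤ s * T k := fun k => mul_nonneg hs0.le (T2 k)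
  have hsU0 : ∀ k, 0 ≤ s * U k := fun k => mul_nonneg hs0.le (U2 k)
  have hF : FF l (c * N) = (∏ k ∈ Finset.range p, (1 - s * T k)) /
      ∏ k ∈ Finset.range p, (1 + s * U k) := by
    have e1 : FF l (c * N) = (∏ m ∈ R, (c * N + m)) / ∏ m ∈ L, (c * N + (m : ℝ)) := by
      rw [FF, rp, hL, Finset.prod_image (fun x _ y _ hxy => hl hxy)]
      simp only [div_eq_mul_inv, one_mul, Finset.prod_inv_distrib, hR]
    have pos : ∀ m : ℕ, 0 < c * N + (m : ℝ) := fun m => by positivity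
    have e2 : (∏ m ∈ R, (c * N + (m : ℝ))) =
        (∏ m ∈ R \ L, (c * N + (m : ℝ))) * ∏ m ∈ R ∩ L, (c * N + (m : ℝ)) := by
      rw [← Finset.prod_union (Finset.disjoint_sdiff_inter R L), Finset.sdiff_union_inter]
    have e3 : (∏ m ∈ L, (c * N + (m : ℝ))) =
        (∏ m ∈ L \ R, (c * N + (m : ℝ))) * ∏ m ∈ R ∩ L, (c * N + (m : ℝ)) := by
      rw [Finset.inter_comm, ← Finset.prod_union (Finset.disjoint_sdiff_inter L R),
        Finset.sdiff_union_inter]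
    have e4 : (∏ m ∈ R \ L, (c * N + (m : ℝ))) =
        ((1 + c) * N) ^ p * ∏ k ∈ Finset.range p, (1 - s * T k) := by
      rw [← T5 (fun x => 1 - s * x), hp, ← Finset.prod_const, ← Finset.prod_mul_distrib]
      refine Finset.prod_congr rfl fun m _ => ?_
      rw [hs]; field_simp; ring
    have e5 : (∏ m ∈ L \ R, (c * N + (m : ℝ))) =
        ((1 + c) * N) ^ p * ∏ k ∈ Finset.range p, (1 + s * U k) := by
      rw [← U5 (fun x => 1 + s * x), hcard, ← Finset.prod_const, ← Finset.prod_mul_distrib]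
      refine Finset.prod_congr rfl fun m _ => ?_
      rw [hs]; field_simp; ring
    have p1 : (∏ m ∈ R ∩ L, (c * N + (m : ℝ))) ≠ 0 := (Finset.prod_pos fun m _ => pos m).ne'
    have p2 : ((1 + c) * N) ^ p ≠ 0 := by positivity
    rw [e1, e2, e3, mul_div_mul_right _ _ p1, e4, e5, mul_div_mul_left _ _ p2]
  have hden : 1 ≤ ∏ k ∈ Finset.range p, (1 + s * U k) := by
    have := one_add_sum_le_prod (Finset.range p) (fun k => s * U k) hsU0
    have h2 : 0 ≤ ∑ k ∈ Finset.range p, s * U k := Finset.sum_nonneg fun k _ => hsU0 k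
    linarith
  have hnum : ∏ k ∈ Finset.range p, (1 - s * T k) ≤ 1 :=
    Finset.prod_le_one (fun k _ => by linarith [hsT k]) fun k _ => by linarith [hsT0 k]
  have hnum0 : 0 < ∏ k ∈ Finset.range p, (1 - s * T k) :=
    Finset.prod_pos fun k _ => by linarith [hsT k]
  refine ⟨?_, ?_, ?_⟩
  · rw [sT, Finset.mul_sum, hF]
    have h1 := prod_one_sub_le (Finset.range p) (fun k => s * T k) hsT0 (fun k => (hsT k).le)
    have h2 : 0 ≤ ∑ k ∈ Finset.range p, s * T k := Finset.sum_nonneg fun k _ => hsT0 k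
    refine le_trans (mul_le_mul_of_nonneg_right (div_le_self hnum0.le hden) (by linarith)) h1
  · rw [sU, Finset.mul_sum, hF]
    have h1 := one_add_sum_le_prod (Finset.range p) (fun k => s * U k) hsU0
    rw [div_mul_eq_mul_div, div_le_one (by linarith)]
    have h2 : 0 ≤ ∑ k ∈ Finset.range p, s * U k := Finset.sum_nonneg fun k _ => hsU0 k
    nlinarith
  · have eP : PP s T = ∑ k ∈ Finset.range p, (Real.log (1 - s * T k) + s * T k) :=
      tsum_eq_sum fun k hk => by rw [T3 k (by simpa using hk)]; simp
    have eQ : QQ s U = ∑ k ∈ Finset.range p, (Real.log (1 + s * U k) - s * U k) :=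
      tsum_eq_sum fun k hk => by rw [U3 k (by simpa using hk)]; simp
    rw [eP, eQ, sT, sU, Finset.sum_add_distrib, Finset.sum_sub_distrib, mul_add, Finset.mul_sum,
      Finset.mul_sum]
    have : ∀ x y z w : ℝ, x + y - (z - w) - (y + w) = x - z := fun x y z w => by ring
    rw [this, Real.exp_sub, Real.exp_sum, Real.exp_sum, hF]
    congr 1
    · refine Finset.prod_congr rfl fun k _ => ?_
      rw [Real.exp_log (by linarith [hsT k])]
    · refine Finset.prod_congr rfl fun k _ => ?_
      rw [Real.exp_log (by linarith [hsU0 k])]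

lemma PP_bound {x : ℝ} (h0 : 0 ≤ x) (h1 : x ≤ 1 / 2) : |Real.log (1 - x) + x| ≤ 2 * x ^ 2 := by
  have h := Real.abs_log_sub_add_sum_range_le (x := x) (by rw [abs_of_nonneg h0]; linarith) 1
  simp only [Finset.range_one, Finset.sum_singleton, abs_of_nonneg h0] at h
  norm_num at h
  rw [add_comm]
  refine h.trans ?_
  rw [div_le_iff₀ (by linarith)]
  nlinarith [sq_nonneg x]

lemma QQ_bound {x : ℝ} (h0 : 0 ≤ x) : |Real.log (1 + x) - x| ≤ x ^ 2 := by
  have h1 := Real.one_sub_inv_le_log_of_pos (x := 1 + x) (by linarith)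
  have h2 := Real.log_le_sub_one_of_pos (x := 1 + x) (by linarith)
  have h3 : x - x ^ 2 ≤ 1 - (1 + x)⁻¹ := by
    have : 1 - (1 + x)⁻¹ = x / (1 + x) := by field_simp; ring
    rw [this, le_div_iff₀ (by linarith)]
    nlinarith [pow_nonneg h0 3]
  rw [abs_le]
  constructor <;> nlinarith

end Edrei

namespace Edrei

/-- evaluation points -/
noncomputable def cc (k : ℕ) : ℝ := 1 + 1 / ((k : ℝ) + 1)

lemma cc_gt (k : ℕ) : 1 < cc k := by
  have : 0 < 1 / ((k : ℝ) + 1) := by positivity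
  rw [cc]; linarith

lemma al_pos {a : ℕ → ℝ} (h : Std a) {c : ℝ} (hc : 0 < c) : 0 < al a c :=
  div_pos (Ag_pos h (by positivity) (by rw [div_le_one (by positivity)]; linarith))
    (Ag_pos h zero_le_one le_rfl)

lemma approx {a : ℕ → ℝ} (h : Std a) : ∃ C : ℝ, 0 ≤ C ∧ ∀ j : ℕ, ∃ T U : ℕ → ℝ,
    Antitone T ∧ Antitone U ∧ (∀ k, 0 ≤ T k) ∧ (∀ k, T k ≤ 1) ∧ (∀ k, 0 ≤ U k) ∧
      Summable T ∧ Summable U ∧ ∑' k, T k ≤ C ∧ ∑' k, U k ≤ C ∧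
      ∀ i ≤ j, |Real.exp (PP (1 / (1 + cc i)) T - QQ (1 / (1 + cc i)) U -
        1 / (1 + cc i) * (∑' k, T k + ∑' k, U k)) - al a (cc i)| < 1 / ((j : ℝ) + 1) := by
  have hcc : ∀ k, 0 < cc k := fun k => by linarith [cc_gt k]
  set δ := al a (cc 0) / 2 with hδ
  have hal := al_pos h (hcc 0)
  have hδ0 : 0 < δ := by positivity
  set s := 1 / (1 + cc 0) with hs
  have hs0 : 0 < s := by have := hcc 0; positivity
  refine ⟨1 / (δ * s), by positivity, fun j => ?_⟩
  classical
  obtain ⟨n, l, hl, hlS⟩ := exists_l h ((Finset.range (j + 1)).image cc)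
    (by intro c hc; obtain ⟨k, _, rfl⟩ := Finset.mem_image.1 hc; exact hcc k)
    (η := min δ (1 / ((j : ℝ) + 1))) (by positivity)
  obtain ⟨T, U, T1, U1, T2, T3, U2, T4, U4, hTU⟩ := profile (N := n + 2) (by omega) l hl.injective
  have eN : (((n + 2 : ℕ)) : ℝ) = (n : ℝ) + 2 := by push_cast; ring
  rw [eN] at hTU
  have hmem : ∀ i ≤ j, cc i ∈ (Finset.range (j + 1)).image cc := fun i hi =>
    Finset.mem_image_of_mem _ (by simp; omega)
  have hF : δ ≤ FF l (cc 0 * ((n : ℝ) + 2)) := by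
    have h1 := (hlS _ (hmem 0 (Nat.zero_le _))).trans_le (min_le_left _ _)
    rw [abs_lt] at h1
    rw [hδ] at h1 ⊢
    linarith [h1.1]
  obtain ⟨b1, b2, _⟩ := hTU (cc 0) (hcc 0)
  have bound : ∀ x : ℝ, 0 ≤ x → FF l (cc 0 * ((n : ℝ) + 2)) * (1 + s * x) ≤ 1 → x ≤ 1 / (δ * s) := by
    intro x hx hb
    rw [le_div_iff₀ (by positivity)]
    have : δ * (1 + s * x) ≤ 1 := le_trans (mul_le_mul_of_nonneg_right hF (by positivity)) hb
    nlinarith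
  refine ⟨T, U, T1, U1, T2, T3, U2, T4, U4, bound _ (tsum_nonneg T2) b1, bound _ (tsum_nonneg U2) b2,
    fun i hi => ?_⟩
  rw [← (hTU (cc i) (hcc i)).2.2]
  exact (hlS _ (hmem i hi)).trans_le (min_le_right _ _)

lemma anti_bound {T : ℕ → ℝ} (hT : Antitone T) (h0 : ∀ k, 0 ≤ T k) (hs : Summable T) {C : ℝ}
    (hC : ∑' k, T k ≤ C) (k : ℕ) : T k ≤ C / ((k : ℝ) + 1) := by
  rw [le_div_iff₀ (by positivity)]
  have h1 : ∑ i ∈ Finset.range (k + 1), T k ≤ ∑ i ∈ Finset.range (k + 1), T i :=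
    Finset.sum_le_sum fun i hi => hT (by simp at hi; omega)
  have h2 := hs.sum_le_tsum (Finset.range (k + 1)) (fun i _ => h0 i)
  simp at h1
  linarith

lemma summable_inv_sq (C : ℝ) : Summable (fun k : ℕ => 2 * (C / ((k : ℝ) + 1)) ^ 2) := by
  have h1 : Summable (fun k : ℕ => 1 / ((k : ℝ) ^ 2)) := Real.summable_one_div_nat_pow.2 one_lt_two
  have h2 := ((summable_nat_add_iff 1).2 h1).mul_left (2 * C ^ 2)
  refine h2.congr fun k => ?_
  push_cast
  field_simp

lemma hard_real {a : ℕ → ℝ} (h : Std a) : ∃ γ : ℝ, 0 ≤ γ ∧ ∃ T U : ℕ → ℝ, (∀ k, 0 ≤ T k) ∧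
    (∀ k, T k ≤ 1) ∧ (∀ k, 0 ≤ U k) ∧ Summable T ∧ Summable U ∧
    ∀ i, al a (cc i) * ∏' k, (1 + 1 / (1 + cc i) * U k) =
      Real.exp (-(γ * (1 / (1 + cc i)))) * ∏' k, (1 - 1 / (1 + cc i) * T k) := by
  obtain ⟨C, hC, happ⟩ := approx h
  choose T U T1 U1 T2 T3 U2 T4 U4 T5 U5 hTU using happ
  set K : Set ((ℕ → ℝ) × (ℕ → ℝ) × ℝ) := (Set.univ.pi fun _ => Set.Icc 0 C) ×ˢ
    ((Set.univ.pi fun _ => Set.Icc 0 C) ×ˢ Set.Icc 0 (C + C)) with hK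
  have hKc : IsCompact K := (isCompact_univ_pi fun _ => isCompact_Icc).prod
    ((isCompact_univ_pi fun _ => isCompact_Icc).prod isCompact_Icc)
  have Tb : ∀ j k, T j k ≤ C / ((k : ℝ) + 1) := fun j => anti_bound (T1 j) (T2 j) (T4 j) (T5 j)
  have Ub : ∀ j k, U j k ≤ C / ((k : ℝ) + 1) := fun j => anti_bound (U1 j) (U2 j) (U4 j) (U5 j)
  have hCk : ∀ k : ℕ, C / ((k : ℝ) + 1) ≤ C := fun k =>
    div_le_self hC (by have : (0 : ℝ) ≤ k := by positivity
                       linarith)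
  obtain ⟨⟨t, u, Γ⟩, -, φ, hφ, hlim⟩ := hKc.tendsto_subseq
    (x := fun j => (T j, U j, ∑' k, T j k + ∑' k, U j k)) (fun j => by
      refine ⟨fun k _ => ⟨T2 j k, (Tb j k).trans (hCk k)⟩, fun k _ => ⟨U2 j k, (Ub j k).trans (hCk k)⟩,
        add_nonneg (tsum_nonneg (T2 j)) (tsum_nonneg (U2 j)), add_le_add (T5 j) (U5 j)⟩)
  rw [nhds_prod_eq, nhds_prod_eq] at hlim
  have lT' : Tendsto (fun j => T (φ j)) atTop (𝓝 t) := tendsto_fst.comp hlim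
  have lU' : Tendsto (fun j => U (φ j)) atTop (𝓝 u) := tendsto_fst.comp (tendsto_snd.comp hlim)
  have lG : Tendsto (fun j => ∑' k, T (φ j) k + ∑' k, U (φ j) k) atTop (𝓝 Γ) :=
    tendsto_snd.comp (tendsto_snd.comp hlim)
  have lT : ∀ k, Tendsto (fun j => T (φ j) k) atTop (𝓝 (t k)) := tendsto_pi_nhds.1 lT'
  have lU : ∀ k, Tendsto (fun j => U (φ j) k) atTop (𝓝 (u k)) := tendsto_pi_nhds.1 lU'
  have t0 : ∀ k, 0 ≤ t k := fun k => ge_of_tendsto' (lT k) fun j => T2 _ k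
  have u0 : ∀ k, 0 ≤ u k := fun k => ge_of_tendsto' (lU k) fun j => U2 _ k
  have t1 : ∀ k, t k ≤ 1 := fun k => le_of_tendsto' (lT k) fun j => T3 _ k
  have hpart : ∀ M : ℕ, ∑ k ∈ Finset.range M, t k + ∑ k ∈ Finset.range M, u k ≤ Γ := by
    intro M
    refine le_of_tendsto_of_tendsto' ((tendsto_finsetSum _ fun k _ => lT k).add
      (tendsto_finsetSum _ fun k _ => lU k)) lG fun j => ?_
    exact add_le_add ((T4 _).sum_le_tsum _ fun k _ => T2 _ k) ((U4 _).sum_le_tsum _ fun k _ => U2 _ k)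
  have st : Summable t := summable_of_sum_range_le t0 (c := Γ) fun M => by
    have : 0 ≤ ∑ k ∈ Finset.range M, u k := Finset.sum_nonneg fun k _ => u0 k
    linarith [hpart M]
  have su : Summable u := summable_of_sum_range_le u0 (c := Γ) fun M => by
    have : 0 ≤ ∑ k ∈ Finset.range M, t k := Finset.sum_nonneg fun k _ => t0 k
    linarith [hpart M]
  have hΓ : ∑' k, t k + ∑' k, u k ≤ Γ :=
    le_of_tendsto' (st.hasSum.tendsto_sum_nat.add su.hasSum.tendsto_sum_nat) hpart
  refine ⟨Γ - ∑' k, t k - ∑' k, u k, by linarith, t, u, t0, t1, u0, st, su, fun i => ?_⟩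
  set s := 1 / (1 + cc i) with hs
  have hci := cc_gt i
  have hs0 : 0 < s := by have := hci; positivity
  have hs1 : s ≤ 1 / 2 := by
    rw [hs]; gcongr; linarith
  have lP : Tendsto (fun j => PP s (T (φ j))) atTop (𝓝 (PP s t)) := by
    refine tendsto_tsum_of_dominated_convergence (summable_inv_sq C) (fun k => ?_) ?_
    · have hne : 1 - s * t k ≠ 0 := by nlinarith [t0 k, t1 k]
      exact ((tendsto_const_nhds.sub ((lT k).const_mul s)).log hne).add ((lT k).const_mul s)
    · refine Eventually.of_forall fun j k => ?_
      have a1 := T2 (φ j) k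
      have a2 := T3 (φ j) k
      refine (PP_bound (mul_nonneg hs0.le a1) (by nlinarith)).trans ?_
      have : s * T (φ j) k ≤ C / ((k : ℝ) + 1) := by nlinarith [Tb (φ j) k]
      gcongr
  have lQ : Tendsto (fun j => QQ s (U (φ j))) atTop (𝓝 (QQ s u)) := by
    refine tendsto_tsum_of_dominated_convergence (summable_inv_sq C) (fun k => ?_) ?_
    · have hne : 1 + s * u k ≠ 0 := by nlinarith [u0 k]
      exact ((tendsto_const_nhds.add ((lU k).const_mul s)).log hne).sub ((lU k).const_mul s)
    · refine Eventually.of_forall fun j k => ?_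
      have a1 := U2 (φ j) k
      refine (QQ_bound (mul_nonneg hs0.le a1)).trans ?_
      have h1 : s * U (φ j) k ≤ C / ((k : ℝ) + 1) := by nlinarith [Ub (φ j) k]
      have h2 : (s * U (φ j) k) ^ 2 ≤ (C / ((k : ℝ) + 1)) ^ 2 := by gcongr
      nlinarith [sq_nonneg (C / ((k : ℝ) + 1))]
  have l1 : Tendsto (fun j => Real.exp (PP s (T (φ j)) - QQ s (U (φ j)) -
      s * (∑' k, T (φ j) k + ∑' k, U (φ j) k))) atTop (𝓝 (Real.exp (PP s t - QQ s u - s * Γ))) :=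
    (Real.continuous_exp.tendsto _).comp ((lP.sub lQ).sub (lG.const_mul s))
  have l2 : Tendsto (fun j => Real.exp (PP s (T (φ j)) - QQ s (U (φ j)) -
      s * (∑' k, T (φ j) k + ∑' k, U (φ j) k))) atTop (𝓝 (al a (cc i))) := by
    rw [tendsto_iff_norm_sub_tendsto_zero]
    have hz : Tendsto (fun j : ℕ => 1 / ((φ j : ℝ) + 1)) atTop (𝓝 0) :=
      tendsto_one_div_add_atTop_nhds_zero_nat.comp hφ.tendsto_atTop
    refine squeeze_zero' (Eventually.of_forall fun j => norm_nonneg _) ?_ hz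
    filter_upwards [eventually_ge_atTop i] with j hj
    exact (hTU (φ j) i (hj.trans (hφ.id_le j))).le
  have hal : al a (cc i) = Real.exp (PP s t - QQ s u - s * Γ) := tendsto_nhds_unique l2 l1
  have pt : ∀ k, 0 < 1 - s * t k := fun k => by nlinarith [t0 k, t1 k]
  have pu : ∀ k, 0 < 1 + s * u k := fun k => by nlinarith [u0 k]
  have sst := st.mul_left s
  have ssu := su.mul_left s
  have slt : Summable (fun k => Real.log (1 - s * t k)) := by
    simpa [sub_eq_add_neg] using Real.summable_log_one_add_of_summable sst.neg
  have slu : Summable (fun k => Real.log (1 + s * u k)) := Real.summable_log_one_add_of_summable ssu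
  rw [← Real.rexp_tsum_eq_tprod pt slt, ← Real.rexp_tsum_eq_tprod pu slu, hal, ← Real.exp_add,
    ← Real.exp_add]
  congr 1
  rw [PP, QQ, slt.tsum_add sst, slu.tsum_sub ssu, tsum_mul_left, tsum_mul_left]
  ring

end Edrei

namespace Edrei

/-- infinite products -/
noncomputable def EE (c : ℕ → ℝ) (w : ℂ) : ℂ := ∏' k, (1 + (c k : ℂ) * w)

lemma EE_summable {c : ℕ → ℝ} (hc : Summable c) (w : ℂ) : Summable (fun k => ‖(c k : ℂ) * w‖) := by
  simp only [norm_mul, Complex.norm_real]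
  exact hc.norm.mul_right _

lemma EE_mult {c : ℕ → ℝ} (hc : Summable c) (w : ℂ) : Multipliable (fun k => 1 + (c k : ℂ) * w) :=
  multipliable_one_add_of_summable (EE_summable hc w)

lemma EE_ne {c : ℕ → ℝ} (hc : Summable c) {w : ℂ} (h : ∀ k, 1 + (c k : ℂ) * w ≠ 0) : EE c w ≠ 0 :=
  tprod_one_add_ne_zero_of_summable h (EE_summable hc w)

lemma EE_diff {c : ℕ → ℝ} (hc : Summable c) (R : ℝ) :
    DifferentiableOn ℂ (EE c) (Metric.ball 0 R) := by
  have h1 : HasProdLocallyUniformlyOn (fun k w => 1 + (c k : ℂ) * w)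
      (fun w => ∏' k, (1 + (c k : ℂ) * w)) (Metric.ball (0 : ℂ) R) := by
    refine Summable.hasProdLocallyUniformlyOn_one_add Metric.isOpen_ball (hc.norm.mul_right R) ?_ ?_
    · refine Eventually.of_forall fun k w hw => ?_
      rw [norm_mul, Complex.norm_real]
      have : ‖w‖ < R := by simpa using hw
      gcongr
    · intro k; fun_prop
  refine h1.differentiableOn (Eventually.of_forall fun s => ?_) Metric.isOpen_ball
  simpa [Finset.prod_fn] using
    DifferentiableOn.finsetProd (fun _ _ ↦ by fun_prop)

lemma EE_ofReal {c : ℕ → ℝ} (hc : Summable c) (s : ℝ) :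
    EE c (s : ℂ) = ((∏' k, (1 + c k * s) : ℝ) : ℂ) := by
  have h := Multipliable.map_tprod (Real.multipliable_one_add_of_summable (hc.mul_right s))
    Complex.ofRealHom Complex.continuous_ofReal
  simp only [Complex.ofRealHom_eq_coe] at h
  rw [h, EE]
  refine tprod_congr fun k => by push_cast; ring

lemma summable_d {c : ℕ → ℝ} (hc : Summable c) : Summable (fun k => - c k / (1 + c k)) := by
  refine Summable.of_norm_bounded_eventually_nat (hc.norm.mul_left 2) ?_
  have := hc.tendsto_atTop_zero.norm
  rw [norm_zero] at this
  filter_upwards [this.eventually (gt_mem_nhds (show (0 : ℝ) < 1 / 2 by norm_num))] with k hk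
  rw [Real.norm_eq_abs, abs_lt] at hk
  have h1 : 0 < 1 + c k := by linarith
  rw [norm_div, norm_neg, Real.norm_of_nonneg h1.le, div_le_iff₀ h1]
  nlinarith [norm_nonneg (c k)]

lemma EE_shift {c : ℕ → ℝ} (hc : Summable c) (h : ∀ k, 1 + c k ≠ 0) (z : ℂ) :
    EE c (1 - z) = EE c 1 * EE (fun k => - c k / (1 + c k)) z := by
  rw [EE, EE, EE, ← (EE_mult hc 1).tprod_mul (EE_mult (summable_d hc) z)]
  refine tprod_congr fun k => ?_
  have : (1 : ℂ) + c k ≠ 0 := by exact_mod_cast h k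
  push_cast
  field_simp
  ring

lemma A_bound {a : ℕ → ℝ} (h : Std a) (m : ℕ) {z : ℂ} (hz : ‖z‖ < 1) : ‖(a m : ℂ) * z ^ m‖ ≤ a m := by
  rw [norm_mul, norm_pow, Complex.norm_real, Real.norm_of_nonneg (h.nonneg m)]
  exact mul_le_of_le_one_right (h.nonneg m) (pow_le_one₀ (norm_nonneg _) hz.le)

lemma cc_z (i : ℕ) : cc i / (cc i + 1) = 1 - 1 / (1 + cc i) := by
  have := cc_gt i
  have : 1 + cc i ≠ 0 := by linarith
  have : cc i + 1 ≠ 0 := by linarith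
  field_simp
  ring

lemma cc_lim : Tendsto (fun i => ((1 - 1 / (1 + cc i) : ℝ) : ℂ)) atTop (𝓝[≠] ((1 / 2 : ℝ) : ℂ)) := by
  refine tendsto_nhdsWithin_iff.2 ⟨?_, Eventually.of_forall fun i => ?_⟩
  · have h1 : Tendsto cc atTop (𝓝 (1 + 0)) :=
      tendsto_const_nhds.add tendsto_one_div_add_atTop_nhds_zero_nat
    have h2 : Tendsto (fun i => 1 - 1 / (1 + cc i)) atTop (𝓝 (1 - 1 / (1 + (1 + 0)))) :=
      tendsto_const_nhds.sub (tendsto_const_nhds.div (tendsto_const_nhds.add h1) (by norm_num))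
    have e : (1 - 1 / (1 + (1 + 0)) : ℝ) = 1 / 2 := by norm_num
    rw [e] at h2
    exact (Complex.continuous_ofReal.tendsto _).comp h2
  · have h1 := cc_gt i
    simp only [Set.mem_compl_iff, Set.mem_singleton_iff, Complex.ofReal_inj]
    have : 1 / (1 + cc i) < 1 / 2 := by gcongr; linarith
    intro hcon
    linarith

lemma std_hard {a : ℕ → ℝ} (h : Std a) : ∃ γ : ℝ, 0 ≤ γ ∧ ∃ t u : ℕ → ℝ, (∀ i, 0 ≤ t i) ∧
    (∀ i, 0 ≤ u i) ∧ Summable t ∧ Summable u ∧ ∀ z : ℂ, ‖z‖ < 1 →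
      EE (fun k => - u k) z ≠ 0 ∧
      HasSum (fun k => (a k : ℂ) * z ^ k) (Complex.exp (γ * z) * EE t z / EE (fun k => - u k) z) := by
  obtain ⟨γ, hγ, T, U, T0, T1, U0, sT, sU, hI⟩ := hard_real h
  set A : ℂ → ℂ := fun z => ∑' m, (a m : ℂ) * z ^ m with hA
  set A1 : ℝ := Ag a 1 with hA1
  have hA1pos : 0 < A1 := Ag_pos h zero_le_one le_rfl
  have sT' : Summable (fun k => - T k) := sT.neg
  set f : ℂ → ℂ := fun z => A z * EE U (1 - z) with hf
  set g : ℂ → ℂ := fun z => A1 * Complex.exp (-(γ * (1 - z))) * EE (fun k => - T k) (1 - z) with hg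
  have hmaps : Set.MapsTo (fun z : ℂ => 1 - z) (Metric.ball 0 1) (Metric.ball 0 2) := by
    intro z hz
    have : ‖z‖ < 1 := by simpa using hz
    have h2 := norm_sub_le (1 : ℂ) z
    rw [norm_one] at h2
    simp only [Metric.mem_ball, dist_zero_right]
    linarith
  have dsub : DifferentiableOn ℂ (fun z : ℂ => 1 - z) (Metric.ball 0 1) := by fun_prop
  have dA : DifferentiableOn ℂ A (Metric.ball 0 1) := by
    refine Complex.differentiableOn_tsum_of_summable_norm h.summable (fun m => by fun_prop)
      Metric.isOpen_ball fun m z hz => A_bound h m (by simpa using hz)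
  have df : DifferentiableOn ℂ f (Metric.ball 0 1) :=
    dA.mul ((EE_diff sU 2).comp dsub hmaps)
  have dg : DifferentiableOn ℂ g (Metric.ball 0 1) :=
    DifferentiableOn.mul (by fun_prop) ((EE_diff sT' 2).comp dsub hmaps)
  have hpt : ∀ i, f ((1 - 1 / (1 + cc i) : ℝ) : ℂ) = g ((1 - 1 / (1 + cc i) : ℝ) : ℂ) := by
    intro i
    have e := hI i
    rw [al, cc_z, ← hA1, div_mul_eq_mul_div, div_eq_iff hA1pos.ne'] at e
    set s := 1 / (1 + cc i) with hs
    have e1 : (1 : ℂ) - ((1 - s : ℝ) : ℂ) = (s : ℂ) := by push_cast; ring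
    have e2 : A ((1 - s : ℝ) : ℂ) = ((Ag a (1 - s) : ℝ) : ℂ) := by
      rw [hA, Ag]; push_cast; rfl
    simp only [hf, hg]
    have e3 : Complex.exp (-((γ : ℂ) * (s : ℂ))) = ((Real.exp (-(γ * s)) : ℝ) : ℂ) := by
      push_cast; rfl
    rw [e1, e2, EE_ofReal sU, EE_ofReal sT', e3, ← Complex.ofReal_mul, ← Complex.ofReal_mul,
      ← Complex.ofReal_mul]
    congr 1
    have c1 : ∏' k, (1 + U k * s) = ∏' k, (1 + s * U k) := tprod_congr fun k => by ring
    have c2 : ∏' k, (1 + -T k * s) = ∏' k, (1 - s * T k) := tprod_congr fun k => by ring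
    rw [c1, c2, e]
    ring
  have hEq : Set.EqOn f g (Metric.ball 0 1) := by
    refine AnalyticOnNhd.eqOn_of_preconnected_of_frequently_eq
      (df.analyticOnNhd Metric.isOpen_ball) (dg.analyticOnNhd Metric.isOpen_ball)
      (convex_ball (0 : ℂ) 1).isPreconnected (z₀ := ((1 / 2 : ℝ) : ℂ)) ?_ ?_
    · simp only [Metric.mem_ball, dist_zero_right, Complex.norm_real]
      norm_num
    · exact cc_lim.frequently (Eventually.frequently (Eventually.of_forall hpt))
  have hA0 : A 0 = 1 := by
    rw [hA]
    simp only
    rw [tsum_eq_single 0 (fun m hm => by simp [hm])]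
    simp [h.zero]
  have h0 := hEq (Metric.mem_ball_self one_pos)
  simp only [hf, hg, sub_zero, hA0, one_mul, mul_one] at h0
  have U1 : ∀ k, 1 + U k ≠ 0 := fun k => by linarith [U0 k]
  have hEU : EE U 1 ≠ 0 := EE_ne sU fun k => by
    rw [mul_one]; exact_mod_cast U1 k
  have T2 : ∀ k, 1 + -T k ≠ 0 := by
    intro k hk
    apply hEU
    have : EE (fun k => - T k) 1 = 0 := tprod_of_exists_eq_zero ⟨k, by
      rw [mul_one]; exact_mod_cast hk⟩
    rw [h0, this, mul_zero]
  have T3 : ∀ k, 0 < 1 - T k := fun k => lt_of_le_of_ne (by linarith [T1 k])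
    (by have := T2 k; intro hc; apply this; linarith)
  refine ⟨γ, hγ, fun k => - (- T k) / (1 + - T k), fun k => U k / (1 + U k), ?_, ?_, summable_d sT', ?_, ?_⟩
  · intro k
    refine div_nonneg (by simpa using T0 k) (by linarith [T3 k])
  · intro k
    exact div_nonneg (U0 k) (by linarith [U0 k])
  · have := (summable_d sU).neg
    refine this.congr fun k => by ring
  intro z hz
  have eU : (fun k => - (U k / (1 + U k))) = fun k => - U k / (1 + U k) := by ext k; ring
  rw [eU]
  have hne : EE (fun k => - U k / (1 + U k)) z ≠ 0 := by
    refine EE_ne (summable_d sU) fun k hk => ?_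
    have h1 : ‖((- U k / (1 + U k) : ℝ) : ℂ) * z‖ < 1 := by
      rw [norm_mul, Complex.norm_real, norm_div, norm_neg, Real.norm_of_nonneg (U0 k),
        Real.norm_of_nonneg (by linarith [U0 k])]
      have h2 : U k / (1 + U k) ≤ 1 := by
        rw [div_le_one (by linarith [U0 k])]; linarith
      have h3 : 0 ≤ U k / (1 + U k) := div_nonneg (U0 k) (by linarith [U0 k])
      nlinarith [norm_nonneg z]
    have h2 : ((- U k / (1 + U k) : ℝ) : ℂ) * z = -1 := by
      linear_combination hk
    rw [h2] at h1
    simp at h1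
  refine ⟨hne, ?_⟩
  have hs : Summable (fun k => (a k : ℂ) * z ^ k) :=
    Summable.of_norm_bounded h.summable fun m => A_bound h m hz
  have hzE := hEq (show z ∈ Metric.ball (0 : ℂ) 1 by simpa using hz)
  simp only [hf, hg] at hzE
  rw [EE_shift sU U1 z, EE_shift sT' T2 z] at hzE
  have hexp : Complex.exp (-((γ : ℂ) * (1 - z))) = Complex.exp (-(γ : ℂ)) * Complex.exp (γ * z) := by
    rw [← Complex.exp_add]; congr 1; ring
  rw [hexp] at hzE
  have hfin : A z = Complex.exp (γ * z) * EE (fun k => - (- T k) / (1 + - T k)) z /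
      EE (fun k => - U k / (1 + U k)) z := by
    rw [eq_div_iff hne]
    apply mul_left_cancel₀ hEU
    calc _ = A z * (EE U 1 * EE (fun k => - U k / (1 + U k)) z) := by ring
      _ = _ := hzE
      _ = (A1 * Complex.exp (-(γ : ℂ)) * EE (fun k => - T k) 1) *
          (Complex.exp (γ * z) * EE (fun k => - (- T k) / (1 + - T k)) z) := by ring
      _ = _ := by rw [← h0]
  rw [← hfin]
  exact hs.hasSum

lemma tp_scale {a : ℕ → ℝ} (ha : IsTotallyPositive a) {r : ℝ} (hr : 0 < r) :
    IsTotallyPositive (fun k => a k * r ^ k) := by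
  intro n hn i j hi hj
  have e : (Matrix.of fun s t => seqExt (fun k => a k * r ^ k) ((i s : ℤ) - (j t : ℤ))) =
      Matrix.of fun s t => r ^ (i s) * (Matrix.of fun s t => (r ^ (j t))⁻¹ *
        (Matrix.of fun s t => seqExt a ((i s : ℤ) - (j t : ℤ))) s t) s t := by
    ext s t
    simp only [Matrix.of_apply]
    rcases le_or_gt (j t) (i s) with hle | hlt
    · rw [seqExt_sub_le _ hle, seqExt_sub_le _ hle]
      obtain ⟨q, hq⟩ := Nat.exists_eq_add_of_le hle
      rw [hq, Nat.add_sub_cancel_left, pow_add]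
      field_simp
    · rw [seqExt_sub_lt _ hlt, seqExt_sub_lt _ hlt]; simp
  rw [e, Matrix.det_mul_column, Matrix.det_mul_row]
  refine mul_nonneg (Finset.prod_nonneg fun s _ => by positivity)
    (mul_nonneg (Finset.prod_nonneg fun s _ => by positivity) (ha n hn i j hi hj))

theorem hard (a : ℕ → ℝ) (ha : a 0 = 1) (htp : IsTotallyPositive a) :
      ∃ (γ : ℝ), 0 ≤ γ ∧ ∃ (t u : ℕ → ℝ),
        (∀ i, 0 ≤ t i) ∧ (∀ i, 0 ≤ u i) ∧ Summable (fun i => t i + u i) ∧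
        ∃ ε : ℝ, 0 < ε ∧ ∀ z : ℂ, ‖z‖ < ε →
          Multipliable (fun i => (1 + (t i : ℂ) * z)) ∧
          Multipliable (fun i => (1 - (u i : ℂ) * z)) ∧
          (∏' i, (1 - (u i : ℂ) * z)) ≠ 0 ∧
          HasSum (fun k => (a k : ℂ) * z ^ k)
            (Complex.exp ((γ : ℂ) * z) * (∏' i, (1 + (t i : ℂ) * z)) /
              (∏' i, (1 - (u i : ℂ) * z))) := by
  have ha1 : 0 ≤ a 1 := tp_nonneg htp 1
  set r : ℝ := 1 / (2 * (a 1 + 1)) with hr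
  have hr0 : 0 < r := by positivity
  have hstd : Std (fun k => a k * r ^ k) := by
    refine ⟨tp_scale htp hr0, by simp [ha], fun k => ?_⟩
    calc a k * r ^ k ≤ a 1 ^ k * r ^ k := by
          gcongr; exact tp_le_pow htp ha k
      _ = (a 1 * r) ^ k := by rw [mul_pow]
      _ ≤ (1 / 2) ^ k := by
          gcongr
          rw [hr, mul_one_div, div_le_div_iff₀ (by positivity) (by norm_num)]
          linarith
  obtain ⟨γ, hγ, t, u, t0, u0, st, su, hz⟩ := std_hard hstd
  refine ⟨γ / r, by positivity, fun i => t i / r, fun i => u i / r, fun i => div_nonneg (t0 i) hr0.le,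
    fun i => div_nonneg (u0 i) hr0.le, (st.div_const r).add (su.div_const r), r, hr0, fun z hzr => ?_⟩
  have hrc : (r : ℂ) ≠ 0 := by exact_mod_cast hr0.ne'
  have hw : ‖z / r‖ < 1 := by
    rw [norm_div, Complex.norm_real, Real.norm_of_nonneg hr0.le, div_lt_one hr0]; exact hzr
  obtain ⟨h1, h2⟩ := hz (z / r) hw
  have e1 : ∀ i, (1 + ((t i / r : ℝ) : ℂ) * z) = 1 + (t i : ℂ) * (z / r) := fun i => by
    push_cast; ring
  have e2 : ∀ i, (1 - ((u i / r : ℝ) : ℂ) * z) = 1 + ((- u i : ℝ) : ℂ) * (z / r) := fun i => by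
    push_cast; ring
  have e3 : ∀ k, (a k : ℂ) * z ^ k = ((a k * r ^ k : ℝ) : ℂ) * (z / r) ^ k := fun k => by
    push_cast; rw [div_pow]; field_simp
  have e4 : ((γ / r : ℝ) : ℂ) * z = (γ : ℂ) * (z / r) := by push_cast; ring
  simp_rw [e1, e2, e3, e4]
  exact ⟨EE_mult st _, EE_mult su.neg _, h1, h2⟩

end Edrei

end EdreiHelpers

/-- Theorem 2.2 (Edrei): a sequence `a` with `a₀ = 1` is totally positive if and only
if its generating function has the form `e^{γz}·∏(1+t_iz)/∏(1−u_iz)` with `γ ≥ 0`,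
`t_i, u_i ≥ 0`, `Σ(t_i+u_i) < ∞`, as an identity of convergent complex functions in a
neighbourhood of zero. -/
theorem edrei_theorem (a : ℕ → ℝ) (ha : a 0 = 1) :
    IsTotallyPositive a ↔
      ∃ (γ : ℝ), 0 ≤ γ ∧ ∃ (t u : ℕ → ℝ),
        (∀ i, 0 ≤ t i) ∧ (∀ i, 0 ≤ u i) ∧ Summable (fun i => t i + u i) ∧
        ∃ ε : ℝ, 0 < ε ∧ ∀ z : ℂ, ‖z‖ < ε →
          Multipliable (fun i => (1 + (t i : ℂ) * z)) ∧
          Multipliable (fun i => (1 - (u i : ℂ) * z)) ∧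
          (∏' i, (1 - (u i : ℂ) * z)) ≠ 0 ∧
          HasSum (fun k => (a k : ℂ) * z ^ k)
            (Complex.exp ((γ : ℂ) * z) * (∏' i, (1 + (t i : ℂ) * z)) /
              (∏' i, (1 - (u i : ℂ) * z))) := by
  constructor
  · exact fun h => Edrei.hard a ha h
  · rintro ⟨γ, hγ, t, u, ht, hu, hs, ε, hε, h⟩
    exact Edrei.easy a γ hγ t u ht hu hs ε hε h
end

section
/- Let R be a Hecke operator on V and assume the quantum integers [k]_q = 1 + q + ⋯ + q^{k−1} are nonzero in K for every integer k ≥ 1. For n ≥ 2 and 1 ≤ i ≤ n−1 let R_i = id_V^{⊗(i−1)} ⊗ R ⊗ id_V^{⊗(n−1−i)} ∈ End_K(V^{⊗n}), and let A_n be the unital K-subalgebra of End_K(V^{⊗n}) generated by R_1, …, R_{n−1} (the image of the Hecke algebra H_n under the representation induced by R). Then A_n equals its own double centralizer: the centralizer in End_K(V^{⊗n}) of the centralizer of A_n is exactly A_n. (Theorem 1.1, the quantum double centralizer theorem) -/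
open TensorProduct PiTensorProduct

/-- The Yang–Baxter equation for an operator `R` on `V ⊗ V`, stated on `(V ⊗ V) ⊗ V`:
`(R ⊗ 1)(1 ⊗ R)(R ⊗ 1) = (1 ⊗ R)(R ⊗ 1)(1 ⊗ R)`, where `1 ⊗ R` is transported along
the associator. -/
def YangBaxter (K : Type*) [Field K] (V : Type*) [AddCommGroup V] [Module K V]
    (R : V ⊗[K] V →ₗ[K] V ⊗[K] V) : Prop :=
  let R₁ : (V ⊗[K] V) ⊗[K] V →ₗ[K] (V ⊗[K] V) ⊗[K] V := LinearMap.rTensor V R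
  let R₂ : (V ⊗[K] V) ⊗[K] V →ₗ[K] (V ⊗[K] V) ⊗[K] V :=
    (TensorProduct.assoc K V V V).symm.toLinearMap ∘ₗ LinearMap.lTensor V R ∘ₗ
      (TensorProduct.assoc K V V V).toLinearMap
  R₁ ∘ₗ R₂ ∘ₗ R₁ = R₂ ∘ₗ R₁ ∘ₗ R₂

/-- A Hecke operator on `V` for the parameter `q`: the Yang–Baxter equation together
with the Hecke equation `(R + 1)(R − q) = 0`. -/
def IsHecke (K : Type*) [Field K] (V : Type*) [AddCommGroup V] [Module K V]
    (q : K) (R : V ⊗[K] V →ₗ[K] V ⊗[K] V) : Prop :=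
  YangBaxter K V R ∧ (R + LinearMap.id) ∘ₗ (R - q • LinearMap.id) = 0

/-- The canonical identification `V^{⊗2} ≅ V ⊗ V`. -/
noncomputable def tpow2Equiv (K : Type*) [Field K] (V : Type*) [AddCommGroup V]
    [Module K V] : (⨂[K] (_ : Fin 2), V) ≃ₗ[K] V ⊗[K] V :=
  (PiTensorProduct.reindex K (fun _ : Fin 2 => V)
      (finSumFinEquiv (m := 1) (n := 1)).symm).trans <|
    ((PiTensorProduct.tmulEquiv K V (ι := Fin 1) (ι₂ := Fin 1)).symm.trans
      (TensorProduct.congr (PiTensorProduct.subsingletonEquiv (0 : Fin 1))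
        (PiTensorProduct.subsingletonEquiv (0 : Fin 1))))

/-- The identification `V^{⊗n} ≅ (V^{⊗i} ⊗ V^{⊗2}) ⊗ V^{⊗(n−i−2)}` splitting off the
tensor factors in positions `i+1`, `i+2` (order preserving). -/
noncomputable def tpowSplit (K : Type*) [Field K] (V : Type*) [AddCommGroup V]
    [Module K V] (n i : ℕ) (h : i + 2 ≤ n) :
    (⨂[K] (_ : Fin n), V) ≃ₗ[K]
      (((⨂[K] (_ : Fin i), V) ⊗[K] (⨂[K] (_ : Fin 2), V)) ⊗[K]
        (⨂[K] (_ : Fin (n - (i + 2))), V)) :=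
  (PiTensorProduct.reindex K (fun _ : Fin n => V)
      (((finCongr (Nat.add_sub_cancel' h)).symm).trans
        (finSumFinEquiv (m := i + 2) (n := n - (i + 2))).symm)).trans <|
    ((PiTensorProduct.tmulEquiv K V (ι := Fin (i + 2)) (ι₂ := Fin (n - (i + 2)))).symm.trans
      (TensorProduct.congr
        ((PiTensorProduct.reindex K (fun _ : Fin (i + 2) => V)
            (finSumFinEquiv (m := i) (n := 2)).symm).trans
          (PiTensorProduct.tmulEquiv K V (ι := Fin i) (ι₂ := Fin 2)).symm)
        (LinearEquiv.refl K _)))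

/-- The operator `R_{i+1} = id^{⊗i} ⊗ R ⊗ id^{⊗(n−i−2)}` on `V^{⊗n}`: `R` acts on the
tensor factors in (zero-based) positions `i`, `i+1`. -/
noncomputable def heckeOp (K : Type*) [Field K] (V : Type*) [AddCommGroup V]
    [Module K V] (R : V ⊗[K] V →ₗ[K] V ⊗[K] V) (n i : ℕ) (h : i + 2 ≤ n) :
    Module.End K (⨂[K] (_ : Fin n), V) :=
  (tpowSplit K V n i h).symm.toLinearMap ∘ₗ
    LinearMap.rTensor _ (LinearMap.lTensor _
      ((tpow2Equiv K V).symm.toLinearMap ∘ₗ R ∘ₗ (tpow2Equiv K V).toLinearMap)) ∘ₗ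
    (tpowSplit K V n i h).toLinearMap

/-- `A_n`: the unital subalgebra of `End(V^{⊗n})` generated by `R_1, …, R_{n−1}`, i.e.
the image of the Hecke algebra `H_n` under the representation induced by `R`. -/
noncomputable def heckeImage (K : Type*) [Field K] (V : Type*) [AddCommGroup V]
    [Module K V] (R : V ⊗[K] V →ₗ[K] V ⊗[K] V) (n : ℕ) :
    Subalgebra K (Module.End K (⨂[K] (_ : Fin n), V)) :=
  Algebra.adjoin K (Set.range fun i : Fin (n - 1) => heckeOp K V R n i (by omega))

namespace HeckeDC

section Alg
variable {K : Type*} [Field K] {A : Type*} [Ring A] [Algebra K A]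

/-- The relations of the Hecke algebra for `T 0, …, T (m-1)`. -/
structure HeckeRel (q : K) (T : ℕ → A) (m : ℕ) : Prop where
  quad : ∀ i, i < m → T i * T i = q • (1 : A) + (q - 1) • T i
  comm : ∀ i j, i + 2 ≤ j → j < m → T i * T j = T j * T i
  braid : ∀ i, i + 1 < m → T i * T (i + 1) * T i = T (i + 1) * T i * T (i + 1)

theorem HeckeRel.mono {q : K} {T : ℕ → A} {m k : ℕ} (h : HeckeRel q T m) (hk : k ≤ m) :
    HeckeRel q T k :=
  ⟨fun i hi => h.quad i (by omega), fun i j hi hj => h.comm i j hi (by omega),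
    fun i hi => h.braid i (by omega)⟩

/-- Relative trace. -/
def rtr (q : K) (T : ℕ → A) : ℕ → A → A
  | 0, f => f
  | k + 1, f => f + q⁻¹ • rtr q T k (T k * f * T k)

/-- Jucys–Murphy elements. -/
def jm (q : K) (T : ℕ → A) : ℕ → A
  | 0 => 1
  | k + 1 => q⁻¹ • (T k * jm q T k * T k)

variable {q : K} {T : ℕ → A} {m : ℕ}

theorem rtr_add (k : ℕ) : ∀ f g : A, rtr q T k (f + g) = rtr q T k f + rtr q T k g := by
  induction k with
  | zero => intros; rfl
  | succ k ih => intro f g; simp only [rtr, mul_add, add_mul, ih, smul_add]; abel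

theorem rtr_smul (k : ℕ) (c : K) : ∀ f : A, rtr q T k (c • f) = c • rtr q T k f := by
  induction k with
  | zero => intros; rfl
  | succ k ih =>
    intro f
    simp only [rtr, mul_smul_comm, smul_mul_assoc, ih, smul_add, smul_smul, mul_comm]

theorem rtr_mul_left (k : ℕ) (c : A) (hc : ∀ j, j < k → Commute c (T j)) :
    ∀ f : A, rtr q T k (c * f) = c * rtr q T k f := by
  induction k with
  | zero => intros; rfl
  | succ k ih =>
    intro f
    have h := (hc k (by omega)).eq
    have : T k * (c * f) * T k = c * (T k * f * T k) := by
      simp only [← mul_assoc, h]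
    simp only [rtr, this, ih (fun j hj => hc j (by omega)), mul_add, mul_smul_comm]

theorem rtr_mul_right (k : ℕ) (c : A) (hc : ∀ j, j < k → Commute c (T j)) :
    ∀ f : A, rtr q T k (f * c) = rtr q T k f * c := by
  induction k with
  | zero => intros; rfl
  | succ k ih =>
    intro f
    have h := (hc k (by omega)).eq
    have : T k * (f * c) * T k = (T k * f * T k) * c := by
      simp only [mul_assoc, h]
    simp only [rtr, this, ih (fun j hj => hc j (by omega)), add_mul, smul_mul_assoc]

/-- If `c` commutes with `f` and the `T j`, it commutes with the relative trace. -/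
theorem commute_rtr (k : ℕ) (c : A) (hc : ∀ j, j < k → Commute c (T j)) (f : A)
    (hf : Commute c f) : Commute c (rtr q T k f) := by
  rw [Commute, SemiconjBy, ← rtr_mul_left k c hc, ← rtr_mul_right k c hc, hf.eq]

theorem HeckeRel.commT (h : HeckeRel q T m) {i j : ℕ} (hi : i < m) (hj : j < m)
    (hij : i + 2 ≤ j ∨ j + 2 ≤ i) : Commute (T i) (T j) := by
  rcases hij with hij | hij
  · exact h.comm i j hij hj
  · exact (h.comm j i hij hi).symm

theorem rtr_comm (hq : q ≠ 0) (k : ℕ) : ∀ (_ : HeckeRel q T k) (f : A)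
    (_ : ∀ j, j + 1 < k → Commute (T j) f) (j : ℕ) (_ : j < k), Commute (T j) (rtr q T k f) := by
  induction k with
  | zero => intro _ _ _ j hj; omega
  | succ k ih =>
    intro h f hf j hj
    by_cases hjk : j < k
    · refine (hf j (by omega)).add_right (Commute.smul_right ?_ _)
      refine ih (h.mono (by omega)) _ (fun i hi => ?_) j hjk
      have h1 : Commute (T i) (T k) := h.commT (by omega) (by omega) (Or.inl (by omega))
      exact (h1.mul_right (hf i (by omega))).mul_right h1
    · obtain rfl : j = k := by omega
      have key : Commute (T j) (f + q⁻¹ • (T j * f * T j)) := by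
        rw [Commute, SemiconjBy]
        have h2 := h.quad j hj
        have e1 : T j * (T j * f * T j) = (T j * T j) * f * T j := by noncomm_ring
        have e2 : (T j * f * T j) * T j = T j * f * (T j * T j) := by noncomm_ring
        rw [mul_add, add_mul, mul_smul_comm, smul_mul_assoc, e1, e2, h2]
        simp only [mul_add, add_mul, smul_mul_assoc, mul_smul_comm, one_mul, mul_one, smul_add,
          smul_smul, inv_mul_cancel₀ hq, one_smul]
        abel
      cases j with
      | zero => simpa [rtr] using key
      | succ i =>
        have e : rtr q T (i + 1 + 1) f = (f + q⁻¹ • (T (i+1) * f * T (i+1))) +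
            q⁻¹ • q⁻¹ • rtr q T i (T i * (T (i+1) * f * T (i+1)) * T i) := by
          simp only [rtr, smul_add, add_assoc]
        rw [e]
        refine key.add_right (Commute.smul_right (Commute.smul_right ?_ _) _)
        refine commute_rtr _ _ (fun l hl => h.commT (by omega) (by omega) (Or.inr (by omega))) _ ?_
        have hb := h.braid i (by omega)
        have hfi := (hf i (by omega)).eq
        rw [Commute, SemiconjBy]
        generalize T i = a at *
        generalize T (i+1) = b at *
        calc b * (a * (b * f * b) * a) = (b * a * b) * f * b * a := by noncomm_ring
          _ = (a * b) * (a * f) * b * a := by rw [← hb]; noncomm_ring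
          _ = (a * b) * f * (a * b * a) := by rw [hfi]; noncomm_ring
          _ = _ := by rw [hb]; noncomm_ring

theorem jm_commute_gt (h : HeckeRel q T m) (k : ℕ) :
    ∀ j, k < j → j < m → Commute (T j) (jm q T k) := by
  induction k with
  | zero => intro j _ _; exact Commute.one_right _
  | succ k ih =>
    intro j hj hjm
    have h1 : Commute (T j) (T k) := h.commT (by omega) (by omega) (Or.inr (by omega))
    exact Commute.smul_right ((h1.mul_right (ih j (by omega) hjm)).mul_right h1) _

theorem jm_commute_lt (h : HeckeRel q T m) (k : ℕ) :
    k ≤ m → ∀ j, j + 1 < k → Commute (T j) (jm q T k) := by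
  induction k with
  | zero => intro _ j _; omega
  | succ k ih =>
    intro hk j hj
    by_cases hjk : j + 1 < k
    · have h1 : Commute (T j) (T k) := h.commT (by omega) (by omega) (Or.inl (by omega))
      exact Commute.smul_right ((h1.mul_right (ih (by omega) j hjk)).mul_right h1) _
    · obtain rfl : k = j + 1 := by omega
      have hf := (jm_commute_gt h j (j+1) (by omega) (by omega)).eq
      have hb := h.braid j (by omega)
      simp only [jm, mul_smul_comm, smul_mul_assoc]
      refine Commute.smul_right (Commute.smul_right ?_ _) _
      rw [Commute, SemiconjBy]
      generalize T j = a at *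
      generalize T (j+1) = b at *
      generalize jm q T j = f at *
      calc a * (b * (a * f * a) * b) = (a * b * a) * f * a * b := by noncomm_ring
        _ = (b * a) * (b * f) * a * b := by rw [hb]; noncomm_ring
        _ = (b * a) * f * (b * a * b) := by rw [hf]; noncomm_ring
        _ = _ := by rw [← hb]; noncomm_ring

/-- anything commuting with the `T j`, `j < k`, commutes with `jm k`. -/
theorem commute_jm (c : A) (k : ℕ) (hc : ∀ j, j < k → Commute c (T j)) :
    Commute c (jm q T k) := by
  induction k with
  | zero => exact Commute.one_right _
  | succ k ih =>
    exact Commute.smul_right (((hc k (by omega)).mul_right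
      (ih fun j hj => hc j (by omega))).mul_right (hc k (by omega))) _

theorem jm_eq (hq : q ≠ 0) (h : HeckeRel q T m) (k : ℕ) :
    k < m → (q - 1) • rtr q T k (T k) = q • (jm q T (k + 1) - 1) := by
  induction k with
  | zero =>
    intro hk
    simp only [rtr, jm, mul_one, h.quad 0 hk]
    simp only [smul_add, smul_sub, smul_smul, one_smul, inv_mul_cancel₀ hq]
    rw [mul_inv_cancel_left₀ hq]; abel
  | succ k ih =>
    intro hk
    have h1 := ih (by omega)
    have hb := h.braid k hk
    have h2 : rtr q T k (T (k+1) * T k * T (k+1)) = T (k+1) * rtr q T k (T k) * T (k+1) := by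
      have hc : ∀ j, j < k → Commute (T (k+1)) (T j) := fun j hj =>
        h.commT (by omega) (by omega) (Or.inr (by omega))
      rw [rtr_mul_right k _ hc, rtr_mul_left k _ hc]
    have h3 : T (k+1) * ((q - 1) • rtr q T k (T k)) * T (k+1)
        = T (k+1) * (q • (jm q T (k + 1) - 1)) * T (k+1) := by rw [h1]
    rw [rtr, hb, h2, jm]
    simp only [mul_smul_comm, smul_mul_assoc, mul_sub, sub_mul, mul_one, h.quad (k+1) hk] at h3
    rw [smul_add, smul_comm (q - 1) q⁻¹, h3]
    match_scalars <;> field_simp <;> ring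

theorem rtr_rec (hq : q ≠ 0) (h : HeckeRel q T m) (k : ℕ) (hk : k < m) (u s : K)
    (hs : s * ((q - 1) ^ 2 * u) = - (u - 1) * q)
    (D E : A) (hD : D * (u • 1 - jm q T k) = 1) (hD' : (u • 1 - jm q T k) * D = 1)
    (hE : E * (u • 1 - jm q T (k+1)) = 1) (hE' : (u • 1 - jm q T (k+1)) * E = 1) :
    rtr q T (k+1) E + s • 1 = (u • E - q • (u • E - 1)) * (u • E - q⁻¹ • (u • E - 1)) *
      (rtr q T k D + s • 1) := by
  have hjm := jm_eq hq h k hk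
  set L := jm q T k with hL
  set L' := jm q T (k+1) with hL'
  have hT := h.quad k hk
  have hLT : L * T k = T k * L' - (q - 1) • L' := by
    have e : T k * L' = q⁻¹ • ((T k * T k) * L * T k) := by
      rw [hL', jm, mul_smul_comm]; simp only [mul_assoc, hL]
    have e2 : L' = q⁻¹ • (T k * L * T k) := rfl
    rw [e, hT]
    rw [e2]
    simp only [add_mul, smul_mul_assoc, one_mul, smul_add, smul_smul, inv_mul_cancel₀ hq, one_smul]
    rw [mul_comm q⁻¹]; abel
  have cL' : ∀ j, j < k → Commute L' (T j) := fun j hj =>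
    (jm_commute_lt h (k+1) (by omega) j (by omega)).symm
  have cEgen : ∀ x, Commute L' x → Commute E x := by
    intro x hx
    have h1 : Commute (u • 1 - L') x := by
      refine Commute.sub_left (Commute.smul_left (Commute.one_left _) _) hx
    rw [Commute, SemiconjBy]
    calc E * x = E * (x * ((u • 1 - L') * E)) := by rw [hE', mul_one]
      _ = E * (x * (u • 1 - L')) * E := by noncomm_ring
      _ = (E * (u • 1 - L')) * x * E := by rw [← h1.eq]; noncomm_ring
      _ = x * E := by rw [hE, one_mul]
  have cE : ∀ j, j < k → Commute E (T j) := fun j hj => cEgen _ (cL' j hj)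
  have cEL' : Commute E L' := cEgen _ (Commute.refl _)
  have cL'L : Commute L' L := commute_jm _ _ cL'
  have cEL : Commute E L := commute_jm _ _ cE
  have cED : Commute E D := by
    have h1 : Commute E (u • 1 - L) := (Commute.smul_right (Commute.one_right _) _).sub_right cEL
    rw [Commute, SemiconjBy]
    calc E * D = D * (u • 1 - L) * E * D := by rw [hD, one_mul]
      _ = D * (E * (u • 1 - L)) * D := by rw [h1.eq]; noncomm_ring
      _ = D * E * ((u • 1 - L) * D) := by noncomm_ring
      _ = D * E := by rw [hD', mul_one]
  have cEG : Commute E (rtr q T k D) := commute_rtr _ _ cE _ cED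
  set G := rtr q T k D with hG
  have hL'E : L' * E = u • E - 1 := by
    have : u • E - L' * E = 1 := by simpa [sub_mul] using hE'
    rw [← this]; abel
  set F := u • E - 1 with hF
  have cFj : ∀ j, j < k → Commute F (T j) := fun j hj =>
    (Commute.smul_left (cE j hj) _).sub_left (Commute.one_left _)
  -- T E = D T + (q-1) D F
  have hTE : T k * E = D * T k + (q - 1) • (D * F) := by
    have e1 : (u • 1 - L) * T k = T k * (u • 1 - L') + (q - 1) • L' := by
      simp only [sub_mul, mul_sub, hLT, smul_mul_assoc, mul_smul_comm, one_mul, mul_one]; abel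
    have e2 : D * ((u • 1 - L) * T k) * E = D * (T k * (u • 1 - L') + (q - 1) • L') * E := by
      rw [e1]
    calc T k * E = (D * (u • 1 - L)) * T k * E := by rw [hD, one_mul]
      _ = D * ((u • 1 - L) * T k) * E := by noncomm_ring
      _ = D * (T k * (u • 1 - L') + (q - 1) • L') * E := by rw [e1]
      _ = D * T k * ((u • 1 - L') * E) + (q - 1) • (D * (L' * E)) := by
        simp only [mul_add, add_mul, mul_assoc, smul_mul_assoc, mul_smul_comm]
      _ = _ := by rw [hE', hL'E, mul_one]
  have hFD : D * F = F * D := by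
    simp only [hF, mul_sub, sub_mul, mul_smul_comm, smul_mul_assoc, cED.eq, mul_one, one_mul]
  have hTET : T k * E * T k = q • D + (q - 1) • (D * T k) + (q - 1) • (F * (D * T k)) := by
    rw [hTE, add_mul, mul_assoc, hT, hFD]
    simp only [mul_add, mul_smul_comm, smul_mul_assoc, mul_one, mul_assoc]
  have hDT : D * T k = T k * E - (q - 1) • (D * F) := by rw [hTE]; abel
  have hX : (q - 1) • rtr q T k (D * T k) = q • ((u - 1) • E - 1) - (q - 1) ^ 2 • (G * F) := by
    have e1 : rtr q T k (D * T k) = rtr q T k (T k) * E - (q - 1) • (G * F) := by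
      rw [hDT, sub_eq_add_neg, ← neg_smul, rtr_add, rtr_smul, rtr_mul_right k E cE,
        rtr_mul_right k F cFj, neg_smul, ← sub_eq_add_neg]
    rw [e1, smul_sub, ← smul_mul_assoc, hjm, smul_mul_assoc, sub_mul, hL'E, smul_smul, one_mul,
      ← pow_two, hF]
    congr 2
    rw [sub_smul, one_smul]; abel
  have hG' : rtr q T (k+1) E = E + q⁻¹ • (q • G + (1 + F) *
      (q • ((u - 1) • E - 1) - (q - 1) ^ 2 • (G * F))) := by
    rw [← hX, rtr, hTET, rtr_add, rtr_add, rtr_smul, rtr_smul, rtr_smul, rtr_mul_left k F cFj,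
      add_mul, one_mul, mul_smul_comm, add_assoc]
  have e1F : 1 + F = u • E := by rw [hF]; abel
  rw [hG', e1F, hF]
  have cGE : G * E = E * G := cEG.eq.symm
  have cGE' : ∀ x, G * (E * x) = E * (G * x) := fun x => by
    rw [← mul_assoc, cGE, mul_assoc]
  simp only [mul_add, add_mul, mul_sub, sub_mul, smul_mul_assoc, mul_smul_comm, one_mul, mul_one,
    mul_assoc, cGE]
  have hs' : (u - 1) * q = - (s * ((q - 1) ^ 2 * u)) := by rw [hs]; ring
  match_scalars <;> field_simp <;> first | ring1 | linear_combination (-1) * hs | linear_combination u * hs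

end Alg
end HeckeDC

namespace HeckeDC
section Pol
open Polynomial
theorem exists_good {K : Type*} [Field K] [Infinite K] (q : K) (hq : q ≠ 0)
    (hq1 : ∀ k : ℕ, 1 ≤ k → q ^ k ≠ 1) (P : K[X]) (h0 : P.eval 0 ≠ 0) (hd : 1 ≤ P.natDegree) :
    ∃ u : K, u ≠ 0 ∧ P.eval u ≠ 0 ∧ P.eval (q * u) * P.eval (q⁻¹ * u) ≠ P.eval u ^ 2 := by
  set Q : K[X] := P.comp (C q * X) * P.comp (C q⁻¹ * X) - P ^ 2 with hQ
  have hPne : P ≠ 0 := by rintro rfl; simp at h0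
  have hQne : Q ≠ 0 := by
    set c := P.eval 0 with hc
    have hne : P - C c ≠ 0 := by
      intro h
      rw [sub_eq_zero] at h
      rw [h, natDegree_C] at hd
      omega
    obtain ⟨S, hS, hS'⟩ := exists_eq_pow_rootMultiplicity_mul_and_not_dvd (P - C c) hne 0
    set m := rootMultiplicity 0 (P - C c) with hm
    have hm1 : 1 ≤ m := by
      rw [hm, Nat.one_le_iff_ne_zero, ← Nat.pos_iff_ne_zero, rootMultiplicity_pos hne]
      simp [hc]
    rw [dvd_iff_isRoot, IsRoot] at hS'
    have hP : P = C c + X ^ m * S := by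
      rw [C_0, sub_zero] at hS
      rw [← hS]; ring
    intro hQ0
    have e : Q = X ^ m * (C c * (C q ^ m * S.comp (C q * X) + C q⁻¹ ^ m * S.comp (C q⁻¹ * X)
        - 2 * S) + X ^ m * (C q ^ m * S.comp (C q * X) * (C q⁻¹ ^ m * S.comp (C q⁻¹ * X))
        - S ^ 2)) := by
      rw [hQ, hP]
      simp only [add_comp, mul_comp, C_comp, X_pow_comp, mul_pow]
      ring
    rw [hQ0] at e
    have e2 := (mul_eq_zero.mp e.symm).resolve_left (pow_ne_zero _ X_ne_zero)
    have e3 := congrArg (eval 0) e2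
    have hz : (0 : K) ^ m = 0 := zero_pow (by omega)
    simp [hz] at e3
    have e4 : c * (q ^ m - 1) ^ 2 * S.eval 0 = 0 := by
      rcases e3 with e3 | e3
      · rw [e3]; ring
      · have hqm : (q ^ m) ≠ 0 := pow_ne_zero _ hq
        have hinv := mul_inv_cancel₀ hqm
        linear_combination c * q ^ m * e3 - c * S.eval 0 * hinv
    rcases mul_eq_zero.mp e4 with e5 | e5
    · rcases mul_eq_zero.mp e5 with e6 | e6
      · exact h0 e6
      · exact hq1 m hm1 (sub_eq_zero.mp (pow_eq_zero_iff (two_ne_zero) |>.mp e6))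
    · exact hS' e5
  have hne : Q * P * X ≠ 0 := mul_ne_zero (mul_ne_zero hQne hPne) X_ne_zero
  have : ∃ u, (Q * P * X).eval u ≠ 0 := by
    by_contra! h
    exact hne (Polynomial.funext fun r => by simpa using h r)
  obtain ⟨u, hu⟩ := this
  simp only [eval_mul, eval_X, mul_ne_zero_iff] at hu
  refine ⟨u, hu.2, hu.1.2, fun h => hu.1.1 ?_⟩
  simp [hQ, h]
end Pol

section Ex
open Module
variable {K : Type*} [Field K] {N : Type*} [AddCommGroup N] [Module K N] [FiniteDimensional K N]
variable {q : K} {T : ℕ → End K N} {m : ℕ}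

theorem det_T_ne (hq : q ≠ 0) (h : HeckeRel q T m) (k : ℕ) (hk : k < m) :
    LinearMap.det (T k) ≠ 0 := by
  have h1 : T k * (T k - (q - 1) • 1) = q • 1 := by
    rw [mul_sub, h.quad k hk, mul_smul_comm, mul_one]; abel
  have h2 := congrArg LinearMap.det h1
  rw [map_mul, LinearMap.det_smul, map_one, mul_one] at h2
  intro h0
  rw [h0, zero_mul] at h2
  exact pow_ne_zero _ hq h2.symm

theorem det_jm_ne (hq : q ≠ 0) (h : HeckeRel q T m) (k : ℕ) (hk : k ≤ m) :
    LinearMap.det (jm q T k) ≠ 0 := by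
  induction k with
  | zero => simp [jm]
  | succ k ih =>
    have h1 := det_T_ne hq h k (by omega)
    rw [jm, LinearMap.det_smul, map_mul, map_mul]
    exact mul_ne_zero (pow_ne_zero _ (inv_ne_zero hq))
      (mul_ne_zero (mul_ne_zero h1 (ih (by omega))) h1)

theorem exists_inv (f : End K N) (hf : LinearMap.det f ≠ 0) : ∃ g : End K N, g * f = 1 ∧ f * g = 1 := by
  have h := (LinearMap.isUnit_iff_isUnit_det f).mpr hf.isUnit
  obtain ⟨g, rfl⟩ := h
  exact ⟨↑g⁻¹, by simp, by simp⟩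

theorem rtr_one (h : HeckeRel (1 : K) T m) (k : ℕ) (hk : k ≤ m) :
    rtr (1 : K) T k 1 = ((k : K) + 1) • 1 := by
  induction k with
  | zero => simp [rtr]
  | succ k ih =>
    have h1 := h.quad k (by omega)
    rw [rtr, mul_one, h1]
    simp only [sub_self, zero_smul, add_zero, one_smul, inv_one, ih (by omega)]
    push_cast
    module

theorem commute_inv {E L x : End K N} (u : K) (hE : E * (u • 1 - L) = 1)
    (hE' : (u • 1 - L) * E = 1) (hx : Commute L x) : Commute E x := by
  have h1 : Commute (u • 1 - L) x := by
    refine Commute.sub_left (Commute.smul_left (Commute.one_left _) _) hx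
  rw [Commute, SemiconjBy]
  calc E * x = E * (x * ((u • 1 - L) * E)) := by rw [hE', mul_one]
    _ = E * (x * (u • 1 - L)) * E := by noncomm_ring
    _ = (E * (u • 1 - L)) * x * E := by rw [← h1.eq]; noncomm_ring
    _ = x * E := by rw [hE, one_mul]

theorem det_rho (hq : q ≠ 0) (u : K) (E L : End K N) (hE : E * (u • 1 - L) = 1) :
    LinearMap.det ((u • E - q • (u • E - 1)) * (u • E - q⁻¹ • (u • E - 1))) *
      L.charpoly.eval u ^ 2 = L.charpoly.eval (q * u) * L.charpoly.eval (q⁻¹ * u) := by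
  have ev : ∀ t : K, L.charpoly.eval t = LinearMap.det (t • 1 - L) := by
    intro t
    rw [LinearMap.eval_charpoly, Algebra.algebraMap_eq_smul_one]
  have key : ∀ c : K, c ≠ 0 → LinearMap.det (u • E - c • (u • E - 1)) * LinearMap.det (u • 1 - L)
      = c ^ finrank K N * LinearMap.det ((c⁻¹ * u) • 1 - L) := by
    intro c hc
    rw [← map_mul, ← LinearMap.det_smul]
    congr 1
    rw [sub_mul, smul_mul_assoc, hE, smul_mul_assoc, sub_mul, smul_mul_assoc, hE, one_mul,
      smul_sub c ((c⁻¹ * u) • 1), smul_smul, mul_inv_cancel_left₀ hc]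
    congr 2
    abel
  have k1 := key q hq
  have k2 := key q⁻¹ (inv_ne_zero hq)
  rw [inv_inv] at k2
  have : q ^ finrank K N * q⁻¹ ^ finrank K N = 1 := by
    rw [← mul_pow, mul_inv_cancel₀ hq, one_pow]
  rw [ev, ev, ev, map_mul, pow_two]
  calc _ = (LinearMap.det (u • E - q • (u • E - 1)) * LinearMap.det (u • 1 - L)) *
      (LinearMap.det (u • E - q⁻¹ • (u • E - 1)) * LinearMap.det (u • 1 - L)) := by ring
    _ = (q ^ finrank K N * q⁻¹ ^ finrank K N) * (LinearMap.det ((q⁻¹ * u) • 1 - L)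
      * LinearMap.det ((q * u) • 1 - L)) := by rw [k1, k2]; ring
    _ = _ := by rw [this]; ring

theorem exists_rtr_ne_zero [CharZero K] [Nontrivial N] (hq : q ≠ 0)
    (hqint : ∀ k : ℕ, 1 ≤ k → (∑ i ∈ Finset.range k, q ^ i) ≠ 0) (h : HeckeRel q T m) :
    ∃ D : End K N, (∀ j, j + 1 < m → Commute (T j) D) ∧ rtr q T m D ≠ 0 := by
  by_cases hq1 : q = 1
  · subst hq1
    refine ⟨1, fun _ _ => Commute.one_right _, ?_⟩
    rw [rtr_one h m le_rfl]
    exact smul_ne_zero (by exact_mod_cast Nat.succ_ne_zero m) one_ne_zero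
  have hroot : ∀ k : ℕ, 1 ≤ k → q ^ k ≠ 1 := by
    intro k hk hk1
    have := geom_sum_mul q k
    rw [hk1, sub_self] at this
    exact (mul_ne_zero (hqint k hk) (sub_ne_zero.mpr hq1)) this
  have ev : ∀ (t : K) (L : End K N), L.charpoly.eval t = LinearMap.det (t • 1 - L) := by
    intro t L
    rw [LinearMap.eval_charpoly, Algebra.algebraMap_eq_smul_one]
  set P : Polynomial K := ∏ k ∈ Finset.range (m + 1), (jm q T k).charpoly with hP
  have hPev : ∀ t, P.eval t = ∏ k ∈ Finset.range (m + 1), (jm q T k).charpoly.eval t := by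
    intro t; rw [hP, Polynomial.eval_prod]
  have hpos : 0 < finrank K N := finrank_pos
  have h0 : P.eval 0 ≠ 0 := by
    rw [hPev, Finset.prod_ne_zero_iff]
    intro k hk
    have := det_jm_ne hq h k (by simpa [Nat.lt_succ_iff] using hk)
    rw [ev, zero_smul, zero_sub, ← neg_one_smul K, LinearMap.det_smul]
    exact mul_ne_zero (pow_ne_zero _ (by norm_num)) this
  have hd : 1 ≤ P.natDegree := by
    rw [hP, Polynomial.natDegree_prod_of_monic _ _ (fun k _ => LinearMap.charpoly_monic _)]
    simp only [LinearMap.charpoly_natDegree, Finset.sum_const, Finset.card_range, smul_eq_mul]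
    nlinarith
  obtain ⟨u, hu0, hPu, hgood⟩ := exists_good q hq hroot P h0 hd
  have hPu' := hPu
  rw [hPev, Finset.prod_ne_zero_iff] at hPu'
  have hex : ∀ k, ∃ D : End K N, k ≤ m → D * (u • 1 - jm q T k) = 1 ∧
      (u • 1 - jm q T k) * D = 1 := by
    intro k
    by_cases hk : k ≤ m
    · have := hPu' k (by simpa [Nat.lt_succ_iff] using hk)
      rw [ev] at this
      obtain ⟨g, hg⟩ := exists_inv _ this
      exact ⟨g, fun _ => hg⟩
    · exact ⟨0, fun h => absurd h hk⟩
  choose D hD using hex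
  have hu1 : u ≠ 1 := by
    rintro rfl
    have := hPu' 0 (by simp)
    rw [ev] at this
    simp [jm] at this
  refine ⟨D m, fun j hj => ?_, fun hzero => ?_⟩
  · exact (commute_inv u (hD m le_rfl).1 (hD m le_rfl).2 (jm_commute_lt h m le_rfl j hj).symm).symm
  set s : K := - (u - 1) * q / ((q - 1) ^ 2 * u) with hs
  have hq1' : q - 1 ≠ 0 := sub_ne_zero.mpr hq1
  have hden : (q - 1) ^ 2 * u ≠ 0 := mul_ne_zero (pow_ne_zero _ hq1') hu0
  have hs' : s * ((q - 1) ^ 2 * u) = - (u - 1) * q := by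
    rw [hs, div_mul_cancel₀ _ hden]
  have hsne : s ≠ 0 := by
    rw [hs]
    exact div_ne_zero (mul_ne_zero (neg_ne_zero.mpr (sub_ne_zero.mpr hu1)) hq) hden
  have main : ∀ k, k ≤ m → LinearMap.det (rtr q T k (D k) + s • 1) *
      (∏ j ∈ Finset.range (k + 1), (jm q T j).charpoly.eval u) ^ 2 =
      s ^ finrank K N * ((∏ j ∈ Finset.range (k + 1), (jm q T j).charpoly.eval (q * u)) *
        ∏ j ∈ Finset.range (k + 1), (jm q T j).charpoly.eval (q⁻¹ * u)) := by
    intro k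
    induction k with
    | zero =>
      intro _
      have hr := det_rho hq u (D 0) (jm q T 0) (hD 0 (by omega)).1
      have e : rtr q T 0 (D 0) + s • 1 = ((u • D 0 - q • (u • D 0 - 1)) *
          (u • D 0 - q⁻¹ • (u • D 0 - 1))) * (s • 1) := by
        have h1 := (hD 0 (by omega)).1
        simp only [jm] at h1
        have h2 : (u - 1) • D 0 = 1 := by
          rw [mul_sub, mul_smul_comm, mul_one] at h1
          rw [sub_smul, one_smul, h1]
        have h3 : D 0 = (u - 1)⁻¹ • 1 := by
          rw [← h2, smul_smul, inv_mul_cancel₀ (sub_ne_zero.mpr hu1), one_smul]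
        have hu1' : u - 1 ≠ 0 := sub_ne_zero.mpr hu1
        rw [rtr, h3]
        simp only [mul_sub, sub_mul, smul_mul_assoc, mul_smul_comm, one_mul, mul_one]
        match_scalars
        field_simp
        linear_combination hs'
      rw [e, map_mul, LinearMap.det_smul, map_one, mul_one]
      simp only [zero_add, Finset.prod_range_one]
      rw [← hr]; ring
    | succ k ih =>
      intro hk
      have h1 := ih (by omega)
      have hr := det_rho hq u (D (k+1)) (jm q T (k+1)) (hD (k+1) hk).1
      rw [rtr_rec hq h k (by omega) u s hs' (D k) (D (k+1)) (hD k (by omega)).1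
        (hD k (by omega)).2 (hD (k+1) hk).1 (hD (k+1) hk).2, map_mul]
      rw [Finset.prod_range_succ _ (k+1), Finset.prod_range_succ _ (k+1),
        Finset.prod_range_succ _ (k+1)]
      generalize LinearMap.det ((u • D (k+1) - q • (u • D (k+1) - 1)) *
        (u • D (k+1) - q⁻¹ • (u • D (k+1) - 1))) = r at *
      linear_combination r * (jm q T (k+1)).charpoly.eval u ^ 2 * h1 + s ^ finrank K N *
        ((∏ j ∈ Finset.range (k + 1), (jm q T j).charpoly.eval (q * u)) *
        ∏ j ∈ Finset.range (k + 1), (jm q T j).charpoly.eval (q⁻¹ * u)) * hr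
  have hm := main m le_rfl
  rw [hzero, zero_add, LinearMap.det_smul, map_one, mul_one, ← hPev, ← hPev, ← hPev] at hm
  exact hgood (mul_left_cancel₀ (pow_ne_zero _ hsne) hm).symm
end Ex
end HeckeDC

namespace HeckeDC
section Compl
open Module
variable {K : Type*} [Field K] {M : Type*} [AddCommGroup M] [Module K M] [FiniteDimensional K M]
variable {q : K} {T : ℕ → End K M}

/-- Stability under the first `m` operators. -/
def Stable (T : ℕ → End K M) (m : ℕ) (N : Submodule K M) : Prop :=
  ∀ j, j < m → ∀ x ∈ N, T j x ∈ N

theorem rtr_mem {N : Submodule K M} (k : ℕ) (hN : Stable T k N) : ∀ y : End K M,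
    (∀ x, y x ∈ N) → ∀ x, rtr q T k y x ∈ N := by
  induction k with
  | zero => intro y hy x; exact hy x
  | succ k ih =>
    intro y hy x
    refine N.add_mem (hy x) (N.smul_mem _ (ih (fun j hj => hN j (by omega)) _ (fun z => ?_) x))
    exact hN k (by omega) _ (hy _)

theorem rtr_restrict {N : Submodule K M} (k : ℕ) (T' : ℕ → End K N)
    (hT : ∀ j, j < k → ∀ x : N, ((T' j x : N) : M) = T j x) : ∀ (y : End K M) (y' : End K N),
    (∀ x : N, ((y' x : N) : M) = y x) → ∀ x : N, ((rtr q T' k y' x : N) : M) = rtr q T k y x := by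
  induction k with
  | zero => intro y y' hy x; exact hy x
  | succ k ih =>
    intro y y' hy x
    simp only [rtr, LinearMap.add_apply, LinearMap.smul_apply, Submodule.coe_add,
      Submodule.coe_smul, hy]
    rw [ih (fun j hj => hT j (by omega)) (T k * y * T k) (T' k * y' * T' k)]
    intro z
    simp only [Module.End.mul_apply, hT k (by omega), hy]

theorem compl_simple [CharZero K] (hq : q ≠ 0)
    (hqint : ∀ k : ℕ, 1 ≤ k → (∑ i ∈ Finset.range k, q ^ i) ≠ 0) (m : ℕ)
    (h : HeckeRel q T (m + 1))
    (ih : ∀ N : Submodule K M, Stable T m N → ∃ C, Stable T m C ∧ IsCompl N C)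
    (N : Submodule K M) (hN : Stable T (m + 1) N) (hne : N ≠ ⊥)
    (hmin : ∀ N', Stable T (m + 1) N' → N' ≤ N → N' ≠ ⊥ → N' = N) :
    ∃ C, Stable T (m + 1) C ∧ IsCompl N C := by
  have hN' : Stable T m N := fun j hj => hN j (by omega)
  obtain ⟨C, hC, hNC⟩ := ih N hN'
  let T' : ℕ → End K N := fun j => if hj : j < m + 1 then (T j).restrict (hN j hj) else 0
  have hT' : ∀ j, j < m + 1 → ∀ x : N, ((T' j x : N) : M) = T j x := by
    intro j hj x
    simp only [T', dif_pos hj]; rfl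
  have hrel : HeckeRel q T' (m + 1) := by
    refine ⟨fun i hi => ?_, fun i j hi hj => ?_, fun i hi => ?_⟩
    · ext x
      have := congrArg (fun f : End K M => f (x : M)) (h.quad i hi)
      simpa [hT' i hi] using this
    · ext x
      have := congrArg (fun f : End K M => f (x : M)) (h.comm i j hi hj)
      simpa [hT' i (by omega), hT' j hj] using this
    · ext x
      have := congrArg (fun f : End K M => f (x : M)) (h.braid i hi)
      simpa [hT' i (by omega), hT' (i+1) hi] using this
  have : Nontrivial N := Submodule.nontrivial_iff_ne_bot.mpr hne
  obtain ⟨D, hD, hDne⟩ := exists_rtr_ne_zero hq hqint hrel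
  let p := N.projectionOnto C hNC
  have hp : ∀ j, j < m → ∀ x, p (T j x) = T' j (p x) := by
    intro j hj x
    obtain ⟨a, ha, c, hc, rfl⟩ : ∃ a ∈ N, ∃ c ∈ C, a + c = x :=
      Submodule.mem_sup.mp (hNC.sup_eq_top ▸ Submodule.mem_top)
    have e1 : p a = ⟨a, ha⟩ := Submodule.projectionOnto_apply_left hNC ⟨a, ha⟩
    have e2 : p c = 0 := Submodule.projectionOnto_apply_right hNC ⟨c, hc⟩
    have e3 : p (T j a) = ⟨T j a, hN' j hj a ha⟩ :=
      Submodule.projectionOnto_apply_left hNC ⟨T j a, hN' j hj a ha⟩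
    have e4 : p (T j c) = 0 := Submodule.projectionOnto_apply_right hNC ⟨T j c, hC j hj c hc⟩
    rw [map_add, map_add, map_add, e1, e2, e3, e4, add_zero, add_zero]
    ext
    rw [hT' j (by omega)]
  let y : End K M := N.subtype ∘ₗ D ∘ₗ p
  have hy : ∀ j, j + 1 < m + 1 → Commute (T j) y := by
    intro j hj
    rw [Commute, SemiconjBy]
    ext x
    have := congrArg (fun f : End K N => f (p x)) (hD j hj).eq
    simp only [Module.End.mul_apply] at this
    simp only [Module.End.mul_apply, y, LinearMap.comp_apply, Submodule.subtype_apply,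
      hp j (by omega), ← this, hT' j (by omega)]
  set Z := rtr q T (m + 1) y with hZ
  have hZc : ∀ j, j < m + 1 → Commute (T j) Z := rtr_comm hq (m + 1) h y hy
  have hZN : ∀ x, Z x ∈ N := rtr_mem (m + 1) hN y (fun x => (D (p x)).2)
  have hZD : ∀ x : N, ((rtr q T' (m + 1) D x : N) : M) = Z x := by
    refine rtr_restrict (m + 1) T' hT' y D (fun x => ?_)
    have : p x = x := Submodule.projectionOnto_apply_left hNC x
    simp [y, this]
  have hker : Stable T (m + 1) (LinearMap.ker Z) := by
    intro j hj x hx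
    have := congrArg (fun f : End K M => f x) (hZc j hj).eq
    simp only [Module.End.mul_apply] at this
    rw [LinearMap.mem_ker] at hx ⊢
    rw [← this, hx, map_zero]
  have hbot : N ⊓ LinearMap.ker Z = ⊥ := by
    by_contra hb
    have := hmin (N ⊓ LinearMap.ker Z) (fun j hj x hx => ⟨hN j hj x hx.1, hker j hj x hx.2⟩)
      inf_le_left hb
    refine hDne (LinearMap.ext fun x => Subtype.ext ?_)
    rw [hZD]
    have hx : (x : M) ∈ N ⊓ LinearMap.ker Z := by rw [this]; exact x.2
    simpa using hx.2
  refine ⟨LinearMap.ker Z, hker, disjoint_iff.mpr hbot, codisjoint_iff.mpr ?_⟩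
  have hinj : Function.Injective (rtr q T' (m + 1) D : End K N) := by
    rw [← LinearMap.ker_eq_bot, eq_bot_iff]
    intro x hx
    have : (x : M) ∈ N ⊓ LinearMap.ker Z := by
      refine ⟨x.2, ?_⟩
      rw [LinearMap.mem_ker] at hx
      rw [SetLike.mem_coe, LinearMap.mem_ker, ← hZD, hx]; rfl
    rw [hbot, Submodule.mem_bot] at this
    simpa using this
  have hsurj := LinearMap.injective_iff_surjective.mp hinj
  rw [eq_top_iff]
  intro x _
  obtain ⟨n, hn⟩ := hsurj ⟨Z x, hZN x⟩
  have hn' : Z (n : M) = Z x := by rw [← hZD, hn]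
  refine Submodule.mem_sup.mpr ⟨n, n.2, x - n, ?_, by abel⟩
  rw [LinearMap.mem_ker, map_sub, hn', sub_self]

theorem compl_of_simple (m : ℕ)
    (hs : ∀ N : Submodule K M, Stable T m N → N ≠ ⊥ →
      (∀ N', Stable T m N' → N' ≤ N → N' ≠ ⊥ → N' = N) → ∃ C, Stable T m C ∧ IsCompl N C)
    (N : Submodule K M) : Stable T m N → ∃ C, Stable T m C ∧ IsCompl N C := by
  induction N using WellFoundedLT.induction with
  | ind N ih =>
  intro hN
  by_cases hne : N = ⊥
  · subst hne
    exact ⟨⊤, fun _ _ _ _ => Submodule.mem_top, isCompl_bot_top⟩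
  obtain ⟨N₁, ⟨h1s, h1ne, h1le⟩, h1min⟩ := (wellFounded_lt (α := Submodule K M)).has_min
    {N' | Stable T m N' ∧ N' ≠ ⊥ ∧ N' ≤ N} ⟨N, hN, hne, le_rfl⟩
  obtain ⟨C, hC, hc⟩ := hs N₁ h1s h1ne (fun N' hs' hle hne' => by
    by_contra hn
    exact h1min N' ⟨hs', hne', hle.trans h1le⟩ (lt_of_le_of_ne hle hn))
  have hlt : N ⊓ C < N := by
    refine lt_of_le_of_ne inf_le_left (fun he => h1ne ?_)
    have : N₁ ≤ C := h1le.trans (inf_eq_left.mp he)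
    rw [eq_bot_iff, ← hc.inf_eq_bot]
    exact le_inf le_rfl this
  obtain ⟨C', hC', hc'⟩ := ih (N ⊓ C) hlt (fun j hj x hx => ⟨hN j hj x hx.1, hC j hj x hx.2⟩)
  refine ⟨C ⊓ C', fun j hj x hx => ⟨hC j hj x hx.1, hC' j hj x hx.2⟩, ?_, ?_⟩
  · rw [disjoint_iff, ← inf_assoc, hc'.inf_eq_bot]
  · rw [codisjoint_iff, eq_top_iff, ← hc.sup_eq_top]
    refine sup_le (h1le.trans le_sup_left) ?_
    intro x hx
    obtain ⟨a, ha, b, hb, rfl⟩ : ∃ a ∈ N ⊓ C, ∃ b ∈ C', a + b = x :=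
      Submodule.mem_sup.mp (hc'.sup_eq_top ▸ Submodule.mem_top)
    refine Submodule.mem_sup.mpr ⟨a, ha.1, b, ⟨?_, hb⟩, rfl⟩
    simpa using C.sub_mem hx ha.2

theorem exists_compl [CharZero K] (hq : q ≠ 0)
    (hqint : ∀ k : ℕ, 1 ≤ k → (∑ i ∈ Finset.range k, q ^ i) ≠ 0) (m : ℕ) :
    HeckeRel q T m → ∀ N : Submodule K M, Stable T m N → ∃ C, Stable T m C ∧ IsCompl N C := by
  induction m with
  | zero =>
    intro _ N _
    obtain ⟨C, hC⟩ := Submodule.exists_isCompl N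
    exact ⟨C, fun j hj => absurd hj (by omega), hC⟩
  | succ m ih =>
    intro h
    exact compl_of_simple (m + 1) (compl_simple hq hqint m h (ih (h.mono (by omega))))

theorem double_centralizer (A : Subalgebra K (End K M))
    (hss : ∀ N : Submodule K M, (∀ a ∈ A, ∀ x ∈ N, a x ∈ N) →
      ∃ C : Submodule K M, (∀ a ∈ A, ∀ x ∈ C, a x ∈ C) ∧ IsCompl N C) :
    Subalgebra.centralizer K (Subalgebra.centralizer K (A : Set (End K M)) : Set (End K M)) = A := by
  refine le_antisymm ?_ ?_
  · intro f hf
    rw [Subalgebra.mem_centralizer_iff] at hf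
    have : IsSemisimpleModule A M := by
      rw [isSemisimpleModule_iff]
      refine ⟨fun N => ?_⟩
      obtain ⟨C, hC, hc⟩ := hss (N.restrictScalars K) (fun a ha x hx => N.smul_mem ⟨a, ha⟩ hx)
      refine ⟨{ C.toAddSubmonoid with smul_mem' := fun a x hx => hC a.1 a.2 x hx }, ?_, ?_⟩
      · rw [Submodule.disjoint_def]
        intro x hx hx'
        exact Submodule.disjoint_def.mp hc.disjoint x hx hx'
      · rw [codisjoint_iff, eq_top_iff]
        intro x _
        obtain ⟨a, ha, b, hb, rfl⟩ : ∃ a ∈ N.restrictScalars K, ∃ b ∈ C, a + b = x :=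
          Submodule.mem_sup.mp (hc.sup_eq_top ▸ Submodule.mem_top)
        exact Submodule.mem_sup.mpr ⟨a, ha, b, hb, rfl⟩
    let F : End (End A M) M :=
      { toFun := f
        map_add' := map_add f
        map_smul' := fun g x => by
          have hg : (g.restrictScalars K : End K M) ∈
              (Subalgebra.centralizer K (A : Set (End K M)) : Set (End K M)) := by
            rw [SetLike.mem_coe, Subalgebra.mem_centralizer_iff]
            intro a ha
            ext z
            exact (g.map_smul (⟨a, ha⟩ : A) z).symm
          exact (congrArg (fun e : End K M => e x) (hf _ hg)).symm }
    classical
    let b := Module.finBasis K M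
    obtain ⟨r, hr⟩ := jacobson_density F (Finset.univ.image b)
    have : f = r.1 := b.ext fun i => hr (b i) (by simp)
    rw [this]
    exact r.2
  · intro a ha
    rw [Subalgebra.mem_centralizer_iff]
    intro g hg
    rw [SetLike.mem_coe, Subalgebra.mem_centralizer_iff] at hg
    exact (hg a ha).symm

theorem double_centralizer_hecke [CharZero K] (hq : q ≠ 0)
    (hqint : ∀ k : ℕ, 1 ≤ k → (∑ i ∈ Finset.range k, q ^ i) ≠ 0) (m : ℕ)
    (h : HeckeRel q T m) (A : Subalgebra K (End K M))
    (hA : A = Algebra.adjoin K (Set.range fun i : Fin m => T i)) :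
    Subalgebra.centralizer K (Subalgebra.centralizer K (A : Set (End K M)) : Set (End K M)) = A := by
  refine double_centralizer A fun N hN => ?_
  have hTA : ∀ j, j < m → T j ∈ A := fun j hj => by
    rw [hA]; exact Algebra.subset_adjoin ⟨⟨j, hj⟩, rfl⟩
  obtain ⟨C, hC, hc⟩ := exists_compl hq hqint m h N (fun j hj x hx => hN _ (hTA j hj) x hx)
  refine ⟨C, fun a ha => ?_, hc⟩
  rw [hA] at ha
  induction ha using Algebra.adjoin_induction with
  | mem x hx => obtain ⟨i, rfl⟩ := hx; exact hC i i.2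
  | algebraMap r => intro x hx; simpa [Module.algebraMap_end_apply] using C.smul_mem r hx
  | add a b _ _ ha hb => intro x hx; exact C.add_mem (ha x hx) (hb x hx)
  | mul a b _ _ ha hb => intro x hx; exact ha _ (hb x hx)
end Compl
end HeckeDC

namespace HeckeDC
section Tensor
open TensorProduct PiTensorProduct Function
variable {K : Type*} [Field K] {V : Type*} [AddCommGroup V] [Module K V]

/-- Insertion of an element of `V ⊗ V` in two distinct positions. -/
noncomputable def ins {ι : Type*} [DecidableEq ι] (v : ι → V) (p p' : ι) (h : p ≠ p') :
    V ⊗[K] V →ₗ[K] (⨂[K] (_ : ι), V) :=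
  TensorProduct.lift (LinearMap.mk₂ K (fun a b => tprod K (update (update v p a) p' b))
    (fun a a' b => by
      simp only [update_comm h, MultilinearMap.map_update_add])
    (fun c a b => by
      simp only [update_comm h, MultilinearMap.map_update_smul])
    (fun a b b' => by simp only [MultilinearMap.map_update_add])
    (fun c a b => by simp only [MultilinearMap.map_update_smul]))

theorem ins_tmul {ι : Type*} [DecidableEq ι] (v : ι → V) (p p' : ι) (h : p ≠ p') (a b : V) :
    ins v p p' h (a ⊗ₜ[K] b) = tprod K (update (update v p a) p' b) := rfl

/-- Insertion in three positions. -/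
noncomputable def ins3 {ι : Type*} [DecidableEq ι] (v : ι → V) (p p' p'' : ι) (h : p ≠ p')
    (h1 : p ≠ p'') (h2 : p' ≠ p'') :
    (V ⊗[K] V) ⊗[K] V →ₗ[K] (⨂[K] (_ : ι), V) :=
  TensorProduct.lift (LinearMap.flip
    { toFun := fun c => ins (update v p'' c) p p' h
      map_add' := fun c c' => by
        ext a b
        simp only [AlgebraTensorModule.curry_apply, LinearMap.restrictScalars_self, TensorProduct.curry_apply,
          LinearMap.add_apply, ins_tmul, update_comm h1.symm, update_comm h2.symm,
          MultilinearMap.map_update_add]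
      map_smul' := fun r c => by
        ext a b
        simp only [AlgebraTensorModule.curry_apply, LinearMap.restrictScalars_self, TensorProduct.curry_apply,
          LinearMap.smul_apply, ins_tmul, update_comm h1.symm, update_comm h2.symm,
          MultilinearMap.map_update_smul, RingHom.id_apply] })

theorem ins3_tmul {ι : Type*} [DecidableEq ι] (v : ι → V) (p p' p'' : ι) (h : p ≠ p')
    (h1 : p ≠ p'') (h2 : p' ≠ p'') (z : V ⊗[K] V) (c : V) :
    ins3 v p p' p'' h h1 h2 (z ⊗ₜ[K] c) = ins (update v p'' c) p p' h z := rfl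

theorem tpow2_tprod (w : Fin 2 → V) : tpow2Equiv K V (tprod K w) = w 0 ⊗ₜ[K] w 1 := by
  simp only [tpow2Equiv, LinearEquiv.trans_apply]
  erw [reindex_tprod]
  rw [tmulEquiv_symm_apply]
  simp only [TensorProduct.congr_tmul, subsingletonEquiv_apply_tprod]
  rfl

theorem split_tprod (n i : ℕ) (h : i + 2 ≤ n) (v : Fin n → V) :
    tpowSplit K V n i h (tprod K v) =
      ((tprod K fun j : Fin i => v ⟨j, by omega⟩) ⊗ₜ[K]
        (tprod K fun j : Fin 2 => v ⟨i + j, by omega⟩)) ⊗ₜ[K]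
        (tprod K fun j : Fin (n - (i + 2)) => v ⟨i + 2 + j, by omega⟩) := by
  simp only [tpowSplit, LinearEquiv.trans_apply]
  erw [reindex_tprod]
  rw [tmulEquiv_symm_apply]
  simp only [TensorProduct.congr_tmul, LinearEquiv.trans_apply]
  erw [reindex_tprod]
  rw [tmulEquiv_symm_apply]
  rfl

theorem split_symm (n i : ℕ) (h : i + 2 ≤ n) (v : Fin n → V) (z : V ⊗[K] V) :
    (tpowSplit K V n i h).symm (((tprod K fun j : Fin i => v ⟨j, by omega⟩) ⊗ₜ[K]
        ((tpow2Equiv K V).symm z)) ⊗ₜ[K]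
        (tprod K fun j : Fin (n - (i + 2)) => v ⟨i + 2 + j, by omega⟩)) =
      ins v ⟨i, by omega⟩ ⟨i + 1, by omega⟩ (by simp) z := by
  induction z using TensorProduct.induction_on with
  | zero => simp
  | add z w hz hw =>
    rw [map_add, map_add, TensorProduct.tmul_add, TensorProduct.add_tmul, map_add, hz, hw]
  | tmul a b =>
    have e : (tpow2Equiv K V).symm (a ⊗ₜ[K] b) = tprod K ![a, b] := by
      rw [LinearEquiv.symm_apply_eq, tpow2_tprod]; rfl
    rw [e, LinearEquiv.symm_apply_eq, ins_tmul, split_tprod]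
    have e1 : (fun j : Fin i => v ⟨j, by omega⟩) = fun j : Fin i =>
        update (update v ⟨i, by omega⟩ a) ⟨i + 1, by omega⟩ b ⟨j, by omega⟩ := by
      funext j
      rw [update_of_ne, update_of_ne]
      · simp only [ne_eq, Fin.mk.injEq]; omega
      · simp only [ne_eq, Fin.mk.injEq]; omega
    have e2 : ![a, b] = fun j : Fin 2 =>
        update (update v ⟨i, by omega⟩ a) ⟨i + 1, by omega⟩ b ⟨i + j, by omega⟩ := by
      funext j
      fin_cases j
      · simp [update_of_ne]
      · simp
    have e3 : (fun j : Fin (n - (i + 2)) => v ⟨i + 2 + j, by omega⟩) = fun j : Fin (n - (i + 2)) =>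
        update (update v ⟨i, by omega⟩ a) ⟨i + 1, by omega⟩ b ⟨i + 2 + j, by omega⟩ := by
      funext j
      rw [update_of_ne, update_of_ne]
      · simp only [ne_eq, Fin.mk.injEq]; omega
      · simp only [ne_eq, Fin.mk.injEq]; omega
    rw [e1, e2, e3]

theorem heckeOp_tprod (R : V ⊗[K] V →ₗ[K] V ⊗[K] V) (n i : ℕ) (h : i + 2 ≤ n) (v : Fin n → V) :
    heckeOp K V R n i h (tprod K v) = ins v ⟨i, by omega⟩ ⟨i + 1, by omega⟩ (by simp)
      (R (v ⟨i, by omega⟩ ⊗ₜ[K] v ⟨i + 1, by omega⟩)) := by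
  rw [← split_symm]
  simp only [heckeOp, LinearMap.comp_apply, LinearEquiv.coe_coe, split_tprod,
    LinearMap.rTensor_tmul, LinearMap.lTensor_tmul, tpow2_tprod]
  rfl

theorem heckeOp_quad (q : K) (R : V ⊗[K] V →ₗ[K] V ⊗[K] V) (hR : IsHecke K V q R) (n i : ℕ)
    (h : i + 2 ≤ n) : heckeOp K V R n i h * heckeOp K V R n i h =
      q • (1 : Module.End K _) + (q - 1) • heckeOp K V R n i h := by
  have hR2 : ∀ z, R (R z) = q • z + (q - 1) • R z := by
    intro z
    have := congrArg (fun f : V ⊗[K] V →ₗ[K] V ⊗[K] V => f z) hR.2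
    simp only [LinearMap.comp_apply, LinearMap.add_apply, LinearMap.sub_apply, LinearMap.id_apply,
      LinearMap.smul_apply, map_sub, map_smul, LinearMap.zero_apply] at this
    rw [sub_smul, one_smul, ← sub_eq_zero, ← this, smul_add]
    abel
  have key : ∀ (v : Fin n → V) z, heckeOp K V R n i h (ins v ⟨i, by omega⟩ ⟨i + 1, by omega⟩
      (by simp) z) = ins v ⟨i, by omega⟩ ⟨i + 1, by omega⟩ (by simp) (R z) := by
    intro v z
    induction z using TensorProduct.induction_on with
    | zero => simp
    | add z w hz hw => simp only [map_add, hz, hw]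
    | tmul a b =>
      rw [ins_tmul, heckeOp_tprod, update_self, update_of_ne (by simp), update_self]
      generalize R (a ⊗ₜ[K] b) = z
      induction z using TensorProduct.induction_on with
      | zero => simp
      | add z w hz hw => simp only [map_add, hz, hw]
      | tmul c d =>
        rw [ins_tmul, ins_tmul]
        congr 1
        funext x
        simp only [update_apply, Fin.ext_iff]
        split_ifs <;> first | rfl | (exfalso; omega)
  refine PiTensorProduct.ext (MultilinearMap.ext fun v => ?_)
  simp only [LinearMap.compMultilinearMap_apply, Module.End.mul_apply, LinearMap.add_apply,
    LinearMap.smul_apply, Module.End.one_apply, heckeOp_tprod, key, hR2, map_add, map_smul, ins_tmul]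
  simp

theorem heckeOp_comm (R : V ⊗[K] V →ₗ[K] V ⊗[K] V) (n i j : ℕ)
    (hi : i + 2 ≤ n) (hj : j + 2 ≤ n) (hij : i + 2 ≤ j) :
    heckeOp K V R n i hi * heckeOp K V R n j hj = heckeOp K V R n j hj * heckeOp K V R n i hi := by
  refine PiTensorProduct.ext (MultilinearMap.ext fun v => ?_)
  simp only [LinearMap.compMultilinearMap_apply, Module.End.mul_apply, heckeOp_tprod]
  obtain ⟨s, hs⟩ := TensorProduct.exists_finset
    (R (v ⟨j, by omega⟩ ⊗ₜ[K] v ⟨j + 1, by omega⟩))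
  obtain ⟨s', hs'⟩ := TensorProduct.exists_finset
    (R (v ⟨i, by omega⟩ ⊗ₜ[K] v ⟨i + 1, by omega⟩))
  have n1 : (⟨i, by omega⟩ : Fin n) ≠ ⟨j, by omega⟩ := by simp only [ne_eq, Fin.mk.injEq]; omega
  have n2 : (⟨i, by omega⟩ : Fin n) ≠ ⟨j + 1, by omega⟩ := by
    simp only [ne_eq, Fin.mk.injEq]; omega
  have n3 : (⟨i + 1, by omega⟩ : Fin n) ≠ ⟨j, by omega⟩ := by
    simp only [ne_eq, Fin.mk.injEq]; omega
  have n4 : (⟨i + 1, by omega⟩ : Fin n) ≠ ⟨j + 1, by omega⟩ := by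
    simp only [ne_eq, Fin.mk.injEq]; omega
  rw [hs, hs']
  simp only [map_sum, ins_tmul, heckeOp_tprod, update_of_ne n1, update_of_ne n2, update_of_ne n3,
    update_of_ne n4, update_of_ne n1.symm, update_of_ne n2.symm, update_of_ne n3.symm,
    update_of_ne n4.symm, hs, hs']
  rw [Finset.sum_comm]
  refine Finset.sum_congr rfl fun l _ => Finset.sum_congr rfl fun l' _ => ?_
  rw [update_comm n2.symm, update_comm n1.symm, update_comm n4.symm, update_comm n3.symm]

theorem heckeOp_braid (R : V ⊗[K] V →ₗ[K] V ⊗[K] V) (hR : YangBaxter K V R) (n i : ℕ)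
    (h : i + 3 ≤ n) :
    heckeOp K V R n i (by omega) * heckeOp K V R n (i + 1) (by omega) *
        heckeOp K V R n i (by omega) =
      heckeOp K V R n (i + 1) (by omega) * heckeOp K V R n i (by omega) *
        heckeOp K V R n (i + 1) (by omega) := by
  have n1 : (⟨i, by omega⟩ : Fin n) ≠ ⟨i + 1, by omega⟩ := by simp
  have n2 : (⟨i, by omega⟩ : Fin n) ≠ ⟨i + 2, by omega⟩ := by simp
  have n3 : (⟨i + 1, by omega⟩ : Fin n) ≠ ⟨i + 2, by omega⟩ := by simp
  have k1 : ∀ (v : Fin n → V) z, heckeOp K V R n i (by omega) (ins3 v _ _ _ n1 n2 n3 z) =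
      ins3 v _ _ _ n1 n2 n3 (LinearMap.rTensor V R z) := by
    intro v z
    induction z using TensorProduct.induction_on with
    | zero => simp
    | add z w hz hw => simp only [map_add, hz, hw]
    | tmul y c =>
      induction y using TensorProduct.induction_on with
      | zero => simp
      | add z w hz hw => simp only [map_add, TensorProduct.add_tmul, hz, hw]
      | tmul a b =>
        rw [LinearMap.rTensor_tmul, ins3_tmul, ins3_tmul, ins_tmul, heckeOp_tprod, update_self,
          update_of_ne n1, update_self]
        generalize R (a ⊗ₜ[K] b) = z
        induction z using TensorProduct.induction_on with
        | zero => simp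
        | add z w hz hw => simp only [map_add, hz, hw]
        | tmul d e =>
          rw [ins_tmul, ins_tmul]
          congr 1
          funext x
          simp only [update_apply, Fin.ext_iff]
          split_ifs <;> first | rfl | (exfalso; omega)
  have k2 : ∀ (v : Fin n → V) z, heckeOp K V R n (i + 1) (by omega) (ins3 v _ _ _ n1 n2 n3 z) =
      ins3 v _ _ _ n1 n2 n3 ((TensorProduct.assoc K V V V).symm (LinearMap.lTensor V R
        (TensorProduct.assoc K V V V z))) := by
    intro v z
    induction z using TensorProduct.induction_on with
    | zero => simp
    | add z w hz hw => simp only [map_add, hz, hw]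
    | tmul y c =>
      induction y using TensorProduct.induction_on with
      | zero => simp
      | add z w hz hw => simp only [map_add, TensorProduct.add_tmul, hz, hw]
      | tmul a b =>
        rw [TensorProduct.assoc_tmul, LinearMap.lTensor_tmul, ins3_tmul, ins_tmul, heckeOp_tprod]
        rw [update_self, update_of_ne n3.symm, update_of_ne n2.symm, update_self]
        generalize R (b ⊗ₜ[K] c) = z
        induction z using TensorProduct.induction_on with
        | zero => simp
        | add z w hz hw => simp only [map_add, TensorProduct.tmul_add, hz, hw]
        | tmul d e =>
          rw [ins_tmul, TensorProduct.assoc_symm_tmul, ins3_tmul, ins_tmul]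
          congr 1
          funext x
          simp only [update_apply, Fin.ext_iff]
          split_ifs <;> first | rfl | (exfalso; omega)
  refine PiTensorProduct.ext (MultilinearMap.ext fun v => ?_)
  have hv : tprod K v = ins3 v _ _ _ n1 n2 n3 ((v ⟨i, by omega⟩ ⊗ₜ[K] v ⟨i + 1, by omega⟩) ⊗ₜ[K]
      v ⟨i + 2, by omega⟩) := by
    rw [ins3_tmul, ins_tmul]; simp
  simp only [LinearMap.compMultilinearMap_apply, Module.End.mul_apply]
  rw [hv]
  simp only [k1, k2]
  congr 1
  exact congrArg (fun f : (V ⊗[K] V) ⊗[K] V →ₗ[K] (V ⊗[K] V) ⊗[K] V =>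
    f ((v ⟨i, by omega⟩ ⊗ₜ[K] v ⟨i + 1, by omega⟩) ⊗ₜ[K] v ⟨i + 2, by omega⟩)) hR
end Tensor
end HeckeDC


/-- Theorem 1.1 (quantum double centralizer theorem): the image `A_n` of the Hecke
algebra in `End(V^{⊗n})` equals its own double centralizer. -/
theorem hecke_double_centralizer
    (K : Type*) [Field K] [CharZero K] (V : Type*) [AddCommGroup V] [Module K V]
    [FiniteDimensional K V] (q : K) (hq : q ≠ 0)
    (R : V ⊗[K] V →ₗ[K] V ⊗[K] V) (hR : IsHecke K V q R)
    (hqint : ∀ k : ℕ, 1 ≤ k → (∑ i ∈ Finset.range k, q ^ i) ≠ 0)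
    (n : ℕ) (hn : 2 ≤ n) :
    Subalgebra.centralizer K
        (Subalgebra.centralizer K
          ((heckeImage K V R n : Set (Module.End K (⨂[K] (_ : Fin n), V)))) :
          Set (Module.End K (⨂[K] (_ : Fin n), V))) =
      heckeImage K V R n := by
  let T : ℕ → Module.End K (⨂[K] (_ : Fin n), V) := fun i =>
    if h : i + 2 ≤ n then heckeOp K V R n i h else 0
  have hT : ∀ i (h : i + 2 ≤ n), T i = heckeOp K V R n i h := fun i h => dif_pos h
  have hrel : HeckeDC.HeckeRel q T (n - 1) := by
    refine ⟨fun i hi => ?_, fun i j hij hj => ?_, fun i hi => ?_⟩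
    · rw [hT i (by omega)]
      exact HeckeDC.heckeOp_quad q R hR n i _
    · rw [hT i (by omega), hT j (by omega)]
      exact HeckeDC.heckeOp_comm R n i j _ _ hij
    · rw [hT i (by omega), hT (i + 1) (by omega)]
      exact HeckeDC.heckeOp_braid R hR.1 n i (by omega)
  refine HeckeDC.double_centralizer_hecke hq hqint (n - 1) hrel _ ?_
  rw [heckeImage]
  congr 2
  funext i
  exact (hT i (by omega)).symm
end
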